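/- Let G be chosen uniformly at random from Φ(K_n^↔), and let ℰ be the event that for all distinct y, z ∈ [n], G contains a well-spread collection of at least n²/10⁵⁰ distinct (y,z)-bridging gadgets. Then there exist constants a > 0 and n₀ such that for all n ≥ n₀, P[ℰ] ≥ 1 − exp(−a·n²). -/

import Mathlib

open scoped Classical

noncomputable section

namespace RandomLatin

/-- `φ` is a proper `n`-arc-colouring of the complete digraph with loops on `Fin n`:
`φ i j` is the colour of the arc `i → j`, and no two arcs of the same colour share
a common tail or a common head. -/
def IsProper {n : ℕ} (φ : Fin n → Fin n → Fin n) : Prop :=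
  (∀ i j j' : Fin n, φ i j = φ i j' → j = j') ∧
  (∀ i i' j : Fin n, φ i j = φ i' j → i = i')

/-- The set `Φ(K_n^↔)` of proper `n`-arc-colourings of the complete digraph with loops. -/
abbrev Colouring (n : ℕ) : Type := {φ : Fin n → Fin n → Fin n // IsProper φ}

/-- `L` is an `n × n` Latin square with symbols `Fin n`. -/
def IsLatin {n : ℕ} (L : Fin n → Fin n → Fin n) : Prop :=
  (∀ i, Function.Bijective (L i)) ∧ (∀ j, Function.Bijective fun i => L i j)

abbrev LatinSquare (n : ℕ) : Type := {L : Fin n → Fin n → Fin n // IsLatin L}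

/-- The set of positions `{(i, σ i) : i}` is a (full) transversal of `L`. -/
def IsTransversal {n : ℕ} (L : Fin n → Fin n → Fin n) (σ : Equiv.Perm (Fin n)) : Prop :=
  Function.Bijective fun i => L i (σ i)

/-- A transversal is Hamilton if its arc set `{i → σ i}` is a directed Hamilton cycle. -/
def IsHamiltonTransversal {n : ℕ} (L : Fin n → Fin n → Fin n) (σ : Equiv.Perm (Fin n)) :
    Prop :=
  IsTransversal L σ ∧ σ.IsCycle ∧ σ.support = Finset.univ

def hamTransversalCount {n : ℕ} (L : Fin n → Fin n → Fin n) : ℕ :=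
  Nat.card {σ : Equiv.Perm (Fin n) // IsHamiltonTransversal L σ}

/-- The number of rainbow directed Hamilton cycles of a coloured `K_n^↔`. -/
def rainbowHamCycleCount {n : ℕ} (φ : Fin n → Fin n → Fin n) : ℕ :=
  Nat.card {σ : Equiv.Perm (Fin n) //
    Function.Injective (fun i => φ i (σ i)) ∧ σ.IsCycle ∧ σ.support = Finset.univ}

/-- The maximum number of appearances of a symbol on the leading diagonal. -/
def diagMax {n : ℕ} (L : Fin n → Fin n → Fin n) : ℕ :=
  Finset.univ.sup fun s : Fin n => (Finset.univ.filter fun i : Fin n => L i i = s).card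

/-! ### The spaces `𝒢_D` -/

/-- `𝒢_D`: proper arc-colourings, with colour set `D`, of spanning subdigraphs of `K_n^↔`
in which every vertex has in- and out-degree `|D|`.  `f d i` is the head of the unique
`d`-coloured arc with tail `i`. -/
def GD (n : ℕ) (D : Finset (Fin n)) : Type :=
  {f : {d : Fin n // d ∈ D} → Fin n → Fin n //
    (∀ d, Function.Bijective (f d)) ∧ ∀ i : Fin n, Function.Injective fun d => f d i}

/-- `comp H`: the number of completions of `H ∈ 𝒢_D` to an element of `Φ(K_n^↔)`,
i.e. the number of `g ∈ 𝒢_{Dᶜ}` whose arc set is disjoint from that of `H`. -/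
def completionCount {n : ℕ} {D : Finset (Fin n)} (H : GD n D) : ℕ :=
  Nat.card {g : GD n Dᶜ //
    ∀ (d : {d : Fin n // d ∈ D}) (d' : {d : Fin n // d ∈ Dᶜ}) (i : Fin n),
      H.1 d i ≠ g.1 d' i}

/-- `e_H(A₁, A₂)`: the number of arcs of `H` with tail in `A₁` and head in `A₂`. -/
def eArcs {n : ℕ} {D : Finset (Fin n)} (H : GD n D) (A₁ A₂ : Finset (Fin n)) : ℕ :=
  Nat.card {p : {d : Fin n // d ∈ D} × Fin n // p.2 ∈ A₁ ∧ H.1 p.1 p.2 ∈ A₂}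

/-! ### Absorbing gadgets -/

/-- A `(v,c)`-absorbing gadget, recorded by its vertices `x 0 = x₁, …, x 5 = x₆`. -/
def IsAbsGadget {n : ℕ} (φ : Fin n → Fin n → Fin n) (v c : Fin n) (x : Fin 6 → Fin n) :
    Prop :=
  ([v, x 0, x 1, x 2, x 3, x 4, x 5] : List (Fin n)).Nodup ∧
  φ (x 0) v = φ (x 3) (x 5) ∧
  φ v (x 1) = φ (x 2) (x 4) ∧
  φ (x 0) (x 1) = φ (x 2) (x 3) ∧
  φ (x 4) (x 5) = c ∧
  ([φ (x 0) v, φ v (x 1), φ (x 0) (x 1), c] : List (Fin n)).Nodup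

def absGadgetVerts {n : ℕ} (v : Fin n) (x : Fin 6 → Fin n) : Finset (Fin n) :=
  insert v (Finset.image x Finset.univ)

/-- The gadget contains an arc of colour `d`. -/
def absGadgetHasColour {n : ℕ} (φ : Fin n → Fin n → Fin n) (v : Fin n)
    (x : Fin 6 → Fin n) (d : Fin n) : Prop :=
  d = φ (x 0) v ∨ d = φ v (x 1) ∨ d = φ (x 0) (x 1) ∨ d = φ (x 2) (x 3) ∨
  d = φ (x 2) (x 4) ∨ d = φ (x 3) (x 5) ∨ d = φ (x 4) (x 5)

def WellSpreadAbsGadgets {n : ℕ} (φ : Fin n → Fin n → Fin n) (v c : Fin n)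
    (𝒜 : Finset (Fin 6 → Fin n)) : Prop :=
  (∀ u : Fin n, u ≠ v → (𝒜.filter fun x => u ∈ absGadgetVerts v x).card ≤ n) ∧
  (∀ d : Fin n, d ≠ c → (𝒜.filter fun x => absGadgetHasColour φ v x d).card ≤ n)

/-! ### Bridging gadgets (with respect to a full colouring) -/

/-- A `(y,z)`-bridging gadget, recorded by its vertices `w 0 = w₁, …, w 5 = w₆`. -/
def IsBridgeGadget {n : ℕ} (φ : Fin n → Fin n → Fin n) (y z : Fin n)
    (w : Fin 6 → Fin n) : Prop :=
  ([y, z, w 0, w 1, w 2, w 3, w 4, w 5] : List (Fin n)).Nodup ∧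
  φ y (w 0) = φ (w 5) (w 4) ∧
  φ (w 1) (w 0) = φ (w 5) z ∧
  φ (w 3) y = φ (w 1) (w 2) ∧
  φ (w 3) (w 4) = φ z (w 2) ∧
  ([φ y (w 0), φ (w 1) (w 0), φ (w 3) y, φ (w 3) (w 4)] : List (Fin n)).Nodup

def bridgeVerts {n : ℕ} (y z : Fin n) (w : Fin 6 → Fin n) : Finset (Fin n) :=
  insert y (insert z (Finset.image w Finset.univ))

def bridgeHasColour {n : ℕ} (φ : Fin n → Fin n → Fin n) (y z : Fin n)
    (w : Fin 6 → Fin n) (d : Fin n) : Prop :=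
  d = φ y (w 0) ∨ d = φ (w 1) (w 0) ∨ d = φ (w 1) (w 2) ∨ d = φ z (w 2) ∨
  d = φ (w 3) y ∨ d = φ (w 3) (w 4) ∨ d = φ (w 5) (w 4) ∨ d = φ (w 5) z

def WellSpreadBridgeGadgets {n : ℕ} (φ : Fin n → Fin n → Fin n) (y z : Fin n)
    (ℬ : Finset (Fin 6 → Fin n)) : Prop :=
  (∀ u : Fin n, u ≠ y → u ≠ z → (ℬ.filter fun w => u ∈ bridgeVerts y z w).card ≤ n) ∧
  (∀ d : Fin n, (ℬ.filter fun w => bridgeHasColour φ y z w d).card ≤ n)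


/-- The number of loops of colour `c`. -/
def loopCount {n : ℕ} (φ : Fin n → Fin n → Fin n) (c : Fin n) : ℕ :=
  Nat.card {i : Fin n // φ i i = c}

/-- For all `v, c`, a well-spread collection of at least `n²/2¹⁰⁰` `(v,c)`-absorbing
gadgets exists. -/
def HasAbsGadgets {n : ℕ} (φ : Fin n → Fin n → Fin n) : Prop :=
  ∀ v c : Fin n, ∃ 𝒜 : Finset (Fin 6 → Fin n),
    (∀ x ∈ 𝒜, IsAbsGadget φ v c x) ∧ WellSpreadAbsGadgets φ v c 𝒜 ∧
    (n : ℝ) ^ 2 / 2 ^ 100 ≤ 𝒜.card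

/-- For all distinct `y, z`, a well-spread collection of at least `n²/10⁵⁰`
`(y,z)`-bridging gadgets exists. -/
def HasBridgeGadgets {n : ℕ} (φ : Fin n → Fin n → Fin n) : Prop :=
  ∀ y z : Fin n, y ≠ z → ∃ ℬ : Finset (Fin 6 → Fin n),
    (∀ w ∈ ℬ, IsBridgeGadget φ y z w) ∧ WellSpreadBridgeGadgets φ y z ℬ ∧
    (n : ℝ) ^ 2 / 10 ^ 50 ≤ ℬ.card

/-! ### `(y,z,𝒫)`-bridges in `𝒢_D` -/

/-- `(D₁, …, D₆)` is an equitable ordered partition of `D` into six parts. -/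
def IsEquitableSixPartition {n : ℕ} (D : Finset (Fin n)) (P : Fin 6 → Finset (Fin n)) :
    Prop :=
  (∀ i, P i ⊆ D) ∧ (∀ i j, i ≠ j → Disjoint (P i) (P j)) ∧
  (Finset.univ.biUnion P = D) ∧ (∀ i j, (P i).card ≤ (P j).card + 1)

/-- A `(y,z,𝒫)`-bridge in `H ∈ 𝒢_D`. -/
def IsBridge {n : ℕ} {D : Finset (Fin n)} (H : GD n D) (y z : Fin n)
    (P : Fin 6 → Finset (Fin n)) (w : Fin 6 → Fin n) : Prop :=
  ([y, z, w 0, w 1, w 2, w 3, w 4, w 5] : List (Fin n)).Nodup ∧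
  ∃ d₁ d₂ d₃ d₄ d₅ d₆ : {d : Fin n // d ∈ D},
    (d₁ : Fin n) ∈ P 0 ∧ (d₂ : Fin n) ∈ P 1 ∧ (d₃ : Fin n) ∈ P 2 ∧
    (d₄ : Fin n) ∈ P 3 ∧ (d₅ : Fin n) ∈ P 4 ∧ (d₆ : Fin n) ∈ P 5 ∧
    H.1 d₁ y = w 0 ∧ H.1 d₁ (w 5) = w 4 ∧
    H.1 d₂ (w 1) = w 0 ∧ H.1 d₂ (w 5) = z ∧
    H.1 d₃ (w 3) = y ∧ H.1 d₃ (w 1) = w 2 ∧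
    H.1 d₄ (w 3) = w 4 ∧ H.1 d₄ z = w 2 ∧
    H.1 d₅ y = w 1 ∧ H.1 d₆ z = w 4

/-- The ten arcs of a `(y,z,𝒫)`-bridge. -/
def bridgeArcsOf {n : ℕ} (y z : Fin n) (w : Fin 6 → Fin n) : Finset (Fin n × Fin n) :=
  {(y, w 0), (w 1, w 0), (w 1, w 2), (z, w 2), (w 3, y), (w 3, w 4), (w 5, w 4), (w 5, z),
   (y, w 1), (z, w 4)}

/-- The four arcs `w₂→w₁, w₂→w₃, w₄→w₅, w₆→w₅` of a bridge. -/
def keyArcsOf {n : ℕ} (w : Fin 6 → Fin n) : Finset (Fin n × Fin n) :=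
  {(w 1, w 0), (w 1, w 2), (w 3, w 4), (w 5, w 4)}

/-- A distinguishable `(y,z,𝒫)`-bridge: the only bridge containing any of its four key arcs. -/
def IsDistinguishableBridge {n : ℕ} {D : Finset (Fin n)} (H : GD n D) (y z : Fin n)
    (P : Fin 6 → Finset (Fin n)) (w : Fin 6 → Fin n) : Prop :=
  IsBridge H y z P w ∧
  ∀ w' : Fin 6 → Fin n, IsBridge H y z P w' →
    ¬ Disjoint (keyArcsOf w) (bridgeArcsOf y z w') → w' = w

/-- `r_{(y,z,𝒫)}(H)`: the number of distinguishable `(y,z,𝒫)`-bridges in `H`. -/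
def distBridgeCount {n : ℕ} {D : Finset (Fin n)} (H : GD n D) (y z : Fin n)
    (P : Fin 6 → Finset (Fin n)) : ℕ :=
  Nat.card {w : Fin 6 → Fin n // IsDistinguishableBridge H y z P w}

/-- Membership in `Q̂_D^{(y,z,𝒫)} = ⋃_{s=0}^{n|D|} M_s^{(y,z,𝒫)}`. -/
def InQhat {n : ℕ} {D : Finset (Fin n)} (H : GD n D) (y z : Fin n)
    (P : Fin 6 → Finset (Fin n)) : Prop :=
  distBridgeCount H y z P ≤ n * D.card ∧
  ∀ A₁ A₂ : Finset (Fin n), A₁.card = D.card → A₂.card = D.card →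
    (eArcs H A₁ A₂ : ℝ) ≤ 2 * (D.card : ℝ) ^ 3 / n + 12 * distBridgeCount H y z P

/-- A `(y,z)`-bridging gadget of `H ∈ 𝒢_D`. -/
def IsBridgeGadgetGD {n : ℕ} {D : Finset (Fin n)} (H : GD n D) (y z : Fin n)
    (w : Fin 6 → Fin n) : Prop :=
  ([y, z, w 0, w 1, w 2, w 3, w 4, w 5] : List (Fin n)).Nodup ∧
  ∃ d₁ d₂ d₃ d₄ : {d : Fin n // d ∈ D},
    ([(d₁ : Fin n), (d₂ : Fin n), (d₃ : Fin n), (d₄ : Fin n)] : List (Fin n)).Nodup ∧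
    H.1 d₁ y = w 0 ∧ H.1 d₁ (w 5) = w 4 ∧
    H.1 d₂ (w 1) = w 0 ∧ H.1 d₂ (w 5) = z ∧
    H.1 d₃ (w 3) = y ∧ H.1 d₃ (w 1) = w 2 ∧
    H.1 d₄ (w 3) = w 4 ∧ H.1 d₄ z = w 2

/-- The gadget (in `H ∈ 𝒢_D`) contains an arc of colour `d`. -/
def bridgeGadgetGDHasColour {n : ℕ} {D : Finset (Fin n)} (H : GD n D) (y z : Fin n)
    (w : Fin 6 → Fin n) (d : Fin n) : Prop :=
  ∃ d' : {d : Fin n // d ∈ D}, (d' : Fin n) = d ∧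
    (H.1 d' y = w 0 ∨ H.1 d' (w 1) = w 0 ∨ H.1 d' (w 1) = w 2 ∨ H.1 d' z = w 2 ∨
     H.1 d' (w 3) = y ∨ H.1 d' (w 3) = w 4 ∨ H.1 d' (w 5) = w 4 ∨ H.1 d' (w 5) = z)

def WellSpreadBridgeGadgetsGD {n : ℕ} {D : Finset (Fin n)} (H : GD n D) (y z : Fin n)
    (ℬ : Finset (Fin 6 → Fin n)) : Prop :=
  (∀ u : Fin n, u ≠ y → u ≠ z → (ℬ.filter fun w => u ∈ bridgeVerts y z w).card ≤ n) ∧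
  (∀ d : Fin n, (ℬ.filter fun w => bridgeGadgetGDHasColour H y z w d).card ≤ n)

/-! ### Directed paths, absorbers, `T`-absorbers -/

/-- The arcs of the directed path whose vertices are the entries of `p`, in order. -/
def pathArcs {n : ℕ} (p : List (Fin n)) : List (Fin n × Fin n) := p.zip p.tail

def pathColours {n : ℕ} (φ : Fin n → Fin n → Fin n) (p : List (Fin n)) : List (Fin n) :=
  (pathArcs p).map fun e => φ e.1 e.2

def internalVerts {n : ℕ} (p : List (Fin n)) : List (Fin n) := (p.drop 1).dropLast

set_option maxHeartbeats 1600000 in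
/-- A `(v,c)`-absorber: a `(v,c)`-absorbing gadget with vertices `x`, bridged by an
`(x₄,x₅)`-bridging gadget with vertices `w`, completed by four rainbow directed paths. -/
structure Absorber (n : ℕ) (φ : Fin n → Fin n → Fin n) (v c : Fin n) where
  x : Fin 6 → Fin n
  w : Fin 6 → Fin n
  P : Fin 4 → List (Fin n)
  gadget : IsAbsGadget φ v c x
  bridge : IsBridgeGadget φ (x 3) (x 4) w
  meetAB : absGadgetVerts v x ∩ bridgeVerts (x 3) (x 4) w = {x 3, x 4}
  colourDisjointAB :
    ∀ d : Fin n, absGadgetHasColour φ v x d → bridgeHasColour φ (x 3) (x 4) w d → False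
  pathNodup : ∀ i, (P i).Nodup
  pathEnds :
    (P 0).head? = some (x 1) ∧ (P 0).getLast? = some (x 2) ∧
    (P 1).head? = some (w 0) ∧ (P 1).getLast? = some (w 3) ∧
    (P 2).head? = some (w 4) ∧ (P 2).getLast? = some (w 1) ∧
    (P 3).head? = some (w 2) ∧ (P 3).getLast? = some (w 5)
  pathsDisjoint : ∀ i j, i ≠ j → ∀ a ∈ P i, a ∉ P j
  pathInternalDisjoint : ∀ i, ∀ a ∈ internalVerts (P i),
    a ∉ absGadgetVerts v x ∧ a ∉ bridgeVerts (x 3) (x 4) w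
  pathsRainbowEach : ∀ i, (pathColours φ (P i)).Nodup
  pathsRainbowPair : ∀ i j, i ≠ j → ∀ d ∈ pathColours φ (P i), d ∉ pathColours φ (P j)
  pathColoursNew : ∀ i, ∀ d ∈ pathColours φ (P i),
    ¬ absGadgetHasColour φ v x d ∧ ¬ bridgeHasColour φ (x 3) (x 4) w d

def Absorber.arcs {n : ℕ} {φ : Fin n → Fin n → Fin n} {v c : Fin n}
    (A : Absorber n φ v c) : Finset (Fin n × Fin n) :=
  ({(A.x 0, v), (v, A.x 1), (A.x 0, A.x 1), (A.x 2, A.x 3), (A.x 2, A.x 4),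
    (A.x 3, A.x 5), (A.x 4, A.x 5)} : Finset (Fin n × Fin n)) ∪
  ({(A.x 3, A.w 0), (A.w 1, A.w 0), (A.w 1, A.w 2), (A.x 4, A.w 2), (A.w 3, A.x 3),
    (A.w 3, A.w 4), (A.w 5, A.w 4), (A.w 5, A.x 4)} : Finset (Fin n × Fin n)) ∪
  Finset.univ.biUnion fun i : Fin 4 => (pathArcs (A.P i)).toFinset

def Absorber.verts {n : ℕ} {φ : Fin n → Fin n → Fin n} {v c : Fin n}
    (A : Absorber n φ v c) : Finset (Fin n) :=
  absGadgetVerts v A.x ∪ bridgeVerts (A.x 3) (A.x 4) A.w ∪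
    Finset.univ.biUnion fun i : Fin 4 => (A.P i).toFinset

def Absorber.colours {n : ℕ} {φ : Fin n → Fin n → Fin n} {v c : Fin n}
    (A : Absorber n φ v c) : Finset (Fin n) :=
  A.arcs.image fun e => φ e.1 e.2

def Absorber.initial {n : ℕ} {φ : Fin n → Fin n → Fin n} {v c : Fin n}
    (A : Absorber n φ v c) : Fin n := A.x 0

def Absorber.terminal {n : ℕ} {φ : Fin n → Fin n → Fin n} {v c : Fin n}
    (A : Absorber n φ v c) : Fin n := A.x 5

/-- A `T`-absorber inside the coloured `K_n^↔`, with arc set `H`. -/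
structure TAbsorber (n : ℕ) (φ : Fin n → Fin n → Fin n) {α β : Type}
    [Fintype α] [Fintype β] [DecidableEq α] [DecidableEq β]
    (T : Finset (α × β)) (H : Finset (Fin n × Fin n)) where
  fV : α → Fin n
  fC : β → Fin n
  fVinj : Function.Injective fV
  fCinj : Function.Injective fC
  fCrange : ∀ b : β, fC b ∈ H.image fun e : Fin n × Fin n => φ e.1 e.2
  Ab : (e : α × β) → e ∈ T → Absorber n φ (fV e.1) (fC e.2)
  AbSub : ∀ e he, (Ab e he).arcs ⊆ H
  AbUnique : ∀ e he (A' : Absorber n φ (fV e.1) (fC e.2)),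
    A'.arcs ⊆ H → A'.arcs = (Ab e he).arcs
  AbVertexDisjoint : ∀ e he e' he', e ≠ e' →
    ∀ u : Fin n, u ∈ (Ab e he).verts → u ∈ (Ab e' he').verts → e.1 = e'.1 ∧ u = fV e.1
  AbColourDisjoint : ∀ e he e' he', e ≠ e' →
    ∀ d : Fin n, d ∈ (Ab e he).colours → d ∈ (Ab e' he').colours → e.2 = e'.2 ∧ d = fC e.2
  es : Fin T.card → α × β
  esInj : Function.Injective es
  esMem : ∀ i, es i ∈ T
  link : Fin (T.card - 1) → List (Fin n)
  linkLen : ∀ i, (link i).length = 4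
  linkNodup : ∀ i, (link i).Nodup
  linkSub : ∀ i, ∀ e ∈ pathArcs (link i), e ∈ H
  linkPairwiseDisjoint : ∀ i j, i ≠ j → ∀ a ∈ link i, a ∉ link j
  linkRainbowEach : ∀ i, (pathColours φ (link i)).Nodup
  linkRainbowPair : ∀ i j, i ≠ j → ∀ d ∈ pathColours φ (link i), d ∉ pathColours φ (link j)
  linkColourNew : ∀ i, ∀ d ∈ pathColours φ (link i), ∀ e he, d ∉ (Ab e he).colours
  linkHead : ∀ i : Fin (T.card - 1),
    (link i).head? = some (Ab (es (Fin.castLE (Nat.sub_le _ _) i)) (esMem _)).terminal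
  linkLast : ∀ i : Fin (T.card - 1),
    (link i).getLast? =
      some (Ab (es ⟨i.1 + 1, by have := i.2; omega⟩) (esMem _)).initial
  linkInternalDisjoint : ∀ i, ∀ a ∈ internalVerts (link i), ∀ e he, a ∉ (Ab e he).verts
  minimal : H = (T.attach.biUnion fun e => (Ab e.1 e.2).arcs) ∪
      (Finset.univ.biUnion fun i => (pathArcs (link i)).toFinset)

def TAbsorber.initialVtx {n : ℕ} {φ : Fin n → Fin n → Fin n} {α β : Type}
    [Fintype α] [Fintype β] [DecidableEq α] [DecidableEq β]
    {T : Finset (α × β)} {H : Finset (Fin n × Fin n)} (𝔸 : TAbsorber n φ T H)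
    (h : 0 < T.card) : Fin n :=
  (𝔸.Ab (𝔸.es ⟨0, h⟩) (𝔸.esMem _)).initial

def TAbsorber.terminalVtx {n : ℕ} {φ : Fin n → Fin n → Fin n} {α β : Type}
    [Fintype α] [Fintype β] [DecidableEq α] [DecidableEq β]
    {T : Finset (α × β)} {H : Finset (Fin n × Fin n)} (𝔸 : TAbsorber n φ T H)
    (h : 0 < T.card) : Fin n :=
  (𝔸.Ab (𝔸.es ⟨T.card - 1, Nat.sub_lt h Nat.one_pos⟩) (𝔸.esMem _)).terminal

/-- `T` (bipartite, edge set a finset of `α × β`) is robustly matchable with respect to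
flexible sets `A'`, `B'`. -/
def RobustlyMatchable {α β : Type} [DecidableEq α] [DecidableEq β]
    (T : Finset (α × β)) (A' : Finset α) (B' : Finset β) : Prop :=
  ∀ X : Finset α, ∀ Y : Finset β, X ⊆ A' → Y ⊆ B' → X.card = Y.card →
    (X.card : ℝ) ≤ min ((A'.card : ℝ) / 2) ((B'.card : ℝ) / 2) →
    ∃ M : Finset (α × β), M ⊆ T ∧ (∀ e ∈ M, e.1 ∉ X ∧ e.2 ∉ Y) ∧
      (∀ a : α, a ∉ X → ∃! e, e ∈ M ∧ e.1 = a) ∧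
      (∀ b : β, b ∉ Y → ∃! e, e ∈ M ∧ e.2 = b)

def arcVerts {n : ℕ} (H : Finset (Fin n × Fin n)) : Finset (Fin n) :=
  H.image Prod.fst ∪ H.image Prod.snd

/-- `H` (an arc set in the coloured `K_n^↔`) is robustly rainbow-Hamiltonian with respect
to flexible sets `Vf`, `Cf` and initial and terminal vertices `u`, `v`. -/
def RobustlyRainbowHam {n : ℕ} (φ : Fin n → Fin n → Fin n) (H : Finset (Fin n × Fin n))
    (Vf Cf : Finset (Fin n)) (u v : Fin n) : Prop :=
  ∀ X Y : Finset (Fin n), X ⊆ Vf → Y ⊆ Cf → X.card = Y.card →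
    (X.card : ℝ) ≤ min ((Vf.card : ℝ) / 2) ((Cf.card : ℝ) / 2) →
    ∃ p : List (Fin n), p.Nodup ∧ p.head? = some u ∧ p.getLast? = some v ∧
      (∀ e ∈ pathArcs p, e ∈ H) ∧
      (∀ a ∈ p, a ∉ X) ∧
      p.toFinset = arcVerts H \ X ∧
      (pathColours φ p).Nodup ∧
      (∀ d ∈ pathColours φ p, d ∉ Y)

/-! ### Lower-quasirandomness and rainbow directed path forests -/

/-- `e_{G,D}(U₁,U₂)`: the number of arcs with tail in `U₁`, head in `U₂`, colour in `D`. -/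
def colArcCount {n : ℕ} (φ : Fin n → Fin n → Fin n) (U₁ U₂ D : Finset (Fin n)) : ℕ :=
  Nat.card {p : Fin n × Fin n // p.1 ∈ U₁ ∧ p.2 ∈ U₂ ∧ φ p.1 p.2 ∈ D}

def LowerQuasirandom {n : ℕ} (φ : Fin n → Fin n → Fin n) : Prop :=
  ∀ U₁ U₂ D : Finset (Fin n),
    (U₁.card : ℝ) * U₂.card * D.card / n - (n : ℝ) ^ (5 / 3 : ℝ) ≤ colArcCount φ U₁ U₂ D

/-- The arc set `Q` contains a directed cycle (a loop counts as a cycle of length one). -/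
def HasDiCycle {n : ℕ} (Q : Finset (Fin n × Fin n)) : Prop :=
  ∃ (a : Fin n) (l : List (Fin n)), (a :: l).Nodup ∧
    List.Chain (fun u v : Fin n => (u, v) ∈ Q) a l ∧
    ((a :: l).getLast (List.cons_ne_nil a l), a) ∈ Q

/-- `Q` is (the arc set of) a spanning rainbow directed path forest of `G − U`, using no
colour of `D`, with at most `n^{9/10}` components. -/
def IsGoodPathForest {n : ℕ} (φ : Fin n → Fin n → Fin n) (U D : Finset (Fin n))
    (Q : Finset (Fin n × Fin n)) : Prop :=
  (∀ e ∈ Q, e.1 ∉ U ∧ e.2 ∉ U) ∧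
  (∀ e ∈ Q, ∀ e' ∈ Q, e ≠ e' → e.1 ≠ e'.1 ∧ e.2 ≠ e'.2) ∧
  ¬ HasDiCycle Q ∧
  Set.InjOn (fun e : Fin n × Fin n => φ e.1 e.2) (Q : Set (Fin n × Fin n)) ∧
  (∀ e ∈ Q, φ e.1 e.2 ∉ D) ∧
  ((n : ℝ) - U.card - Q.card ≤ (n : ℝ) ^ (9 / 10 : ℝ))


/-! ### A lower bound for permanents -/

lemma Polynomial_coeff_one_eq (R : Polynomial ℂ) :
    R.coeff 1 = R.eval 0 * (R.roots.map fun ρ => -ρ⁻¹).sum ∨ R.eval 0 = 0 := by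
  by_cases h : R.eval 0 = 0
  · exact Or.inr h
  left
  have h1 : R.derivative.eval 0 = R.coeff 1 := by
    rw [← Polynomial.coeff_zero_eq_eval_zero, Polynomial.coeff_derivative]; simp
  rw [← h1, (IsAlgClosed.splits R).eval_derivative_eq_eval_mul_sum h]
  congr 3
  funext z
  rw [zero_sub, one_div, inv_neg]

lemma coeff_one_ne_zero_of_roots_re_neg (R : Polynomial ℂ) (hdeg : R.natDegree ≠ 0)
    (hR : ∀ z : ℂ, 0 ≤ z.re → R.eval z ≠ 0) : R.coeff 1 ≠ 0 := by
  have h0 : R.eval 0 ≠ 0 := hR 0 (by simp)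
  have hne : R ≠ 0 := by rintro rfl; simp at h0
  rcases Polynomial_coeff_one_eq R with h | h
  swap
  · exact absurd h h0
  rw [h]
  refine mul_ne_zero h0 ?_
  have hcard : R.roots ≠ 0 :=
    (IsAlgClosed.splits R).roots_ne_zero hdeg
  have key : 0 < ((R.roots.map fun ρ => -ρ⁻¹).sum).re := by
    have : ((R.roots.map fun ρ => -ρ⁻¹).sum).re = (R.roots.map fun ρ : ℂ => (-ρ⁻¹).re).sum := by
      have := map_multiset_sum Complex.reAddGroupHom (R.roots.map fun ρ : ℂ => -ρ⁻¹)
      simpa [Multiset.map_map] using this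
    rw [this]
    have hpos : ∀ ρ ∈ R.roots, 0 < (-ρ⁻¹).re := by
      intro ρ hρ
      have hρ0 : R.eval ρ = 0 := (Polynomial.mem_roots hne).1 hρ
      have hneg : ρ.re < 0 := by
        by_contra hc
        exact hR ρ (not_lt.1 hc) hρ0
      have hρne : ρ ≠ 0 := by rintro rfl; simp at hneg
      rw [Complex.neg_re, Complex.inv_re]
      have : 0 < Complex.normSq ρ := Complex.normSq_pos.2 hρne
      have : ρ.re / Complex.normSq ρ < 0 := div_neg_of_neg_of_pos hneg this
      linarith
    obtain ⟨ρ₀, hρ₀⟩ := Multiset.exists_mem_of_ne_zero hcard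
    obtain ⟨s, hs⟩ := Multiset.exists_cons_of_mem hρ₀
    rw [hs] at hpos ⊢
    rw [Multiset.map_cons, Multiset.sum_cons]
    refine add_pos_of_pos_of_nonneg (hpos _ (Multiset.mem_cons_self _ _)) ?_
    refine Multiset.sum_nonneg ?_
    intro x hx
    obtain ⟨ρ, hρ, rfl⟩ := Multiset.mem_map.1 hx
    exact (hpos ρ (Multiset.mem_cons_of_mem hρ)).le
  intro hz
  rw [hz] at key
  simp at key

lemma norm_eval_le_exp (R : Polynomial ℂ)
    (hR : ∀ z : ℂ, R.eval z = 0 → z.im = 0 ∧ z.re < 0) (t : ℝ) (ht : 0 ≤ t) :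
    ‖R.eval (t : ℂ)‖ ≤ ‖R.eval 0‖ * Real.exp (t * (‖R.coeff 1‖ / ‖R.eval 0‖)) := by
  have h0 : R.eval 0 ≠ 0 := fun h => by simpa using (hR 0 h).2
  have hne : R ≠ 0 := by rintro rfl; simp at h0
  have hroot : ∀ ρ ∈ R.roots, ρ ≠ 0 ∧ ρ = -(‖ρ‖ : ℂ) := by
    intro ρ hρ
    have hh := hR ρ ((Polynomial.mem_roots hne).1 hρ)
    have h1 : ρ = (ρ.re : ℂ) := by
      apply Complex.ext <;> simp [hh.1]
    refine ⟨by rintro rfl; simpa using hh.2, ?_⟩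
    rw [h1, Complex.norm_real, Real.norm_eq_abs, abs_of_neg hh.2]
    simp
  have hsum : ‖R.coeff 1‖ / ‖R.eval 0‖ = (R.roots.map fun ρ => ‖ρ‖⁻¹).sum := by
    rcases Polynomial_coeff_one_eq R with h | h
    swap
    · exact absurd h h0
    rw [h, norm_mul, mul_div_cancel_left₀ _ (norm_ne_zero_iff.2 h0)]
    have : (R.roots.map fun ρ => -ρ⁻¹).sum = (((R.roots.map fun ρ => ‖ρ‖⁻¹).sum : ℝ) : ℂ) := by
      have := map_multiset_sum Complex.ofRealHom (R.roots.map fun ρ : ℂ => ‖ρ‖⁻¹)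
      rw [Multiset.map_map] at this
      rw [Complex.ofRealHom_eq_coe] at this
      rw [this]
      congr 1
      apply Multiset.map_congr rfl
      intro ρ hρ
      have := (hroot ρ hρ).2
      conv_lhs => rw [this]
      simp
    rw [this, Complex.norm_real, Real.norm_eq_abs, abs_of_nonneg]
    refine Multiset.sum_nonneg ?_
    intro x hx
    obtain ⟨ρ, hρ, rfl⟩ := Multiset.mem_map.1 hx
    positivity
  rw [hsum]
  have hs := IsAlgClosed.splits R
  rw [hs.eval_eq_prod_roots, hs.eval_eq_prod_roots, norm_mul, norm_mul, mul_assoc]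
  refine mul_le_mul_of_nonneg_left ?_ (norm_nonneg _)
  have gen : ∀ s : Multiset ℂ, (∀ ρ ∈ s, ρ ≠ 0 ∧ ρ = -(‖ρ‖ : ℂ)) →
      ‖(s.map ((t : ℂ) - ·)).prod‖ ≤
        ‖(s.map ((0 : ℂ) - ·)).prod‖ * Real.exp (t * (s.map fun ρ => ‖ρ‖⁻¹).sum) := by
    intro s
    induction s using Multiset.induction_on with
    | empty => simp
    | cons a s ih =>
      intro hs
      have ih' := ih fun ρ hρ => hs ρ (Multiset.mem_cons_of_mem hρ)
      have ha := hs a (Multiset.mem_cons_self _ _)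
      simp only [Multiset.map_cons, Multiset.prod_cons, Multiset.sum_cons, norm_mul, mul_add,
        Real.exp_add]
      have hna : 0 < ‖a‖ := norm_pos_iff.2 ha.1
      have h1 : ‖(t : ℂ) - a‖ ≤ ‖(0 : ℂ) - a‖ * Real.exp (t * ‖a‖⁻¹) := by
        have e1 : ‖(t : ℂ) - a‖ ≤ t + ‖a‖ := by
          refine (norm_sub_le _ _).trans ?_
          simp [abs_of_nonneg ht]
        have e2 := Real.add_one_le_exp (t * ‖a‖⁻¹)
        have e3 : t + ‖a‖ = ‖a‖ * (t * ‖a‖⁻¹ + 1) := by field_simp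
        rw [zero_sub, norm_neg]
        calc _ ≤ _ := e1
          _ = _ := e3
          _ ≤ _ := by gcongr
      calc _ ≤ (‖(0 : ℂ) - a‖ * Real.exp (t * ‖a‖⁻¹)) *
            (‖(s.map ((0 : ℂ) - ·)).prod‖ * Real.exp (t * (s.map fun ρ => ‖ρ‖⁻¹).sum)) := by
              gcongr
        _ = _ := by ring
  exact gen _ hroot

/-- Nonvanishing on the closed right half-space away from the imaginary subspace. -/
def HStable {n : ℕ} (p : MvPolynomial (Fin n) ℂ) : Prop :=
  ∀ z : Fin n → ℂ, (∀ i, 0 ≤ (z i).re) → (∃ i, 0 < (z i).re) → MvPolynomial.eval z p ≠ 0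

lemma eval_smul_of_isHomogeneous {n d : ℕ} {p : MvPolynomial (Fin n) ℂ}
    (hp : p.IsHomogeneous d) (c : ℂ) (z : Fin n → ℂ) :
    MvPolynomial.eval (fun i => c * z i) p = c ^ d * MvPolynomial.eval z p := by
  rw [MvPolynomial.eval_eq, MvPolynomial.eval_eq, Finset.mul_sum]
  refine Finset.sum_congr rfl fun m hm => ?_
  have hd : ∑ i, m i = d := by
    have := hp (MvPolynomial.mem_support_iff.1 hm)
    rw [← this, Finsupp.weight_apply, Finsupp.sum_fintype] <;> simp
  simp only [mul_pow, Finset.prod_mul_distrib, Finset.prod_pow_eq_pow_sum]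
  rw [← hd, ← Finset.sum_subset (Finset.subset_univ m.support)]
  · ring
  · intro i _ hi
    simpa using hi

lemma HStable.coeff_one {n : ℕ} {p : MvPolynomial (Fin (n + 2)) ℂ}
    (hp : p.IsHomogeneous (n + 2)) (hst : HStable p) :
    HStable ((MvPolynomial.finSuccEquiv ℂ (n + 1) p).coeff 1) := by
  intro z hz hz'
  set R := Polynomial.map (MvPolynomial.eval z) (MvPolynomial.finSuccEquiv ℂ (n + 1) p) with hR
  have hRev : ∀ t, R.eval t = MvPolynomial.eval (Fin.cons t z : Fin (n + 2) → ℂ) p := fun t =>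
    (MvPolynomial.eval_eq_eval_mv_eval' z t p).symm
  have hc : MvPolynomial.eval z ((MvPolynomial.finSuccEquiv ℂ (n + 1) p).coeff 1) = R.coeff 1 := by
    rw [hR, Polynomial.coeff_map]
  rw [hc]
  refine coeff_one_ne_zero_of_roots_re_neg R ?_ ?_
  · intro hdeg
    set q := (MvPolynomial.finSuccEquiv ℂ (n + 1) p).coeff (n + 2) with hq
    have hqh : q.IsHomogeneous 0 := hp.finSuccEquiv_coeff_isHomogeneous (n + 2) 0 rfl
    have h1 : MvPolynomial.eval z q = 0 := by
      have : R.coeff (n + 2) = 0 := Polynomial.coeff_eq_zero_of_natDegree_lt (by omega)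
      rwa [hR, Polynomial.coeff_map] at this
    have h2 : MvPolynomial.eval (fun _ => (0 : ℂ)) q = 0 := by
      have := eval_smul_of_isHomogeneous hqh 0 z
      simpa [h1] using this
    set R0 := Polynomial.map (MvPolynomial.eval fun _ => (0 : ℂ))
      (MvPolynomial.finSuccEquiv ℂ (n + 1) p) with hR0
    have hR0ev : ∀ t, R0.eval t =
        MvPolynomial.eval (Fin.cons t (fun _ => 0) : Fin (n + 2) → ℂ) p := fun t =>
      (MvPolynomial.eval_eq_eval_mv_eval' _ t p).symm
    set c := MvPolynomial.eval (Fin.cons 1 (fun _ => 0) : Fin (n + 2) → ℂ) p with hcdef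
    have hcne : c ≠ 0 := by
      refine hst _ (fun i => ?_) ⟨0, by simp⟩
      refine Fin.cases ?_ (fun j => ?_) i <;> simp
    have hR0eq : R0 = Polynomial.C c * Polynomial.X ^ (n + 2) := by
      apply Polynomial.funext
      intro t
      rw [hR0ev]
      have := eval_smul_of_isHomogeneous hp t (Fin.cons 1 (fun _ => 0) : Fin (n + 2) → ℂ)
      have he : (fun i => t * (Fin.cons 1 (fun _ => 0) : Fin (n + 2) → ℂ) i) =
          (Fin.cons t (fun _ => 0) : Fin (n + 2) → ℂ) := by
        funext i
        refine Fin.cases ?_ (fun j => ?_) i <;> simp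
      rw [he] at this
      rw [this, Polynomial.eval_mul, Polynomial.eval_C, Polynomial.eval_pow, Polynomial.eval_X,
        mul_comm]
    have : R0.coeff (n + 2) = c := by rw [hR0eq]; simp
    rw [hR0, Polynomial.coeff_map] at this
    exact hcne (this.symm.trans h2)
  · intro t ht
    rw [hRev]
    obtain ⟨i, hi⟩ := hz'
    refine hst _ (fun j => ?_) ⟨i.succ, by simpa using hi⟩
    refine Fin.cases ?_ (fun j => ?_) j
    · simpa using ht
    · simpa using hz j

lemma HStable.roots_real_neg {n : ℕ} {p : MvPolynomial (Fin (n + 2)) ℂ}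
    (hp : p.IsHomogeneous (n + 2)) (hst : HStable p) (x : Fin (n + 1) → ℝ) (hx : ∀ i, 0 < x i)
    (t : ℂ) (ht : MvPolynomial.eval (Fin.cons t (fun i => (x i : ℂ)) : Fin (n + 2) → ℂ) p = 0) :
    t.im = 0 ∧ t.re < 0 := by
  have hre : t.re < 0 := by
    by_contra hc
    refine hst _ (fun j => ?_) ⟨(0 : Fin (n + 1)).succ, by simpa using hx 0⟩ ht
    refine Fin.cases ?_ (fun j => ?_) j
    · simpa using hc
    · simpa using (hx j).le
  refine ⟨?_, hre⟩
  by_contra him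
  set c : ℂ := ⟨t.im ^ 2 / (-t.re), -t.im⟩ with hc
  have hcre : 0 < c.re := by
    have : 0 < t.im ^ 2 := by positivity
    exact div_pos this (by linarith)
  have h0 := eval_smul_of_isHomogeneous hp c (Fin.cons t (fun i => (x i : ℂ)) : Fin (n + 2) → ℂ)
  rw [ht, mul_zero] at h0
  refine hst _ (fun j => ?_) ⟨(0 : Fin (n + 1)).succ, ?_⟩ h0
  · refine Fin.cases ?_ (fun j => ?_) j
    · have : (c * t).re = 0 := by
        rw [Complex.mul_re, hc]
        have : t.re ≠ 0 := hre.ne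
        field_simp
        ring
      simp [this]
    · simpa using (mul_pos hcre (hx j)).le
  · simpa using mul_pos hcre (hx 0)

/-- Gurvits' capacity inequality. -/
lemma norm_coeff_ones_ge (n : ℕ) : ∀ p : MvPolynomial (Fin (n + 1)) ℂ,
    p.IsHomogeneous (n + 1) → HStable p → ∀ K : ℝ,
    (∀ x : Fin (n + 1) → ℝ, (∀ i, 0 < x i) →
      K * ∏ i, x i ≤ ‖MvPolynomial.eval (fun i => (x i : ℂ)) p‖) →
    K * Real.exp (-(n + 1 : ℝ)) ≤
      ‖p.coeff (Finsupp.equivFunOnFinite.symm fun _ => 1)‖ := by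
  induction n with
  | zero =>
    intro p hp _ K hK
    have h1 := hK (fun _ => 1) (by simp)
    have h2 : MvPolynomial.eval (fun _ => ((1 : ℝ) : ℂ)) p =
        p.coeff (Finsupp.equivFunOnFinite.symm fun _ => 1) := by
      rw [MvPolynomial.eval_eq]
      simp only [Complex.ofReal_one, one_pow, Finset.prod_const_one, mul_one]
      have hsub : p.support ⊆ {Finsupp.equivFunOnFinite.symm fun _ => 1} := by
        intro m hm
        have := hp (MvPolynomial.mem_support_iff.1 hm)
        rw [Finsupp.weight_apply, Finsupp.sum_fintype _ _ (by simp)] at this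
        simp at this
        rw [Finset.mem_singleton]
        ext i
        have hi : i = 0 := by omega
        simp [hi, this]
      rw [Finset.sum_subset hsub, Finset.sum_singleton]
      intro m _ hm
      simpa using hm
    simp only [Finset.prod_const_one, mul_one] at h1
    rw [h2] at h1
    by_cases hK0 : 0 ≤ K
    · refine le_trans ?_ h1
      have : Real.exp (-((0 : ℕ) + 1 : ℝ)) ≤ 1 := by
        rw [Real.exp_le_one_iff]; simp
      nlinarith
    · refine le_trans ?_ (norm_nonneg _)
      exact mul_nonpos_of_nonpos_of_nonneg (not_le.1 hK0).le (Real.exp_pos _).le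
  | succ n ih =>
    intro p hp hst K hK
    set q := (MvPolynomial.finSuccEquiv ℂ (n + 1) p).coeff 1 with hq
    have hqh : q.IsHomogeneous (n + 1) :=
      hp.finSuccEquiv_coeff_isHomogeneous 1 (n + 1) (by ring)
    have hqs : HStable q := HStable.coeff_one hp hst
    have key := ih q hqh hqs (K * Real.exp (-1)) ?_
    · have hcoef : q.coeff (Finsupp.equivFunOnFinite.symm fun _ => 1) =
          p.coeff (Finsupp.equivFunOnFinite.symm fun _ => 1) := by
        rw [hq, MvPolynomial.finSuccEquiv_coeff_coeff]
        congr 1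
        ext i
        refine Fin.cases ?_ (fun j => ?_) i <;> simp
      rw [hcoef] at key
      refine le_trans (le_of_eq ?_) key
      rw [mul_assoc, ← Real.exp_add]
      congr 2
      push_cast
      ring
    · intro x hx
      set R := Polynomial.map (MvPolynomial.eval fun i => (x i : ℂ))
        (MvPolynomial.finSuccEquiv ℂ (n + 1) p) with hR
      have hRev : ∀ t, R.eval t =
          MvPolynomial.eval (Fin.cons t (fun i => (x i : ℂ)) : Fin (n + 2) → ℂ) p := fun t =>
        (MvPolynomial.eval_eq_eval_mv_eval' _ t p).symm
      have hRr : ∀ z, R.eval z = 0 → z.im = 0 ∧ z.re < 0 := fun z hz =>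
        HStable.roots_real_neg hp hst x hx z (by rw [← hRev, hz])
      have hR1 : R.coeff 1 = MvPolynomial.eval (fun i => (x i : ℂ)) q := by
        rw [hR, Polynomial.coeff_map]
      have hR1ne : R.coeff 1 ≠ 0 := by
        rw [hR1]
        exact hqs _ (fun i => by simpa using (hx i).le) ⟨0, by simpa using hx 0⟩
      have hR0ne : R.eval 0 ≠ 0 := fun h => by simpa using (hRr 0 h).2
      have p1 : 0 < ‖R.coeff 1‖ := norm_pos_iff.2 hR1ne
      have p0 : 0 < ‖R.eval 0‖ := norm_pos_iff.2 hR0ne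
      set t : ℝ := ‖R.eval 0‖ / ‖R.coeff 1‖ with ht
      have htpos : 0 < t := div_pos p0 p1
      have h1 := norm_eval_le_exp R hRr t htpos.le
      have h2 : t * (‖R.coeff 1‖ / ‖R.eval 0‖) = 1 := by rw [ht]; field_simp
      rw [h2] at h1
      have h3 := hK (Fin.cons t x) (fun i => by
        refine Fin.cases ?_ (fun j => ?_) i
        · simpa using htpos
        · simpa using hx j)
      have h4 : (fun i => (((Fin.cons t x : Fin (n + 2) → ℝ) i : ℝ) : ℂ)) =
          (Fin.cons (t : ℂ) (fun i => (x i : ℂ)) : Fin (n + 2) → ℂ) := by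
        funext i
        refine Fin.cases ?_ (fun j => ?_) i <;> simp
      rw [h4, ← hRev, Fin.prod_univ_succ] at h3
      simp only [Fin.cons_zero, Fin.cons_succ] at h3
      rw [← hR1]
      have h5 := h3.trans h1
      have h6 : ‖R.eval 0‖ = t * ‖R.coeff 1‖ := by rw [ht]; field_simp
      rw [h6] at h5
      have h7 : K * ∏ i, x i ≤ ‖R.coeff 1‖ * Real.exp 1 := by
        refine le_of_mul_le_mul_left ?_ htpos
        calc _ = _ := by ring
          _ ≤ _ := h5
          _ = _ := by ring
      rw [Real.exp_neg]
      have he := Real.exp_pos 1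
      rw [mul_right_comm, ← div_eq_mul_inv, div_le_iff₀ he]
      exact h7

lemma capacity_ge {N : ℕ} (a : Fin N → Fin N → ℝ) (S : ℝ) (hS : 0 < S)
    (ha : ∀ i j, 0 ≤ a i j) (hrow : ∀ i, ∑ j, a i j = S) (hcol : ∀ j, ∑ i, a i j = S)
    (x : Fin N → ℝ) (hx : ∀ i, 0 < x i) :
    S ^ N * ∏ i, x i ≤ ∏ i, ∑ j, a i j * x j := by
  have h1 : ∀ i, S * ∏ j, x j ^ (a i j / S) ≤ ∑ j, a i j * x j := by
    intro i
    have := Real.geom_mean_le_arith_mean_weighted Finset.univ (fun j => a i j / S) x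
      (fun j _ => div_nonneg (ha i j) hS.le)
      (by rw [← Finset.sum_div, hrow, div_self hS.ne']) (fun j _ => (hx j).le)
    calc _ ≤ S * ∑ j, a i j / S * x j := mul_le_mul_of_nonneg_left this hS.le
      _ = _ := by
        rw [Finset.mul_sum]
        refine Finset.sum_congr rfl fun j _ => ?_
        field_simp
  have h2 : ∏ i, (S * ∏ j, x j ^ (a i j / S)) = S ^ N * ∏ i, x i := by
    rw [Finset.prod_mul_distrib, Finset.prod_const, Finset.card_univ, Fintype.card_fin,
      Finset.prod_comm]
    congr 1
    refine Finset.prod_congr rfl fun j _ => ?_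
    rw [← Real.rpow_sum_of_pos (hx j), ← Finset.sum_div, hcol, div_self hS.ne', Real.rpow_one]
  rw [← h2]
  refine Finset.prod_le_prod (fun i _ => ?_) fun i _ => h1 i
  exact mul_nonneg hS.le (Finset.prod_nonneg fun j _ => (Real.rpow_pos_of_pos (hx j) _).le)

lemma permanent_ge_of_pos {n : ℕ} (a : Fin (n + 1) → Fin (n + 1) → ℝ) (S : ℝ)
    (ha : ∀ i j, 0 < a i j) (hrow : ∀ i, ∑ j, a i j = S) (hcol : ∀ j, ∑ i, a i j = S) :
    S ^ (n + 1) * Real.exp (-(n + 1 : ℝ)) ≤ ∑ σ : Equiv.Perm (Fin (n + 1)), ∏ i, a i (σ i) := by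
  have hS : 0 < S := by
    rw [← hrow 0]
    exact Finset.sum_pos (fun j _ => ha 0 j) Finset.univ_nonempty
  set p : MvPolynomial (Fin (n + 1)) ℂ :=
    ∏ i, ∑ j, MvPolynomial.C (a i j : ℂ) * MvPolynomial.X j with hp
  have hev : ∀ z, MvPolynomial.eval z p = ∏ i, ∑ j, (a i j : ℂ) * z j := by
    intro z; simp [hp]
  have hhom : p.IsHomogeneous (n + 1) := by
    have := MvPolynomial.IsHomogeneous.prod Finset.univ
      (fun i => ∑ j, MvPolynomial.C (a i j : ℂ) * MvPolynomial.X (R := ℂ) j) (fun _ => 1)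
      (fun i _ => MvPolynomial.IsHomogeneous.sum _ _ _ fun j _ => by
        simpa using (MvPolynomial.isHomogeneous_C _ (a i j : ℂ)).mul
          (MvPolynomial.isHomogeneous_X ℂ j))
    simpa using this
  have hst : HStable p := by
    rintro z hz ⟨j0, hj0⟩
    rw [hev]
    refine Finset.prod_ne_zero_iff.2 fun i _ h0 => ?_
    have h1 : (∑ j, (a i j : ℂ) * z j).re = ∑ j, a i j * (z j).re := by
      rw [Complex.re_sum]; simp
    have h2 : 0 < ∑ j, a i j * (z j).re :=
      Finset.sum_pos' (fun j _ => mul_nonneg (ha i j).le (hz j))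
        ⟨j0, Finset.mem_univ _, mul_pos (ha i j0) hj0⟩
    rw [← h1, h0] at h2
    simp at h2
  have hcap := norm_coeff_ones_ge n p hhom hst (S ^ (n + 1)) (fun x hx => by
    rw [hev]
    have h1 : (∏ i, ∑ j, (a i j : ℂ) * (x j : ℂ)) = ((∏ i, ∑ j, a i j * x j : ℝ) : ℂ) := by
      push_cast; rfl
    rw [h1, Complex.norm_real]
    exact (capacity_ge a S hS (fun i j => (ha i j).le) hrow hcol x hx).trans (le_abs_self _))
  refine hcap.trans ?_
  have hexp : p = ∑ g : Fin (n + 1) → Fin (n + 1),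
      MvPolynomial.monomial (∑ i, Finsupp.single (g i) 1) (∏ i, (a i (g i) : ℂ)) := by
    rw [hp, Finset.prod_univ_sum, Fintype.piFinset_univ]
    refine Finset.sum_congr rfl fun g _ => ?_
    rw [MvPolynomial.monomial_sum_prod]
    refine Finset.prod_congr rfl fun i _ => ?_
    rw [MvPolynomial.C_mul_X_eq_monomial]
  rw [hexp, MvPolynomial.coeff_sum]
  have hprod : ∀ g : Fin (n + 1) → Fin (n + 1), 0 ≤ ∏ i, a i (g i) := fun g =>
    Finset.prod_nonneg fun i _ => (ha i (g i)).le
  have hterm : ∀ g : Fin (n + 1) → Fin (n + 1),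
      ‖MvPolynomial.coeff (Finsupp.equivFunOnFinite.symm fun _ => 1)
        (MvPolynomial.monomial (∑ i, Finsupp.single (g i) 1) (∏ i, (a i (g i) : ℂ)))‖ ≤
      if Function.Bijective g then ∏ i, a i (g i) else 0 := by
    intro g
    rw [MvPolynomial.coeff_monomial]
    split_ifs with h1 h2 h2
    · rw [← Complex.ofReal_prod, Complex.norm_real, Real.norm_eq_abs, abs_of_nonneg (hprod g)]
    · exfalso
      refine h2 (Finite.surjective_iff_bijective.1 fun j => ?_)
      have h3 := DFunLike.congr_fun h1 j
      rw [Finsupp.finsetSum_apply] at h3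
      by_contra hc
      push Not at hc
      simp [hc] at h3
    · simpa using hprod g
    · simp
  refine (norm_sum_le _ _).trans ((Finset.sum_le_sum fun g _ => hterm g).trans ?_)
  rw [← Finset.sum_filter]
  have hsub : Finset.univ.filter (fun g : Fin (n + 1) → Fin (n + 1) => Function.Bijective g) ⊆
      Finset.univ.image (fun σ : Equiv.Perm (Fin (n + 1)) => (σ : Fin (n + 1) → Fin (n + 1))) := by
    intro g hg
    rw [Finset.mem_image]
    exact ⟨Equiv.ofBijective g (Finset.mem_filter.1 hg).2, Finset.mem_univ _, rfl⟩
  refine (Finset.sum_le_sum_of_subset_of_nonneg hsub fun g _ _ => hprod g).trans (le_of_eq ?_)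
  rw [Finset.sum_image]
  intro σ _ τ _ h
  exact Equiv.coe_fn_injective h

/-- A `k`-regular bipartite graph with parts of size `N` has at least `(k/e)^N` perfect
matchings. -/
lemma card_perfect_matchings_ge {N k : ℕ} (A : Fin N → Fin N → Prop)
    (hrow : ∀ i, (Finset.univ.filter fun j => A i j).card = k)
    (hcol : ∀ j, (Finset.univ.filter fun i => A i j).card = k) :
    ((k : ℝ) * Real.exp (-1)) ^ N ≤
      ((Finset.univ.filter fun σ : Equiv.Perm (Fin N) => ∀ i, A i (σ i)).card : ℝ) := by
  rcases N with _ | n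
  · simp
  have hper : ∑ σ : Equiv.Perm (Fin (n + 1)), ∏ i, (if A i (σ i) then (1 : ℝ) else 0) =
      ((Finset.univ.filter fun σ : Equiv.Perm (Fin (n + 1)) => ∀ i, A i (σ i)).card : ℝ) := by
    rw [Finset.card_filter]
    push_cast
    refine Finset.sum_congr rfl fun σ _ => ?_
    rw [Finset.prod_ite_zero]
    simp
  rw [← hper]
  have hle : ∀ ε : ℝ, 0 < ε → ((k : ℝ) + (n + 1) * ε) ^ (n + 1) * Real.exp (-(n + 1 : ℝ)) ≤
      ∑ σ : Equiv.Perm (Fin (n + 1)), ∏ i, ((if A i (σ i) then (1 : ℝ) else 0) + ε) := by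
    intro ε hε
    refine permanent_ge_of_pos (fun i j => (if A i j then (1 : ℝ) else 0) + ε) _ ?_ ?_ ?_
    · intro i j
      positivity
    · intro i
      rw [Finset.sum_add_distrib, ← hrow i, Finset.card_filter]
      simp
    · intro j
      rw [Finset.sum_add_distrib, ← hcol j, Finset.card_filter]
      simp
  have hl : Filter.Tendsto
      (fun ε : ℝ => ((k : ℝ) + (n + 1) * ε) ^ (n + 1) * Real.exp (-(n + 1 : ℝ)))
      (nhdsWithin 0 (Set.Ioi 0))
      (nhds (((k : ℝ) + (n + 1) * 0) ^ (n + 1) * Real.exp (-(n + 1 : ℝ)))) := by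
    refine (Continuous.tendsto ?_ 0).mono_left nhdsWithin_le_nhds
    fun_prop
  have hr : Filter.Tendsto
      (fun ε : ℝ => ∑ σ : Equiv.Perm (Fin (n + 1)), ∏ i, ((if A i (σ i) then (1 : ℝ) else 0) + ε))
      (nhdsWithin 0 (Set.Ioi 0))
      (nhds (∑ σ : Equiv.Perm (Fin (n + 1)), ∏ i, ((if A i (σ i) then (1 : ℝ) else 0) + 0))) := by
    refine (Continuous.tendsto ?_ 0).mono_left nhdsWithin_le_nhds
    fun_prop
  have := le_of_tendsto_of_tendsto hl hr (eventually_nhdsWithin_of_forall fun ε hε => hle ε hε)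
  simp only [mul_zero, add_zero] at this
  refine le_trans (le_of_eq ?_) this
  rw [mul_pow, ← Real.exp_nat_mul]
  congr 2
  push_cast
  ring

/-! ### A lower bound for the number of Latin squares -/

/-- Sequences of `m` pairwise disjoint permutations, i.e. `m × n` Latin rectangles. -/
def latinRectangles (n m : ℕ) : Finset (Fin m → Equiv.Perm (Fin n)) :=
  Finset.univ.filter fun f => ∀ j, Function.Injective fun i => f i j

lemma card_latinRectangles_succ (n m : ℕ) :
    ((latinRectangles n m).card : ℝ) * (((n - m : ℕ) : ℝ) * Real.exp (-1)) ^ n ≤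
      ((latinRectangles n (m + 1)).card : ℝ) := by
  set E : (Fin m → Equiv.Perm (Fin n)) → Finset (Equiv.Perm (Fin n)) := fun f =>
    Finset.univ.filter fun σ => ∀ j, ∀ i, f i j ≠ σ j with hE
  have hext : ∀ f ∈ latinRectangles n m,
      (((n - m : ℕ) : ℝ) * Real.exp (-1)) ^ n ≤ ((E f).card : ℝ) := by
    intro f hf
    have hf' := (Finset.mem_filter.1 hf).2
    have hcompl : ∀ g : Fin m → Fin n, Function.Injective g →
        (Finset.univ.filter fun j => ∀ i, g i ≠ j).card = n - m := by
      intro g hg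
      have h1 : (Finset.univ.filter fun j => ∀ i, g i ≠ j) = (Finset.univ.image g)ᶜ := by
        ext j; simp
      rw [h1, Finset.card_compl, Finset.card_image_of_injective _ hg]
      simp
    have hmain := card_perfect_matchings_ge (k := n - m) (fun j s => ∀ i, f i j ≠ s)
      (fun j => by convert hcompl _ (hf' j)) fun s => ?_
    · convert hmain
    rw [← hcompl (fun i => (f i).symm s) ?_]
    · congr 1
      ext j
      simp only [Finset.mem_filter, Finset.mem_univ, true_and, ne_eq, Equiv.symm_apply_eq]
      exact forall_congr' fun i => not_congr eq_comm
    · intro i i' h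
      refine hf' ((f i).symm s) ?_
      have h' : (f i).symm s = (f i').symm s := h
      show f i ((f i).symm s) = f i' ((f i).symm s)
      rw [h', Equiv.apply_symm_apply, ← h', Equiv.apply_symm_apply]
  have hcard : ((latinRectangles n m).sigma E).card ≤ (latinRectangles n (m + 1)).card := by
    refine Finset.card_le_card_of_injOn
      (fun p => (Fin.cons p.2 p.1 : Fin (m + 1) → Equiv.Perm (Fin n))) ?_ ?_
    · rintro ⟨f, σ⟩ hp
      obtain ⟨hf, hσ⟩ := Finset.mem_sigma.1 hp
      have hf' := (Finset.mem_filter.1 hf).2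
      have hσ' := (Finset.mem_filter.1 hσ).2
      refine Finset.mem_filter.2 ⟨Finset.mem_univ _, fun j i i' => ?_⟩
      refine Fin.cases ?_ (fun i => ?_) i <;> refine Fin.cases ?_ (fun i' => ?_) i'
      · simp
      · intro h
        exact absurd h.symm (by simpa using hσ' j i')
      · intro h
        exact absurd h (by simpa using hσ' j i)
      · intro h
        exact congrArg Fin.succ (hf' j (by simpa using h))
    · rintro ⟨f, σ⟩ _ ⟨f', σ'⟩ _ h
      obtain ⟨h1, h2⟩ := Fin.cons_injective2 h
      subst h1 h2
      rfl
  have h2 : ((latinRectangles n m).card : ℝ) * (((n - m : ℕ) : ℝ) * Real.exp (-1)) ^ n ≤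
      (((latinRectangles n m).sigma E).card : ℝ) := by
    rw [Finset.card_sigma, ← nsmul_eq_mul]
    push_cast
    exact Finset.card_nsmul_le_sum _ _ _ hext
  exact h2.trans (by exact_mod_cast hcard)

lemma card_latinRectangles_ge (n m : ℕ) :
    ((n.descFactorial m : ℝ)) ^ n * Real.exp (-1) ^ (n * m) ≤
      ((latinRectangles n m).card : ℝ) := by
  induction m with
  | zero =>
    have : (latinRectangles n 0).Nonempty :=
      ⟨default, Finset.mem_filter.2 ⟨Finset.mem_univ _, fun _ i => i.elim0⟩⟩
    simpa using this
  | succ m ih =>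
    refine le_trans ?_ (card_latinRectangles_succ n m)
    refine le_trans (le_of_eq ?_) (mul_le_mul_of_nonneg_right ih (by positivity))
    rw [Nat.descFactorial_succ, Nat.mul_succ, pow_add]
    push_cast
    ring

lemma card_colouring_ge (n : ℕ) (hn : 0 < n) :
    Real.exp ((n : ℝ) ^ 2 * (Real.log n - 2)) ≤ (Fintype.card (Colouring n) : ℝ) := by
  have h1 := card_latinRectangles_ge n n
  rw [Nat.descFactorial_self] at h1
  have hn' : (0 : ℝ) < n := by exact_mod_cast hn
  have hfac : (n : ℝ) ^ n * Real.exp (-(n : ℝ)) ≤ (n.factorial : ℝ) := by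
    have := Real.pow_div_factorial_le_exp (x := (n : ℝ)) hn'.le n
    rw [div_le_iff₀ (by positivity)] at this
    rw [Real.exp_neg, ← div_eq_mul_inv, div_le_iff₀ (Real.exp_pos _)]
    linarith
  have h2 : Real.exp ((n : ℝ) ^ 2 * (Real.log n - 2)) =
      ((n : ℝ) ^ n * Real.exp (-(n : ℝ))) ^ n * Real.exp (-1) ^ (n * n) := by
    have : (n : ℝ) ^ n = Real.exp (n * Real.log n) := by
      rw [Real.exp_nat_mul, Real.exp_log hn']
    rw [this, ← Real.exp_add, ← Real.exp_nat_mul, ← Real.exp_nat_mul, ← Real.exp_add]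
    congr 1
    push_cast
    ring
  rw [h2]
  refine le_trans (mul_le_mul_of_nonneg_right (pow_le_pow_left₀ (by positivity) hfac n)
    (by positivity)) (h1.trans ?_)
  have h3 : (latinRectangles n n).card ≤ Fintype.card (Colouring n) := by
    rw [← Fintype.card_coe]
    refine Fintype.card_le_of_injective
      (fun f => (⟨fun i j => f.1 i j, ?_, ?_⟩ : Colouring n)) ?_
    · intro i j j' h
      exact (f.1 i).injective h
    · intro i i' j h
      exact (Finset.mem_filter.1 f.2).2 j h
    · intro f g h
      apply Subtype.ext
      funext i
      ext j
      have := congrFun (congrFun (Subtype.ext_iff.1 h) i) j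
      exact congrArg Fin.val this
  exact_mod_cast h3

/-! ### Sequential encodings -/

lemma card_mul_sum_eq_sum_update {C S : Type*} [Fintype C] [DecidableEq C] [Fintype S] (e : C)
    (H : (C → S) → ℝ) :
    (Fintype.card S : ℝ) * ∑ X, H X = ∑ X, ∑ s, H (Function.update X e s) := by
  have h1 : ∀ s, ∀ K : (C → S) → ℝ, ∑ X : C → S, K (Function.update X e s) =
      ∑ X : C → S, ∑ _s' : S, if X e = s then K X else 0 := by
    intro s K
    rw [Finset.sum_comm]
    have : ∀ s', ∑ X : C → S, (if X e = s then K X else 0) =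
        ∑ X : C → S, if X e = s' then K (Function.update X e s) else 0 := by
      intro s'
      rw [← Finset.sum_filter, ← Finset.sum_filter]
      refine Finset.sum_bij' (fun X _ => Function.update X e s')
        (fun X _ => Function.update X e s) ?_ ?_ ?_ ?_ ?_
      · simp
      · simp
      · intro X hX
        simp [← (Finset.mem_filter.1 hX).2]
      · intro X hX
        simp [← (Finset.mem_filter.1 hX).2]
      · intro X hX
        simp [← (Finset.mem_filter.1 hX).2]
    rw [Finset.sum_congr rfl fun s' _ => this s', Finset.sum_comm]
    simp
  rw [Finset.sum_comm, Finset.sum_congr rfl fun s _ => h1 s H, Finset.sum_comm, Finset.mul_sum]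
  refine Finset.sum_congr rfl fun X _ => ?_
  rw [Finset.sum_comm]
  simp

/-- Kraft's inequality for a sequential encoding in which the symbol at `e` is encoded with
knowledge of the symbols at the positions preceding `e`. -/
lemma sum_prod_le_one {C S : Type*} [Fintype C] [DecidableEq C] [Fintype S] [Nonempty S] (τ : C → ℕ)
    (q : C → (C → S) → S → ℝ) (hq : ∀ e X s, 0 ≤ q e X s)
    (hdep : ∀ e X X', (∀ e', τ e' < τ e → X e' = X' e') → q e X = q e X')
    (hsum : ∀ e X, ∑ s, q e X s ≤ 1) :
    ∑ X : C → S, ∏ e, q e X (X e) ≤ 1 := by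
  have hN : (0 : ℝ) < Fintype.card S := by exact_mod_cast Fintype.card_pos
  have key : ∀ T : Finset C, (Fintype.card S : ℝ) ^ T.card * ∑ X : C → S, ∏ e ∈ T, q e X (X e) ≤
      (Fintype.card S : ℝ) ^ Fintype.card C := by
    intro T
    induction T using Finset.induction_on_max_value τ with
    | empty => simp
    | insert e₀ T he hmax ih =>
      refine le_trans ?_ ih
      rw [Finset.card_insert_of_notMem he, pow_succ, mul_assoc]
      refine mul_le_mul_of_nonneg_left ?_ (by positivity)
      rw [card_mul_sum_eq_sum_update e₀]
      refine Finset.sum_le_sum fun X _ => ?_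
      have h1 : ∀ s, ∏ e ∈ insert e₀ T, q e (Function.update X e₀ s) (Function.update X e₀ s e) =
          q e₀ X s * ∏ e ∈ T, q e X (X e) := by
        intro s
        rw [Finset.prod_insert he]
        congr 1
        · rw [Function.update_self]
          refine congrFun (hdep _ _ _ fun e' he' => ?_) s
          rw [Function.update_of_ne]
          rintro rfl
          exact lt_irrefl _ he'
        · refine Finset.prod_congr rfl fun e heT => ?_
          rw [Function.update_of_ne (fun h => he (by rwa [h] at heT))]
          refine congrFun (hdep _ _ _ fun e' he' => ?_) _
          rw [Function.update_of_ne]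
          rintro rfl
          exact absurd (hmax e heT) (not_le.2 he')
      simp_rw [h1]
      rw [← Finset.sum_mul]
      exact mul_le_of_le_one_left (Finset.prod_nonneg fun e _ => hq _ _ _) (hsum e₀ X)
  have := key Finset.univ
  rw [Finset.card_univ] at this
  exact le_of_mul_le_mul_left (by simpa using this) (pow_pos hN (Fintype.card C))

/-! ### Independent uniform labels, conditioned on the label of one position -/

def fibre {C : Type*} [Fintype C] [DecidableEq C] {M : ℕ} (e : C) (t : Fin M) :
    Finset (C → Fin M) :=
  Finset.univ.filter fun τ => τ e = t

def relTime {M : ℕ} (t : Fin M) : ℝ := (t : ℝ) / M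

lemma relTime_nonneg {M : ℕ} (t : Fin M) : 0 ≤ relTime t := by unfold relTime; positivity

lemma relTime_lt_one {M : ℕ} (t : Fin M) : relTime t < 1 := by
  have h : (t : ℝ) < M := by exact_mod_cast t.2
  have : (0 : ℝ) < M := lt_of_le_of_lt (by positivity) h
  rw [relTime, div_lt_one this]
  exact h

lemma card_fibre_filter {C : Type*} [Fintype C] [DecidableEq C] {M : ℕ} (e : C) (t : Fin M)
    (S₁ S₂ : Finset C) (h : Disjoint S₁ S₂) (h₁ : e ∉ S₁) (h₂ : e ∉ S₂) :
    (((fibre e t).filter fun τ => (∀ x ∈ S₁, τ x < t) ∧ ∀ x ∈ S₂, t ≤ τ x).card : ℝ) =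
      (fibre e t).card * (relTime t ^ S₁.card * (1 - relTime t) ^ S₂.card) := by
  have hM : (0 : ℝ) < M := by exact_mod_cast t.pos
  set P : C → Finset (Fin M) := fun x => if x = e then {t} else
    if x ∈ S₁ then Finset.Iio t else if x ∈ S₂ then Finset.Ici t else Finset.univ with hP
  have e1 : ((fibre e t).filter fun τ => (∀ x ∈ S₁, τ x < t) ∧ ∀ x ∈ S₂, t ≤ τ x) =
      Fintype.piFinset P := by
    ext τ
    simp only [fibre, Finset.mem_filter, Finset.mem_univ, true_and, Fintype.mem_piFinset, hP]
    constructor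
    · rintro ⟨ha, hb, hc⟩ x
      split_ifs with h1 h2 h3
      · simp [h1, ha]
      · simpa using hb x h2
      · simpa using hc x h3
      · simp
    · intro hx
      refine ⟨by simpa using hx e, fun x hx1 => ?_, fun x hx2 => ?_⟩
      · have hne : x ≠ e := fun hh => h₁ (hh ▸ hx1)
        simpa [hne, hx1] using hx x
      · have hne : x ≠ e := fun hh => h₂ (hh ▸ hx2)
        have hn1 : x ∉ S₁ := fun hh => (Finset.disjoint_left.1 h) hh hx2
        simpa [hne, hn1, hx2] using hx x
  have e2 : fibre e t = Fintype.piFinset fun x => if x = e then {t} else Finset.univ := by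
    ext τ
    simp only [fibre, Finset.mem_filter, Finset.mem_univ, true_and, Fintype.mem_piFinset]
    constructor
    · intro ha x
      split_ifs with h1
      · simp [h1, ha]
      · simp
    · intro hx
      simpa using hx e
  rw [e1, e2, Fintype.card_piFinset, Fintype.card_piFinset]
  have e3 : ∀ (S : Finset C) (c : ℝ), c ^ S.card = ∏ x, if x ∈ S then c else 1 := by
    intro S c
    rw [Finset.prod_ite_mem, Finset.univ_inter, Finset.prod_const]
  rw [e3 S₁, e3 S₂]
  push_cast
  rw [← Finset.prod_mul_distrib, ← Finset.prod_mul_distrib]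
  refine Finset.prod_congr rfl fun x _ => ?_
  simp only [hP]
  by_cases hxe : x = e
  · subst hxe
    simp [h₁, h₂]
  · simp only [hxe, if_false]
    by_cases hx1 : x ∈ S₁
    · have hx2 : x ∉ S₂ := (Finset.disjoint_left.1 h) hx1
      simp only [hx1, hx2, if_true, if_false, relTime, Fin.card_Iio, Finset.card_univ,
        Fintype.card_fin]
      field_simp
    · by_cases hx2 : x ∈ S₂
      · simp only [hx1, hx2, if_true, if_false, relTime, Fin.card_Ici, Finset.card_univ,
          Fintype.card_fin]
        rw [Nat.cast_sub t.2.le]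
        field_simp
      · simp [hx1, hx2]

lemma card_fibre_filter_ge {C : Type*} [Fintype C] [DecidableEq C] {M : ℕ} (e : C) (t : Fin M)
    (S₁ S₂ : Finset C) (h : Disjoint S₁ S₂) (h₁ : e ∉ S₁) {a b : ℕ}
    (ha : S₁.card ≤ a) (hb : S₂.card ≤ b) :
    (fibre e t).card * (relTime t ^ a * (1 - relTime t) ^ b) ≤
      (((fibre e t).filter fun τ => (∀ x ∈ S₁, τ x < t) ∧ ∀ x ∈ S₂, t ≤ τ x).card : ℝ) := by
  have h0 := relTime_nonneg t
  have h1 := relTime_lt_one t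
  have heq : ((fibre e t).filter fun τ => (∀ x ∈ S₁, τ x < t) ∧ ∀ x ∈ S₂, t ≤ τ x) =
      (fibre e t).filter fun τ => (∀ x ∈ S₁, τ x < t) ∧ ∀ x ∈ S₂.erase e, t ≤ τ x := by
    refine Finset.filter_congr fun τ hτ => and_congr_right fun _ => ?_
    have hτe : τ e = t := (Finset.mem_filter.1 hτ).2
    refine ⟨fun hh x hx => hh x (Finset.mem_of_mem_erase hx), fun hh x hx => ?_⟩
    by_cases hxe : x = e
    · rw [hxe, hτe]
    · exact hh x (Finset.mem_erase.2 ⟨hxe, hx⟩)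
  rw [heq, card_fibre_filter e t S₁ (S₂.erase e) (h.mono_right (Finset.erase_subset _ _)) h₁
    (Finset.notMem_erase _ _)]
  refine mul_le_mul_of_nonneg_left ?_ (by positivity)
  have hb' : (S₂.erase e).card ≤ b := (Finset.card_le_card (Finset.erase_subset _ _)).trans hb
  exact mul_le_mul (pow_le_pow_of_le_one h0 h1.le ha)
    (pow_le_pow_of_le_one (by linarith) (by linarith) hb') (pow_nonneg (by linarith) _)
    (pow_nonneg h0 _)

abbrev Cell (n : ℕ) : Type := Fin n × Fin n

/-- The square `X` is Latin. -/
def Proper {n : ℕ} (X : Cell n → Fin n) : Prop := IsProper fun i j => X (i, j)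

/-- The symbols not excluded at `e` by the earlier entries of the row and the column of `e`. -/
def avail {n M : ℕ} (τ : Cell n → Fin M) (e : Cell n) (X : Cell n → Fin n) : Finset (Fin n) :=
  Finset.univ.filter fun s => ∀ e', (e'.1 = e.1 ∨ e'.2 = e.2) → τ e' < τ e → X e' ≠ s

def PastDependent {n M : ℕ} {α : Type*}
    (w : (Cell n → Fin M) → Cell n → (Cell n → Fin n) → α) : Prop :=
  ∀ τ e X X', (∀ e', τ e' < τ e → X e' = X' e') → w τ e X = w τ e X'

lemma Proper.row {n : ℕ} {X : Cell n → Fin n} (hX : Proper X) {r c c' : Fin n}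
    (h : X (r, c) = X (r, c')) : c = c' := hX.1 r c c' h

lemma Proper.col {n : ℕ} {X : Cell n → Fin n} (hX : Proper X) {r r' c : Fin n}
    (h : X (r, c) = X (r', c)) : r = r' := hX.2 r r' c h

lemma Proper.exists_col {n : ℕ} {X : Cell n → Fin n} (hX : Proper X) (r s : Fin n) :
    ∃ c, X (r, c) = s :=
  (Finite.injective_iff_surjective.1 fun _ _ h => hX.row h) s

lemma Proper.exists_row {n : ℕ} {X : Cell n → Fin n} (hX : Proper X) (c s : Fin n) :
    ∃ r, X (r, c) = s :=
  (Finite.injective_iff_surjective.1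
    (show Function.Injective fun r => X (r, c) from fun _ _ h => hX.col h)) s

lemma Proper.mem_avail {n M : ℕ} {X : Cell n → Fin n} (hX : Proper X) (τ : Cell n → Fin M)
    (e : Cell n) : X e ∈ avail τ e X := by
  refine Finset.mem_filter.2 ⟨Finset.mem_univ _, ?_⟩
  rintro ⟨r', c'⟩ h hlt heq
  obtain ⟨r, c⟩ := e
  have : ((r', c') : Cell n) = (r, c) := by
    rcases h with h | h
    · dsimp only at h; subst h; rw [hX.row heq]
    · dsimp only at h; subst h; rw [hX.col heq]
  rw [this] at hlt
  exact lt_irrefl _ hlt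

lemma avail_congr {n M : ℕ} : PastDependent (avail (n := n) (M := M)) := by
  intro τ e X X' h
  refine Finset.filter_congr fun s _ => ?_
  refine forall_congr' fun e' => forall_congr' fun _ => forall_congr' fun h2 => ?_
  rw [h e' h2]

lemma sum_exp_le_one {n M : ℕ} (𝓧 : Finset (Cell n → Fin n)) (h𝓧 : ∀ X ∈ 𝓧, Proper X)
    (w : (Cell n → Fin M) → Cell n → (Cell n → Fin n) → Fin n → ℝ)
    (hw : ∀ τ e X s, 0 < w τ e X s) (hdep : PastDependent w) (τ : Cell n → Fin M) :
    ∑ X ∈ 𝓧, Real.exp (∑ e, (Real.log (w τ e X (X e)) -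
      Real.log (∑ s ∈ avail τ e X, w τ e X s))) ≤ 1 := by
  rcases Nat.eq_zero_or_pos n with rfl | hn
  · refine (Finset.sum_le_sum_of_subset_of_nonneg (Finset.subset_univ 𝓧)
      fun _ _ _ => (Real.exp_pos _).le).trans ?_
    simp
  have : Nonempty (Fin n) := ⟨⟨0, hn⟩⟩
  set q : Cell n → (Cell n → Fin n) → Fin n → ℝ := fun e X s =>
    if s ∈ avail τ e X then w τ e X s / ∑ s ∈ avail τ e X, w τ e X s else 0 with hqdef
  have hW : ∀ e X, 0 ≤ ∑ s ∈ avail τ e X, w τ e X s := fun e X =>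
    Finset.sum_nonneg fun s _ => (hw τ e X s).le
  have hq : ∀ e X s, 0 ≤ q e X s := by
    intro e X s
    simp only [hqdef]
    split_ifs
    · exact div_nonneg (hw τ e X s).le (hW e X)
    · exact le_rfl
  have hk := sum_prod_le_one (fun e => (τ e : ℕ)) q hq (fun e X X' h => by
      funext s
      simp only [hqdef]
      rw [avail_congr τ e X X' h, hdep τ e X X' h])
    (fun e X => by
      simp only [hqdef]
      rw [← Finset.sum_filter, Finset.filter_mem_eq_inter, Finset.univ_inter, ← Finset.sum_div]
      exact div_self_le_one _)
  refine le_trans ?_ hk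
  refine le_trans ?_ (Finset.sum_le_sum_of_subset_of_nonneg (Finset.subset_univ 𝓧)
    fun X _ _ => Finset.prod_nonneg fun e _ => hq e X (X e))
  refine Finset.sum_le_sum fun X hX => le_of_eq ?_
  rw [Real.exp_sum]
  refine Finset.prod_congr rfl fun e _ => ?_
  have hmem := (h𝓧 X hX).mem_avail τ e
  have hpos : 0 < ∑ s ∈ avail τ e X, w τ e X s :=
    Finset.sum_pos (fun s _ => hw τ e X s) ⟨_, hmem⟩
  simp only [hqdef, hmem, if_true]
  rw [Real.exp_sub, Real.exp_log (hw _ _ _ _), Real.exp_log hpos]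

lemma card_le_exp_of_average {n M : ℕ} (hM : 0 < M) (𝓧 : Finset (Cell n → Fin n))
    (h𝓧 : ∀ X ∈ 𝓧, Proper X)
    (w : (Cell n → Fin M) → Cell n → (Cell n → Fin n) → Fin n → ℝ)
    (hw : ∀ τ e X s, 0 < w τ e X s) (hdep : PastDependent w) (B : ℝ)
    (hB : ∀ X ∈ 𝓧, ∑ τ : Cell n → Fin M, ∑ e, (Real.log (∑ s ∈ avail τ e X, w τ e X s) -
      Real.log (w τ e X (X e))) ≤ Fintype.card (Cell n → Fin M) * B) :
    (𝓧.card : ℝ) ≤ Real.exp B := by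
  have : Nonempty (Fin M) := ⟨⟨0, hM⟩⟩
  have hΩ : (0 : ℝ) < Fintype.card (Cell n → Fin M) := by exact_mod_cast Fintype.card_pos
  set f : (Cell n → Fin M) → (Cell n → Fin n) → ℝ := fun τ X =>
    ∑ e, (Real.log (w τ e X (X e)) - Real.log (∑ s ∈ avail τ e X, w τ e X s)) with hf
  have h1 : ∑ τ, ∑ X ∈ 𝓧, Real.exp (f τ X) ≤ Fintype.card (Cell n → Fin M) := by
    refine (Finset.sum_le_sum fun τ _ => sum_exp_le_one 𝓧 h𝓧 w hw hdep τ).trans ?_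
    simp
  have h2 : ∀ X ∈ 𝓧, Fintype.card (Cell n → Fin M) * Real.exp (-B) ≤
      ∑ τ, Real.exp (f τ X) := by
    intro X hX
    have h3 : ∑ τ, Real.exp (-B) * (f τ X + B + 1) ≤ ∑ τ, Real.exp (f τ X) := by
      refine Finset.sum_le_sum fun τ _ => ?_
      calc Real.exp (-B) * (f τ X + B + 1) ≤ Real.exp (-B) * Real.exp (f τ X + B) :=
            mul_le_mul_of_nonneg_left (Real.add_one_le_exp _) (Real.exp_pos _).le
        _ = _ := by rw [← Real.exp_add]; congr 1; ring
    refine le_trans ?_ h3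
    rw [← Finset.mul_sum, Finset.sum_add_distrib, Finset.sum_add_distrib, mul_comm]
    refine mul_le_mul_of_nonneg_left ?_ (Real.exp_pos _).le
    have h4 : ∑ τ, f τ X = -∑ τ : Cell n → Fin M, ∑ e,
        (Real.log (∑ s ∈ avail τ e X, w τ e X s) - Real.log (w τ e X (X e))) := by
      rw [← Finset.sum_neg_distrib]
      refine Finset.sum_congr rfl fun τ _ => ?_
      rw [← Finset.sum_neg_distrib]
      exact Finset.sum_congr rfl fun e _ => by ring
    have h5 := hB X hX
    rw [h4]
    simp only [Finset.sum_const, Finset.card_univ, nsmul_eq_mul]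
    linarith
  have h6 : 𝓧.card * (Fintype.card (Cell n → Fin M) * Real.exp (-B)) ≤
      Fintype.card (Cell n → Fin M) := by
    rw [← nsmul_eq_mul]
    refine (Finset.card_nsmul_le_sum _ _ _ h2).trans ?_
    rw [Finset.sum_comm]
    exact h1
  rw [Real.exp_neg] at h6
  have h7 : (𝓧.card : ℝ) * (Real.exp B)⁻¹ ≤ 1 := by
    refine le_of_mul_le_mul_left ?_ hΩ
    calc _ = _ := by ring
      _ ≤ _ := h6
      _ = _ := (mul_one _).symm
  rwa [← div_eq_mul_inv, div_le_one (Real.exp_pos _)] at h7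

lemma sum_card_avail_le {n M : ℕ} {X : Cell n → Fin n} (hX : Proper X) (e : Cell n)
    (t : Fin M) :
    ∑ τ ∈ fibre e t, ((avail τ e X).card : ℝ) ≤
      (fibre e t).card * (n * (1 - relTime t) ^ 2 + 1) := by
  have h1 : ∑ τ ∈ fibre e t, ((avail τ e X).card : ℝ) =
      ∑ s, (((fibre e t).filter fun τ => s ∈ avail τ e X).card : ℝ) := by
    have : ∀ τ : Cell n → Fin M, ((avail τ e X).card : ℝ) =
        ∑ s, if s ∈ avail τ e X then (1 : ℝ) else 0 := by
      intro τ; simp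
    rw [Finset.sum_congr rfl fun τ _ => this τ, Finset.sum_comm]
    refine Finset.sum_congr rfl fun s _ => ?_
    rw [Finset.card_filter]
    push_cast
    rfl
  rw [h1, ← Finset.add_sum_erase _ _ (Finset.mem_univ (X e)), mul_add, add_comm, mul_one]
  refine add_le_add ?_ (by exact_mod_cast Finset.card_le_card (Finset.filter_subset _ _))
  have h2 : ∀ s ∈ Finset.univ.erase (X e),
      (((fibre e t).filter fun τ => s ∈ avail τ e X).card : ℝ) ≤
        (fibre e t).card * (1 - relTime t) ^ 2 := by
    intro s hs
    have hs' : s ≠ X e := (Finset.mem_erase.1 hs).1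
    obtain ⟨c', hc'⟩ := hX.exists_col e.1 s
    obtain ⟨r', hr'⟩ := hX.exists_row e.2 s
    have hc : c' ≠ e.2 := by rintro rfl; exact hs' hc'.symm
    have hr : r' ≠ e.1 := by rintro rfl; exact hs' hr'.symm
    have hne : ((e.1, c') : Cell n) ≠ (r', e.2) := fun h => hc (congrArg Prod.snd h)
    have := card_fibre_filter e t (∅ : Finset (Cell n)) {(e.1, c'), (r', e.2)}
      (Finset.disjoint_empty_left _) (Finset.notMem_empty _) (by
        simp only [Finset.mem_insert, Finset.mem_singleton, not_or]
        exact ⟨fun h => hc (congrArg Prod.snd h).symm, fun h => hr (congrArg Prod.fst h).symm⟩)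
    rw [Finset.card_pair hne] at this
    simp only [Finset.card_empty, pow_zero, one_mul] at this
    rw [← this]
    refine Nat.cast_le.2 (Finset.card_le_card ?_)
    intro τ hτ
    obtain ⟨hτ1, hτ2⟩ := Finset.mem_filter.1 hτ
    refine Finset.mem_filter.2 ⟨hτ1, by simp, ?_⟩
    have hτe : τ e = t := (Finset.mem_filter.1 hτ1).2
    have hav := (Finset.mem_filter.1 hτ2).2
    intro x hx
    by_contra hlt
    rcases Finset.mem_insert.1 hx with rfl | hx
    · exact hav (e.1, c') (Or.inl rfl) (by rw [hτe]; exact not_le.1 hlt) hc'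
    · rw [Finset.mem_singleton] at hx
      subst hx
      exact hav (r', e.2) (Or.inr rfl) (by rw [hτe]; exact not_le.1 hlt) hr'
  refine (Finset.sum_le_card_nsmul _ _ _ h2).trans ?_
  rw [nsmul_eq_mul]
  have h3 : ((Finset.univ.erase (X e)).card : ℝ) ≤ n := by
    have := Finset.card_le_univ (Finset.univ.erase (X e))
    rw [Fintype.card_fin] at this
    exact_mod_cast this
  calc _ ≤ (n : ℝ) * ((fibre e t).card * (1 - relTime t) ^ 2) := by gcongr
    _ = _ := by ring

lemma card_fibre_mul {C : Type*} [Fintype C] [DecidableEq C] {M : ℕ} (e : C) (t : Fin M) :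
    ((fibre e t).card : ℝ) * M = Fintype.card (C → Fin M) := by
  have e2 : fibre e t = Fintype.piFinset fun x => if x = e then {t} else Finset.univ := by
    ext τ
    simp only [fibre, Finset.mem_filter, Finset.mem_univ, true_and, Fintype.mem_piFinset]
    constructor
    · intro ha x
      split_ifs with h1
      · simp [h1, ha]
      · simp
    · intro hx
      simpa using hx e
  rw [e2, Fintype.card_piFinset, ← Finset.mul_prod_erase _ _ (Finset.mem_univ e)]
  have h1 : ∏ x ∈ Finset.univ.erase e,
      (if x = e then ({t} : Finset (Fin M)) else Finset.univ).card =
      M ^ (Finset.univ.erase e).card := by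
    rw [Finset.prod_congr rfl, Finset.prod_const]
    intro x hx
    simp [(Finset.mem_erase.1 hx).1]
  rw [h1, Finset.card_erase_of_mem (Finset.mem_univ e), Finset.card_univ]
  have hpos : 0 < Fintype.card C := Fintype.card_pos_iff.2 ⟨e⟩
  simp only [if_true, Finset.card_singleton, one_mul, Fintype.card_fun, Fintype.card_fin]
  norm_cast
  rw [← pow_succ]
  congr 1
  omega

lemma sum_log_weight_le {n M : ℕ} (hn : 0 < n) {X : Cell n → Fin n} (hX : Proper X)
    (w : (Cell n → Fin M) → Cell n → (Cell n → Fin n) → Fin n → ℝ)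
    (hw : ∀ τ e X s, 0 < w τ e X s) (e : Cell n) (t : Fin M) (δ : ℝ)
    (hδ : ∑ τ ∈ fibre e t, ∑ s ∈ avail τ e X, (w τ e X s - 1) ≤ (fibre e t).card * δ) :
    ∑ τ ∈ fibre e t, Real.log (∑ s ∈ avail τ e X, w τ e X s) ≤
      (fibre e t).card * (Real.log n + 2 * Real.log (1 - relTime t) +
        (1 + δ) / (n * (1 - relTime t) ^ 2)) := by
  have hn' : (0 : ℝ) < n := by exact_mod_cast hn
  have hu := relTime_lt_one t
  have hu' : 0 < 1 - relTime t := by linarith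
  set A : ℝ := n * (1 - relTime t) ^ 2 with hA
  have hApos : 0 < A := by positivity
  have hlogA : Real.log A = Real.log n + 2 * Real.log (1 - relTime t) := by
    rw [hA, Real.log_mul hn'.ne' (by positivity), Real.log_pow]
    norm_cast
  rw [← hlogA]
  have h1 : ∀ τ ∈ fibre e t, Real.log (∑ s ∈ avail τ e X, w τ e X s) ≤
      Real.log A - 1 + (∑ s ∈ avail τ e X, w τ e X s) / A := by
    intro τ _
    have hpos : 0 < ∑ s ∈ avail τ e X, w τ e X s :=
      Finset.sum_pos (fun s _ => hw τ e X s) ⟨_, hX.mem_avail τ e⟩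
    have := Real.log_le_sub_one_of_pos (div_pos hpos hApos)
    rw [Real.log_div hpos.ne' hApos.ne'] at this
    linarith
  refine (Finset.sum_le_sum h1).trans ?_
  rw [Finset.sum_add_distrib, ← Finset.sum_div, Finset.sum_const, nsmul_eq_mul]
  have h2 : ∑ τ ∈ fibre e t, ∑ s ∈ avail τ e X, w τ e X s ≤
      (fibre e t).card * (A + 1 + δ) := by
    have h3 := sum_card_avail_le hX e t
    have h4 : ∑ τ ∈ fibre e t, ∑ s ∈ avail τ e X, w τ e X s =
        ∑ τ ∈ fibre e t, ∑ s ∈ avail τ e X, (w τ e X s - 1) +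
          ∑ τ ∈ fibre e t, ((avail τ e X).card : ℝ) := by
      rw [← Finset.sum_add_distrib]
      refine Finset.sum_congr rfl fun τ _ => ?_
      rw [Finset.sum_sub_distrib]
      simp
    rw [h4]
    linarith
  have h5 : (∑ τ ∈ fibre e t, ∑ s ∈ avail τ e X, w τ e X s) / A ≤
      (fibre e t).card * (A + 1 + δ) / A := by gcongr
  refine (add_le_add le_rfl h5).trans (le_of_eq ?_)
  field_simp
  ring

lemma card_le_exp_of_savings {n M : ℕ} (hn : 0 < n) (hM : 0 < M) (𝓧 : Finset (Cell n → Fin n))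
    (h𝓧 : ∀ X ∈ 𝓧, Proper X)
    (w : (Cell n → Fin M) → Cell n → (Cell n → Fin n) → Fin n → ℝ)
    (hw : ∀ τ e X s, 0 < w τ e X s) (hdep : PastDependent w) (D : ℝ)
    (hD : ∀ X ∈ 𝓧, ∃ δ g : Cell n → Fin M → ℝ,
      (∀ e t, ∑ τ ∈ fibre e t, ∑ s ∈ avail τ e X, (w τ e X s - 1) ≤
        (fibre e t).card * δ e t) ∧
      (∀ e t, (fibre e t).card * g e t ≤ ∑ τ ∈ fibre e t, Real.log (w τ e X (X e))) ∧
      ∑ e, ∑ t, (δ e t / (n * (1 - relTime t) ^ 2) - g e t) ≤ -(D * M)) :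
    (𝓧.card : ℝ) ≤ Real.exp ((n : ℝ) ^ 2 *
      (Real.log n + (∑ t : Fin M, 2 * Real.log (1 - relTime t)) / M + (M : ℝ) ^ 2 / n) - D) := by
  refine card_le_exp_of_average hM 𝓧 h𝓧 w hw hdep _ fun X hX => ?_
  obtain ⟨δ, g, hδ, hg, hsave⟩ := hD X hX
  have hn' : (0 : ℝ) < n := by exact_mod_cast hn
  have hM' : (0 : ℝ) < M := by exact_mod_cast hM
  set F : ℝ := (Fintype.card (Cell n → Fin M) : ℝ) / M with hF
  have hFe : ∀ (e : Cell n) (t : Fin M), ((fibre e t).card : ℝ) = F := fun e t => by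
    rw [hF, eq_div_iff hM'.ne', card_fibre_mul]
  have hFpos : 0 ≤ F := by positivity
  have h1 : ∑ τ : Cell n → Fin M, ∑ e, (Real.log (∑ s ∈ avail τ e X, w τ e X s) -
      Real.log (w τ e X (X e))) =
      ∑ e, ∑ t, ∑ τ ∈ fibre e t, (Real.log (∑ s ∈ avail τ e X, w τ e X s) -
      Real.log (w τ e X (X e))) := by
    rw [Finset.sum_comm]
    refine Finset.sum_congr rfl fun e _ => ?_
    exact (Finset.sum_fiberwise Finset.univ (fun τ : Cell n → Fin M => τ e) _).symm
  rw [h1]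
  have h2 : ∀ (e : Cell n) (t : Fin M),
      ∑ τ ∈ fibre e t, (Real.log (∑ s ∈ avail τ e X, w τ e X s) -
      Real.log (w τ e X (X e))) ≤ F * (Real.log n + 2 * Real.log (1 - relTime t) +
        (M : ℝ) ^ 2 / n + (δ e t / (n * (1 - relTime t) ^ 2) - g e t)) := by
    intro e t
    rw [Finset.sum_sub_distrib]
    have ha := sum_log_weight_le hn (h𝓧 X hX) w hw e t (δ e t) (hδ e t)
    have hb := hg e t
    rw [hFe] at ha hb
    have hu : (1 : ℝ) / M ≤ 1 - relTime t := by
      have : (t : ℝ) + 1 ≤ M := by exact_mod_cast t.2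
      rw [relTime, div_le_iff₀ hM', sub_mul, div_mul_cancel₀ _ hM'.ne']
      linarith
    have hc : 1 / (n * (1 - relTime t) ^ 2) ≤ (M : ℝ) ^ 2 / n := by
      have h3 : ((1 : ℝ) / M) ^ 2 ≤ (1 - relTime t) ^ 2 := by gcongr
      calc 1 / (n * (1 - relTime t) ^ 2) ≤ 1 / (n * ((1 : ℝ) / M) ^ 2) := by gcongr
        _ = _ := by field_simp
    have hd : F * (1 / (n * (1 - relTime t) ^ 2)) ≤ F * ((M : ℝ) ^ 2 / n) := by gcongr
    rw [add_div] at ha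
    linarith
  refine (Finset.sum_le_sum fun e _ => Finset.sum_le_sum fun t _ => h2 e t).trans ?_
  rw [Finset.sum_congr rfl fun e _ => (Finset.mul_sum _ _ _).symm, ← Finset.mul_sum]
  have h4 : ∑ e : Cell n, ∑ t : Fin M, (Real.log n + 2 * Real.log (1 - relTime t) +
        (M : ℝ) ^ 2 / n + (δ e t / (n * (1 - relTime t) ^ 2) - g e t)) =
      (n : ℝ) ^ 2 * (M * Real.log n + ∑ t : Fin M, 2 * Real.log (1 - relTime t) +
        M * ((M : ℝ) ^ 2 / n)) +
      ∑ e, ∑ t, (δ e t / (n * (1 - relTime t) ^ 2) - g e t) := by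
    simp only [Finset.sum_add_distrib, Finset.sum_const, Finset.card_univ, Fintype.card_fin,
      Fintype.card_prod, nsmul_eq_mul]
    push_cast
    ring
  rw [h4]
  have h5 : (Fintype.card (Cell n → Fin M) : ℝ) = F * M := by rw [hF]; field_simp
  rw [h5, mul_assoc]
  refine mul_le_mul_of_nonneg_left ?_ hFpos
  have h6 : (M : ℝ) * ((n : ℝ) ^ 2 *
      (Real.log n + (∑ t : Fin M, 2 * Real.log (1 - relTime t)) / M + (M : ℝ) ^ 2 / n) - D) =
      (n : ℝ) ^ 2 * (M * Real.log n + ∑ t : Fin M, 2 * Real.log (1 - relTime t) +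
        M * ((M : ℝ) ^ 2 / n)) - D * M := by
    field_simp
  rw [h6]
  linarith

lemma log_factorial_le (M : ℕ) :
    Real.log (M.factorial : ℝ) ≤ (M + 1) * Real.log (M + 1) - M := by
  induction M with
  | zero => simp
  | succ M ih =>
    rw [Nat.factorial_succ]
    push_cast
    have h1 : (0 : ℝ) < M + 1 := by positivity
    have h2 : (0 : ℝ) < M + 1 + 1 := by positivity
    rw [Real.log_mul h1.ne' (by positivity)]
    have h3 := Real.log_le_sub_one_of_pos (div_pos h1 h2)
    rw [Real.log_div h1.ne' h2.ne'] at h3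
    have h4 : (M + 1 + 1 : ℝ) * ((M + 1 : ℝ) / (M + 1 + 1) - 1) = -1 := by field_simp; ring
    have h5 := mul_le_mul_of_nonneg_left h3 h2.le
    rw [h4] at h5
    linarith

lemma sum_log_one_sub_relTime_le {M : ℕ} (hM : 0 < M) :
    (∑ t : Fin M, 2 * Real.log (1 - relTime t)) / M ≤
      -2 + 2 * (1 / M + Real.log (M + 1) / M) := by
  have hM' : (0 : ℝ) < M := by exact_mod_cast hM
  have h1 : ∑ t : Fin M, Real.log (1 - relTime t) =
      Real.log (M.factorial : ℝ) - M * Real.log M := by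
    have h2 : ∀ t : Fin M, Real.log (1 - relTime t) = Real.log ((M - t : ℕ) : ℝ) - Real.log M := by
      intro t
      have : (0 : ℝ) < ((M - t : ℕ) : ℝ) := by exact_mod_cast Nat.sub_pos_of_lt t.2
      rw [← Real.log_div this.ne' hM'.ne', Nat.cast_sub t.2.le, relTime]
      congr 1
      field_simp
    rw [Finset.sum_congr rfl fun t _ => h2 t, Finset.sum_sub_distrib, Finset.sum_const,
      Finset.card_univ, Fintype.card_fin, nsmul_eq_mul]
    congr 1
    rw [← Real.log_prod fun t _ => by
      have := Nat.sub_pos_of_lt t.2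
      positivity]
    congr 1
    rw [← Nat.descFactorial_self, Nat.descFactorial_eq_prod_range,
      ← Fin.prod_univ_eq_prod_range (fun i => M - i) M]
    push_cast
    rfl
  rw [← Finset.mul_sum, h1, div_le_iff₀ hM']
  have h3 := log_factorial_le M
  have h4 : Real.log (M + 1) - Real.log M ≤ 1 / M := by
    have := Real.log_le_sub_one_of_pos (show (0 : ℝ) < (M + 1) / M by positivity)
    rw [Real.log_div (by positivity) hM'.ne'] at this
    refine this.trans (le_of_eq ?_)
    field_simp
    ring
  have h5 : M * (Real.log (M + 1) - Real.log M) ≤ 1 := by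
    calc _ ≤ M * (1 / (M : ℝ)) := by gcongr
      _ = 1 := by field_simp
  have h6 : (-2 + 2 * (1 / M + Real.log (M + 1) / M)) * (M : ℝ) =
      -2 * M + 2 + 2 * Real.log (M + 1) := by field_simp; ring
  rw [h6]
  linarith

/-- If a family of Latin squares has weights saving `a n²` then it is exponentially small. -/
lemma exists_card_le_of_savings (a : ℝ) (ha : 0 < a) : ∃ m : ℕ, 0 < m ∧ ∃ n₀ : ℕ, 0 < n₀ ∧
    ∀ n, n₀ ≤ n → ∀ 𝓧 : Finset (Cell n → Fin n), (∀ X ∈ 𝓧, Proper X) →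
    ∀ w : (Cell n → Fin (4 * m)) → Cell n → (Cell n → Fin n) → Fin n → ℝ,
    (∀ τ e X s, 0 < w τ e X s) → PastDependent w →
    (∀ X ∈ 𝓧, ∃ δ g : Cell n → Fin (4 * m) → ℝ,
      (∀ e t, ∑ τ ∈ fibre e t, ∑ s ∈ avail τ e X, (w τ e X s - 1) ≤
        (fibre e t).card * δ e t) ∧
      (∀ e t, (fibre e t).card * g e t ≤ ∑ τ ∈ fibre e t, Real.log (w τ e X (X e))) ∧
      ∑ e, ∑ t, (δ e t / (n * (1 - relTime t) ^ 2) - g e t) ≤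
        -(a * (n : ℝ) ^ 2 * (4 * m : ℕ))) →
    (𝓧.card : ℝ) ≤ Real.exp (-(a / 2 * (n : ℝ) ^ 2)) * Fintype.card (Colouring n) := by
  have hlim : Filter.Tendsto (fun m : ℕ => 2 * (1 / ((4 * m : ℕ) : ℝ) +
      Real.log (((4 * m : ℕ) : ℝ) + 1) / ((4 * m : ℕ) : ℝ))) Filter.atTop (nhds (2 * (0 + 0))) := by
    have hcast : Filter.Tendsto (fun m : ℕ => ((4 * m : ℕ) : ℝ)) Filter.atTop Filter.atTop :=
      tendsto_natCast_atTop_atTop.comp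
        (Filter.tendsto_id.const_mul_atTop' (by norm_num : (0 : ℕ) < 4))
    refine Filter.Tendsto.const_mul 2 (Filter.Tendsto.add ?_ ?_)
    · exact tendsto_const_nhds.div_atTop hcast
    · have h1 : Filter.Tendsto (fun x : ℝ => Real.log (x + 1) / x) Filter.atTop (nhds 0) := by
        have h2 : Filter.Tendsto (fun x : ℝ => Real.log (x + 1) / (x + 1)) Filter.atTop (nhds 0) :=
          Real.isLittleO_log_id_atTop.tendsto_div_nhds_zero.comp
            (Filter.tendsto_atTop_add_const_right _ _ Filter.tendsto_id)
        have h3 : Filter.Tendsto (fun x : ℝ => 1 + 1 / x) Filter.atTop (nhds (1 + 0)) :=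
          tendsto_const_nhds.add (tendsto_const_nhds.div_atTop Filter.tendsto_id)
        have h4 := h2.mul h3
        rw [zero_mul] at h4
        refine h4.congr' ?_
        filter_upwards [Filter.eventually_gt_atTop 0] with x hx
        field_simp
      exact h1.comp hcast
  obtain ⟨m, hm, hm0⟩ := ((hlim.eventually_lt_const
    (show 2 * (0 + 0) < a / 4 by linarith)).and (Filter.eventually_gt_atTop 0)).exists
  obtain ⟨n₀, hn₀⟩ := exists_nat_gt (((4 * m : ℕ) : ℝ) ^ 2 / (a / 4))
  refine ⟨m, hm0, n₀ + 1, Nat.succ_pos _, fun n hn 𝓧 h𝓧 w hw hdep hsav => ?_⟩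
  have hnpos : 0 < n := by omega
  have hn' : (0 : ℝ) < n := by exact_mod_cast hnpos
  refine (card_le_exp_of_savings hnpos (by omega) 𝓧 h𝓧 w hw hdep (a * (n : ℝ) ^ 2) hsav).trans ?_
  refine le_trans ?_ (mul_le_mul_of_nonneg_left (card_colouring_ge n hnpos) (Real.exp_pos _).le)
  rw [← Real.exp_add, Real.exp_le_exp]
  have h1 := sum_log_one_sub_relTime_le (M := 4 * m) (by omega)
  have h2 : ((4 * m : ℕ) : ℝ) ^ 2 / n ≤ a / 4 := by
    rw [div_le_iff₀ hn']
    have : (n₀ : ℝ) ≤ n := by exact_mod_cast (by omega : n₀ ≤ n)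
    have h3 := hn₀.trans_le this
    rw [div_lt_iff₀ (by linarith)] at h3
    linarith
  have h3 : (n : ℝ) ^ 2 * (Real.log n + (∑ t : Fin (4 * m), 2 * Real.log (1 - relTime t)) /
      (4 * m : ℕ) + ((4 * m : ℕ) : ℝ) ^ 2 / n) ≤
      (n : ℝ) ^ 2 * (Real.log n + (-2 + a / 4) + a / 4) := by
    gcongr
    linarith
  refine (sub_le_sub_right h3 _).trans (le_of_eq ?_)
  ring

/-- The middle quarter of the time interval in which encodings are biased. -/
def InWindow {m : ℕ} (t : Fin (4 * m)) : Prop := 2 * m ≤ t.1 ∧ t.1 < 3 * m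

lemma InWindow.pos {m : ℕ} {t : Fin (4 * m)} (h : InWindow t) : 0 < m := by
  have := h.1; have := h.2; omega

lemma InWindow.half_le {m : ℕ} {t : Fin (4 * m)} (h : InWindow t) : 1 / 2 ≤ relTime t := by
  have hm : (0 : ℝ) < m := by exact_mod_cast h.pos
  have h1 : (2 * m : ℝ) ≤ t := by exact_mod_cast h.1
  rw [relTime, le_div_iff₀ (by push_cast; positivity)]
  push_cast
  linarith

lemma InWindow.quarter_le {m : ℕ} {t : Fin (4 * m)} (h : InWindow t) : 1 / 4 ≤ 1 - relTime t := by
  have hm : (0 : ℝ) < m := by exact_mod_cast h.pos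
  have h1 : (t : ℝ) ≤ 3 * m := by exact_mod_cast h.2.le
  have : relTime t ≤ 3 / 4 := by
    rw [relTime, div_le_iff₀ (by push_cast; positivity)]
    push_cast
    linarith
  linarith

lemma card_window (m : ℕ) : (Finset.univ.filter fun t : Fin (4 * m) => InWindow t).card = m := by
  have h : ((Finset.univ.filter fun t : Fin (4 * m) => InWindow t).map Fin.valEmbedding) =
      Finset.Ico (2 * m) (3 * m) := by
    ext i
    simp only [Finset.mem_map, Fin.valEmbedding_apply, Finset.mem_Ico]
    constructor
    · rintro ⟨t, ht, rfl⟩; exact (Finset.mem_filter.1 ht).2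
    · intro hi; exact ⟨⟨i, by omega⟩, Finset.mem_filter.2 ⟨Finset.mem_univ _, hi⟩, rfl⟩
  rw [← Finset.card_map Fin.valEmbedding, h, Nat.card_Ico]
  omega

lemma exists_card_le_of_window_savings (a : ℝ) (ha : 0 < a) : ∃ m : ℕ, ∃ n₀ : ℕ, 0 < n₀ ∧
    ∀ n, n₀ ≤ n → ∀ 𝓧 : Finset (Cell n → Fin n), (∀ X ∈ 𝓧, Proper X) →
    ∀ v : (Cell n → Fin (4 * m)) → Cell n → (Cell n → Fin n) → Fin n → ℝ,
    (∀ τ e X s, 0 < v τ e X s) → PastDependent v → ∀ κ : ℝ,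
    (∀ X ∈ 𝓧, ∃ δ g : Cell n → ℝ,
      (∀ e, ∀ x : ℝ, 4 ≤ x → x ≤ 16 → x * δ e ≤ κ * δ e) ∧
      (∀ e, ∀ t : Fin (4 * m), InWindow t →
        ∑ τ ∈ fibre e t, ∑ s ∈ avail τ e X, (v τ e X s - 1) ≤ (fibre e t).card * δ e) ∧
      (∀ e, ∀ t : Fin (4 * m), InWindow t →
        (fibre e t).card * g e ≤ ∑ τ ∈ fibre e t, Real.log (v τ e X (X e))) ∧
      ∑ e, (κ * δ e / n - g e) ≤ -(a * (n : ℝ) ^ 2)) →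
    (𝓧.card : ℝ) ≤ Real.exp (-(a / 8 * (n : ℝ) ^ 2)) * Fintype.card (Colouring n) := by
  obtain ⟨m, hm, n₀, hn₀, H⟩ := exists_card_le_of_savings (a / 4) (by positivity)
  refine ⟨m, n₀, hn₀, fun n hn 𝓧 h𝓧 v hv hdep κ hsav => ?_⟩
  have hn' : (0 : ℝ) < n := by exact_mod_cast (by omega : 0 < n)
  have hm' : (0 : ℝ) < m := by exact_mod_cast hm
  have h8 : a / 8 = a / 4 / 2 := by ring
  rw [h8]
  refine H n hn 𝓧 h𝓧 (fun τ e X s => if InWindow (τ e) then v τ e X s else 1) ?_ ?_ ?_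
  · intro τ e X s
    split_ifs
    · exact hv τ e X s
    · exact one_pos
  · intro τ e X X' h
    funext s
    simp only [hdep τ e X X' h]
  · intro X hX
    obtain ⟨δ, g, hκ, hδ, hg, hs⟩ := hsav X hX
    refine ⟨fun e t => if InWindow t then δ e else 0, fun e t => if InWindow t then g e else 0,
      fun e t => ?_, fun e t => ?_, ?_⟩
    · rw [Finset.sum_congr rfl fun τ hτ => by rw [(Finset.mem_filter.1 hτ).2]]
      by_cases h : InWindow t
      · simpa only [h, if_true] using hδ e t h
      · simp [h]
    · rw [Finset.sum_congr rfl fun τ hτ => by rw [(Finset.mem_filter.1 hτ).2]]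
      by_cases h : InWindow t
      · simpa only [h, if_true] using hg e t h
      · simp [h]
    · have h1 : ∀ e : Cell n, ∑ t : Fin (4 * m), ((if InWindow t then δ e else 0) /
          (n * (1 - relTime t) ^ 2) - if InWindow t then g e else 0) ≤
          m * (κ * δ e / n - g e) := by
        intro e
        have h2 : ∀ t : Fin (4 * m), ((if InWindow t then δ e else 0) /
          (n * (1 - relTime t) ^ 2) - if InWindow t then g e else 0) ≤
          if InWindow t then κ * δ e / n - g e else 0 := by
          intro t
          split_ifs with h
          · have hq := h.quarter_le
            have hh := h.half_le
            have hp : 0 < 1 - relTime t := by linarith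
            have h3 : 1 / (1 - relTime t) ^ 2 * δ e ≤ κ * δ e := by
              refine hκ e _ ?_ ?_
              · rw [le_div_iff₀ (by positivity)]
                nlinarith
              · rw [div_le_iff₀ (by positivity)]
                nlinarith
            have h4 : δ e / (n * (1 - relTime t) ^ 2) = 1 / (1 - relTime t) ^ 2 * δ e / n := by
              field_simp
            rw [h4]
            gcongr
          · simp
        refine (Finset.sum_le_sum fun t _ => h2 t).trans (le_of_eq ?_)
        rw [← Finset.sum_filter, Finset.sum_const, card_window, nsmul_eq_mul]
      refine (Finset.sum_le_sum fun e _ => h1 e).trans ?_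
      rw [← Finset.mul_sum]
      push_cast
      nlinarith

/-- The entries of `X` that precede `e`. -/
def revealed {n M : ℕ} (τ : Cell n → Fin M) (e : Cell n) (X : Cell n → Fin n) :
    Cell n → Option (Fin n) := fun e' => if τ e' < τ e then some (X e') else none

lemma revealed_eq_some {n M : ℕ} {τ : Cell n → Fin M} {e : Cell n} {X : Cell n → Fin n}
    {e' : Cell n} {s : Fin n} : revealed τ e X e' = some s ↔ τ e' < τ e ∧ X e' = s := by
  unfold revealed
  split_ifs with h <;> simp [h]

lemma revealed_congr {n M : ℕ} : PastDependent (revealed (n := n) (M := M)) := by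
  intro τ e X X' h
  funext e'
  unfold revealed
  split_ifs with h'
  · rw [h e' h']
  · rfl

/-- The columns `c'` for which the cells `(r, c)` and `(r, c')` lead to the same column `k`. -/
def collisions {n : ℕ} (X : Cell n → Fin n) (y z r c : Fin n) : Finset (Fin n) :=
  Finset.univ.filter fun c' => c' ≠ c ∧ c' ≠ z ∧ ∃ w k w', X (w, z) = X (r, c) ∧
    X (w, k) = X (y, c) ∧ X (w', z) = X (r, c') ∧ X (w', k) = X (y, c')

/-- The columns `c'` for which, judging from the revealed entries `Y`, the symbol `s` at `(r, c)`
would lead to the same column as `(r, c')`. -/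
def collisionsOf {n : ℕ} (Y : Cell n → Option (Fin n)) (y z : Fin n) (e : Cell n) (s : Fin n) :
    Finset (Fin n) :=
  Finset.univ.filter fun c' => c' ≠ e.2 ∧ c' ≠ z ∧ ∃ w k w' p q o, Y (w, z) = some s ∧
    Y (w, k) = some p ∧ Y (y, e.2) = some p ∧ Y (w', z) = some q ∧ Y (e.1, c') = some q ∧
    Y (w', k) = some o ∧ Y (y, c') = some o

lemma sum_card_collisionsOf_le {n M : ℕ} {X : Cell n → Fin n} (hX : Proper X) (y z : Fin n)
    (τ : Cell n → Fin M) (e : Cell n) :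
    ∑ s, (collisionsOf (revealed τ e X) y z e s).card ≤ n := by
  have h : ∀ s₁ s₂ : Fin n, s₁ ≠ s₂ → Disjoint (collisionsOf (revealed τ e X) y z e s₁)
      (collisionsOf (revealed τ e X) y z e s₂) := by
    intro s₁ s₂ hne
    rw [Finset.disjoint_left]
    intro c' h1 h2
    obtain ⟨-, -, w, k, w', p, q, o, a1, a2, a3, a4, a5, a6, a7⟩ := (Finset.mem_filter.1 h1).2
    obtain ⟨-, -, v, l, v', p', q', o', b1, b2, b3, b4, b5, b6, b7⟩ := (Finset.mem_filter.1 h2).2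
    rw [revealed_eq_some] at *
    have e1 : w' = v' := hX.col (c := z) (by rw [a4.2, b4.2, ← a5.2, ← b5.2])
    subst e1
    have e2 : k = l := hX.row (r := w') (by rw [a6.2, b6.2, ← a7.2, ← b7.2])
    subst e2
    have e3 : w = v := hX.col (c := k) (by rw [a2.2, b2.2, ← a3.2, ← b3.2])
    subst e3
    exact hne (a1.2.symm.trans b1.2)
  rw [← Finset.card_biUnion fun s₁ _ s₂ _ hne => h s₁ s₂ hne]
  exact (Finset.card_le_univ _).trans (by simp)

lemma log_one_add_mul_ge {l R m : ℝ} (hl : 0 ≤ l) (hR : 0 ≤ R) (hm : 0 < m) (hRm : R ≤ m) :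
    R / m * Real.log (1 + l * m) ≤ Real.log (1 + l * R) := by
  have h1 : 0 ≤ l * m := by positivity
  have h2 := rpow_one_add_le_one_add_mul_self (s := l * m) (by linarith)
    (p := R / m) (by positivity) ((div_le_one hm).2 hRm)
  have h3 : R / m * (l * m) = l * R := by field_simp
  rw [h3] at h2
  rw [← Real.log_rpow (by linarith)]
  exact Real.log_le_log (by positivity) h2

lemma sum_log_collisions_ge {n m : ℕ} {X : Cell n → Fin n} (hX : Proper X) (y z : Fin n)
    (e : Cell n) (h₁ : e.1 ≠ y) (h₂ : e.2 ≠ z) (t : Fin (4 * m)) (ht : InWindow t) {l T : ℝ}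
    (hl : 0 ≤ l) (hT : 0 < T) (hheavy : T ≤ (collisions X y z e.1 e.2).card) :
    (fibre e t).card * (1 / 2 ^ 7 * Real.log (1 + l * T)) ≤ ∑ τ ∈ fibre e t,
      Real.log (1 + l * (collisionsOf (revealed τ e X) y z e (X e)).card) := by
  set Z := collisions X y z e.1 e.2 with hZ
  have hsub : ∀ τ ∈ fibre e t, collisionsOf (revealed τ e X) y z e (X e) ⊆ Z := by
    intro τ _ c' hc'
    obtain ⟨ha, hb, w, k, w', p, q, o, a1, a2, a3, a4, a5, a6, a7⟩ := (Finset.mem_filter.1 hc').2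
    rw [revealed_eq_some] at *
    exact Finset.mem_filter.2 ⟨Finset.mem_univ _, ha, hb, w, k, w', a1.2, by rw [a2.2, a3.2],
      by rw [a4.2, a5.2], by rw [a6.2, a7.2]⟩
  have hZpos : (0 : ℝ) < Z.card := hT.trans_le hheavy
  have h3 : ∀ τ ∈ fibre e t, (((collisionsOf (revealed τ e X) y z e (X e)).card : ℝ)) / Z.card *
      Real.log (1 + l * Z.card) ≤
      Real.log (1 + l * (collisionsOf (revealed τ e X) y z e (X e)).card) := fun τ hτ =>
    log_one_add_mul_ge hl (by positivity) hZpos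
      (by exact_mod_cast Finset.card_le_card (hsub τ hτ))
  refine le_trans ?_ (Finset.sum_le_sum h3)
  rw [← Finset.sum_mul, ← Finset.sum_div]
  have h4 : (fibre e t).card * (1 / 2 ^ 7) * (Z.card : ℝ) ≤
      ∑ τ ∈ fibre e t, ((collisionsOf (revealed τ e X) y z e (X e)).card : ℝ) := by
    have h5 : ∑ τ ∈ fibre e t, ((collisionsOf (revealed τ e X) y z e (X e)).card : ℝ) =
        ∑ c', (((fibre e t).filter fun τ =>
          c' ∈ collisionsOf (revealed τ e X) y z e (X e)).card : ℝ) := by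
      have : ∀ τ : Cell n → Fin (4 * m),
          ((collisionsOf (revealed τ e X) y z e (X e)).card : ℝ) =
          ∑ c', if c' ∈ collisionsOf (revealed τ e X) y z e (X e) then (1 : ℝ) else 0 := by
        intro τ; simp
      rw [Finset.sum_congr rfl fun τ _ => this τ, Finset.sum_comm]
      refine Finset.sum_congr rfl fun s _ => ?_
      rw [Finset.card_filter]
      push_cast
      rfl
    rw [h5]
    refine le_trans ?_ (Finset.sum_le_sum_of_subset_of_nonneg (Finset.subset_univ Z)
      fun _ _ _ => by positivity)
    rw [mul_comm, ← nsmul_eq_mul]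
    refine Finset.card_nsmul_le_sum _ _ _ fun c' hc' => ?_
    obtain ⟨ha, hb, w, k, w', a1, a2, a3, a4⟩ := (Finset.mem_filter.1 hc').2
    obtain ⟨r, c⟩ := e
    dsimp only at *
    set S : Finset (Cell n) := {(y, c), (w, z), (w, k), (r, c'), (y, c'), (w', z), (w', k)} with hS
    have hScard : S.card ≤ 7 :=
      (Finset.card_insert_le _ _).trans (Nat.succ_le_succ Finset.card_le_six)
    have heS : ((r, c) : Cell n) ∉ S := by
      simp only [hS, Finset.mem_insert, Finset.mem_singleton, Prod.mk.injEq, not_or]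
      refine ⟨fun h => h₁ h.1, fun h => h₂ h.2, fun h => ?_, fun h => ha h.2.symm,
        fun h => h₁ h.1, fun h => h₂ h.2, fun h => ?_⟩
      · obtain ⟨rfl, rfl⟩ := h
        exact h₁ (hX.col a2)
      · obtain ⟨rfl, rfl⟩ := h
        exact hb (hX.row a3).symm
    obtain ⟨m1, m2, m3, m4, m5, m6, m7⟩ : (y, c) ∈ S ∧ (w, z) ∈ S ∧ (w, k) ∈ S ∧ (r, c') ∈ S ∧
        (y, c') ∈ S ∧ (w', z) ∈ S ∧ (w', k) ∈ S := by
      simp only [hS, Finset.mem_insert, Finset.mem_singleton, true_or, or_true, and_self]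
    have hge := card_fibre_filter_ge (r, c) t S ∅ (Finset.disjoint_empty_right _) heS hScard
      (Finset.card_empty.le)
    rw [pow_zero, mul_one] at hge
    refine le_trans ?_ (hge.trans ?_)
    · have := ht.half_le
      have : (1 / 2 : ℝ) ^ 7 ≤ relTime t ^ 7 := by gcongr
      rw [one_div_pow] at this
      gcongr
    · refine Nat.cast_le.2 (Finset.card_le_card fun τ hτ => ?_)
      obtain ⟨hτ1, hτ2, -⟩ := Finset.mem_filter.1 hτ
      have hτe : τ (r, c) = t := (Finset.mem_filter.1 hτ1).2
      rw [← hτe] at hτ2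
      refine Finset.mem_filter.2 ⟨hτ1, Finset.mem_filter.2 ⟨Finset.mem_univ _, ha, hb, w, k, w',
        X (y, c), X (r, c'), X (y, c'), ?_⟩⟩
      exact ⟨revealed_eq_some.2 ⟨hτ2 _ m2, a1⟩, revealed_eq_some.2 ⟨hτ2 _ m3, a2⟩,
        revealed_eq_some.2 ⟨hτ2 _ m1, rfl⟩, revealed_eq_some.2 ⟨hτ2 _ m6, a3⟩,
        revealed_eq_some.2 ⟨hτ2 _ m4, rfl⟩, revealed_eq_some.2 ⟨hτ2 _ m7, a4⟩,
        revealed_eq_some.2 ⟨hτ2 _ m5, rfl⟩⟩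
  have h6 : Real.log (1 + l * T) ≤ Real.log (1 + l * Z.card) :=
    Real.log_le_log (by positivity) (by gcongr)
  have h7 : 0 ≤ Real.log (1 + l * T) := by
    have : 0 ≤ l * T := by positivity
    exact Real.log_nonneg (by linarith)
  calc _ = (fibre e t).card * (1 / 2 ^ 7) * Real.log (1 + l * T) := by ring
    _ ≤ (∑ τ ∈ fibre e t, ((collisionsOf (revealed τ e X) y z e (X e)).card : ℝ)) / Z.card *
        Real.log (1 + l * Z.card) := by
      refine mul_le_mul ?_ h6 h7
        (div_nonneg (Finset.sum_nonneg fun _ _ => Nat.cast_nonneg _) hZpos.le)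
      rwa [le_div_iff₀ hZpos]

/-- The cells with at least `T` collisions. -/
def heavyCells {n : ℕ} (X : Cell n → Fin n) (y z : Fin n) (T : ℝ) : Finset (Cell n) :=
  Finset.univ.filter fun e => e.1 ≠ y ∧ e.2 ≠ z ∧ T ≤ (collisions X y z e.1 e.2).card

/-- Latin squares with many heavy cells are exponentially rare. -/
lemma exists_card_heavy_le (η : ℝ) (hη : 0 < η) : ∃ n₀ : ℕ, 0 < n₀ ∧ ∀ n, n₀ ≤ n →
    ∀ y z : Fin n, ((Finset.univ.filter fun X : Cell n → Fin n => Proper X ∧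
      η * (n : ℝ) ^ 2 ≤ (heavyCells X y z (2 ^ 13 / η)).card).card : ℝ) ≤
      Real.exp (-(η / 2 ^ 8 / 8 * (n : ℝ) ^ 2)) * Fintype.card (Colouring n) := by
  obtain ⟨m, n₀, hn₀, H⟩ := exists_card_le_of_window_savings (η / 2 ^ 8) (by positivity)
  refine ⟨n₀, hn₀, fun n hn y z => ?_⟩
  have hn' : (0 : ℝ) < n := by exact_mod_cast (by omega : 0 < n)
  set l : ℝ := η / 2 ^ 12 with hl
  have hlpos : 0 < l := by positivity
  refine H n hn _ (fun X hX => (Finset.mem_filter.1 hX).2.1)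
    (fun τ e X s => 1 + l * (collisionsOf (revealed τ e X) y z e s).card)
    (fun τ e X s => by positivity) ?_ 16 ?_
  · intro τ e X X' h
    simp only [revealed_congr τ e X X' h]
  · intro X hX
    obtain ⟨hXp, hheavy⟩ := (Finset.mem_filter.1 hX).2
    refine ⟨fun _ => l * n, fun e => if e ∈ heavyCells X y z (2 ^ 13 / η) then 1 / 2 ^ 7 else 0,
      fun e x _ hx => by gcongr, fun e t ht => ?_, fun e t ht => ?_, ?_⟩
    · rw [← nsmul_eq_mul]
      refine Finset.sum_le_card_nsmul _ _ _ fun τ _ => ?_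
      simp only [add_sub_cancel_left]
      rw [← Finset.mul_sum]
      refine mul_le_mul_of_nonneg_left ?_ hlpos.le
      refine (Finset.sum_le_sum_of_subset_of_nonneg (Finset.subset_univ _)
        fun _ _ _ => by positivity).trans ?_
      exact_mod_cast sum_card_collisionsOf_le hXp y z τ e
    · dsimp only
      split_ifs with h
      · obtain ⟨h1, h2, h3⟩ := (Finset.mem_filter.1 h).2
        refine le_trans ?_ (sum_log_collisions_ge hXp y z e h1 h2 t ht hlpos.le
          (by positivity) h3)
        have hlT : 1 + l * (2 ^ 13 / η) = 3 := by rw [hl]; field_simp; norm_num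
        have hlog : 1 ≤ Real.log 3 := by
          rw [Real.le_log_iff_exp_le (by norm_num)]
          have := Real.exp_one_lt_d9
          linarith
        rw [hlT]
        gcongr
        linarith
      · rw [mul_zero]
        refine Finset.sum_nonneg fun τ _ => Real.log_nonneg ?_
        have : 0 ≤ l * (collisionsOf (revealed τ e X) y z e (X e)).card := by positivity
        linarith
    · rw [Finset.sum_sub_distrib, ← Finset.sum_filter, Finset.filter_mem_eq_inter,
        Finset.univ_inter]
      simp only [Finset.sum_const, Finset.card_univ, Fintype.card_prod, Fintype.card_fin,
        nsmul_eq_mul]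
      push_cast
      have h5 : (n : ℝ) * n * (16 * (l * n) / n) = η * (n : ℝ) ^ 2 / 2 ^ 8 := by
        rw [hl]; field_simp; norm_num
      rw [h5]
      linarith

lemma card_le_of_determined {α β : Type*} [Fintype β] (S : Finset α) (R : α → β → Prop)
    (h : ∀ a ∈ S, ∃ b, R a b) (h' : ∀ a ∈ S, ∀ a' ∈ S, ∀ b, R a b → R a' b → a = a') :
    S.card ≤ Fintype.card β := by
  choose f hf using h
  rw [← Finset.card_attach, ← Finset.card_univ]
  refine Finset.card_le_card_of_injOn (fun a => f a.1 a.2) (fun _ _ => Finset.mem_univ _) ?_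
  intro a _ b _ hab
  refine Subtype.ext (h' a.1 a.2 b.1 b.2 _ (hf a.1 a.2) ?_)
  have := hf b.1 b.2
  dsimp only at hab
  rwa [← hab] at this

/-- The row of the symbol `s` in the column `c`. -/
def rowOf {n : ℕ} (X : Cell n → Fin n) (c s : Fin n) : Fin n :=
  if h : ∃ r, X (r, c) = s then h.choose else c

lemma Proper.apply_rowOf {n : ℕ} {X : Cell n → Fin n} (hX : Proper X) (c s : Fin n) :
    X (rowOf X c s, c) = s := by
  have h := hX.exists_row c s
  rw [rowOf, dif_pos h]
  exact h.choose_spec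

/-- The column of the symbol `s` in the row `r`. -/
def colOf {n : ℕ} (X : Cell n → Fin n) (r s : Fin n) : Fin n :=
  if h : ∃ c, X (r, c) = s then h.choose else r

lemma Proper.apply_colOf {n : ℕ} {X : Cell n → Fin n} (hX : Proper X) (r s : Fin n) :
    X (r, colOf X r s) = s := by
  have h := hX.exists_col r s
  rw [colOf, dif_pos h]
  exact h.choose_spec

/-- The cell `(r, c)` leads to the cell `(r, k)`, where `k` is the column reached from `(r, c)` via
the column `z` and the row `y`. -/
def link {n : ℕ} (X : Cell n → Fin n) (y z : Fin n) (e : Cell n) : Cell n :=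
  (e.1, colOf X (rowOf X z (X e)) (X (y, e.2)))

lemma Proper.link_eq {n : ℕ} {X : Cell n → Fin n} (hX : Proper X) {y z r c w k : Fin n}
    (h₁ : X (w, z) = X (r, c)) (h₂ : X (w, k) = X (y, c)) : link X y z (r, c) = (r, k) := by
  have hw : rowOf X z (X (r, c)) = w := hX.col (by rw [hX.apply_rowOf, h₁])
  have hk : colOf X w (X (y, c)) = k := hX.row (by rw [hX.apply_colOf, h₂])
  simp only [link, hw, hk]

/-- Few cells without many collisions lead to the same cell. -/
lemma Proper.card_le_mul_card_image_link {n : ℕ} {X : Cell n → Fin n} (hX : Proper X)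
    (y z : Fin n) {K : ℕ} (S : Finset (Cell n)) (hS : ∀ e ∈ S, e.2 ≠ z)
    (hK : ∀ e ∈ S, (collisions X y z e.1 e.2).card ≤ K) :
    S.card ≤ (K + 1) * (S.image (link X y z)).card := by
  refine Finset.card_le_mul_card_image S _ fun q hq => ?_
  obtain ⟨e, he, rfl⟩ := Finset.mem_image.1 hq
  have hsub : S.filter (fun x => link X y z x = link X y z e) ⊆
      (insert e.2 (collisions X y z e.1 e.2)).image fun c => (e.1, c) := by
    rintro ⟨r, c⟩ hx
    obtain ⟨hxS, hx⟩ := Finset.mem_filter.1 hx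
    have hr : r = e.1 := congrArg Prod.fst hx
    have hk := congrArg Prod.snd hx
    subst hr
    refine Finset.mem_image.2 ⟨c, ?_, rfl⟩
    by_cases hc : c = e.2
    · simp [hc]
    · refine Finset.mem_insert_of_mem (Finset.mem_filter.2 ⟨Finset.mem_univ _, hc, hS _ hxS,
        rowOf X z (X e), (link X y z e).2, rowOf X z (X (e.1, c)), hX.apply_rowOf _ _,
        hX.apply_colOf _ _, hX.apply_rowOf _ _, ?_⟩)
      rw [← hk]
      exact hX.apply_colOf _ _
  refine (Finset.card_le_card hsub).trans (Finset.card_image_le.trans ?_)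
  exact (Finset.card_insert_le _ _).trans (Nat.succ_le_succ (hK e he))

/-- The part of a bridging gadget determined by the vertices `w₂` and `w₅`. -/
def openPairs {n : ℕ} (X : Cell n → Fin n) (y z : Fin n) : Finset (Cell n) :=
  Finset.univ.filter fun p => ∃ c w, ([y, z, p.1, c, w, p.2] : List (Fin n)).Nodup ∧
    X (w, y) = X (p.1, c) ∧ X (w, p.2) = X (z, c)

lemma Proper.card_light_le {n : ℕ} {X : Cell n → Fin n} (hX : Proper X) {y z : Fin n}
    (hyz : y ≠ z) {K : ℕ} (S : Finset (Cell n)) (hS₁ : ∀ e ∈ S, e.1 ≠ z) (hS₂ : ∀ e ∈ S, e.2 ≠ y)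
    (hK : ∀ e ∈ S, (collisions X z y e.1 e.2).card ≤ K) :
    S.card ≤ (K + 1) * ((openPairs X y z).card + 10 * n) := by
  refine (hX.card_le_mul_card_image_link z y S hS₂ hK).trans (Nat.mul_le_mul_left _ ?_)
  have hcard : ∀ (P : Cell n → Prop) [DecidablePred P] (R : Cell n → Fin n → Prop),
      (∀ a, P a → ∃ b, R a b) →
      (∀ a a' b, P a → P a' → R a b → R a' b → a = a') → (Finset.univ.filter P).card ≤ n := by
    intro P _ R h1 h2
    refine (card_le_of_determined _ R (fun a ha => h1 a (Finset.mem_filter.1 ha).2)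
      (fun a ha a' ha' b => h2 a a' b (Finset.mem_filter.1 ha).2
        (Finset.mem_filter.1 ha').2)).trans ?_
    simp
  set A₁ : Finset (Cell n) := Finset.univ.filter fun e => e.1 = y
  set A₂ : Finset (Cell n) := Finset.univ.filter fun e => e.2 = y
  set A₃ : Finset (Cell n) := Finset.univ.filter fun e => e.2 = z
  set A₄ : Finset (Cell n) := Finset.univ.filter fun e => e.1 = e.2
  set A₅ : Finset (Cell n) := Finset.univ.filter fun e => X (e.2, y) = X e
  set A₆ : Finset (Cell n) := Finset.univ.filter fun e => X (y, y) = X e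
  set A₇ : Finset (Cell n) := Finset.univ.filter fun e => X (z, y) = X e
  set A₈ : Finset (Cell n) := Finset.univ.filter fun e =>
    ∃ w, X (w, y) = X e ∧ X (w, w) = X (z, e.2)
  have h₁ : A₁.card ≤ n := hcard (fun e => e.1 = y) (fun e b => e.2 = b) (fun a _ => ⟨_, rfl⟩)
    (by intro a a' b h h' e e'; exact Prod.ext (h.trans h'.symm) (e.trans e'.symm))
  have h₂ : A₂.card ≤ n := hcard (fun e => e.2 = y) (fun e b => e.1 = b) (fun a _ => ⟨_, rfl⟩)
    (by intro a a' b h h' e e'; exact Prod.ext (e.trans e'.symm) (h.trans h'.symm))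
  have h₃ : A₃.card ≤ n := hcard (fun e => e.2 = z) (fun e b => e.1 = b) (fun a _ => ⟨_, rfl⟩)
    (by intro a a' b h h' e e'; exact Prod.ext (e.trans e'.symm) (h.trans h'.symm))
  have h₄ : A₄.card ≤ n := hcard (fun e => e.1 = e.2) (fun e b => e.1 = b) (fun a _ => ⟨_, rfl⟩)
    (by
      intro a a' b h h' e e'
      exact Prod.ext (e.trans e'.symm) (h.symm.trans ((e.trans e'.symm).trans h')))
  have h₅ : A₅.card ≤ n := hcard (fun e => X (e.2, y) = X e) (fun e b => e.2 = b)
      (fun a _ => ⟨_, rfl⟩) (by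
    rintro ⟨r, c⟩ ⟨r', c'⟩ b h h' e e'
    dsimp only at *
    subst e' e
    rw [hX.col (h.symm.trans h')])
  have hrow : ∀ s, (Finset.univ.filter fun e => s = X e).card ≤ n := fun s =>
    hcard (fun e => s = X e) (fun e b => e.1 = b) (fun a _ => ⟨_, rfl⟩) (by
      rintro ⟨r, c⟩ ⟨r', c'⟩ b h h' e e'
      dsimp only at *
      subst e' e
      rw [hX.row (h.symm.trans h')])
  have h₆ : A₆.card ≤ n := hrow _
  have h₇ : A₇.card ≤ n := hrow _
  have h₈ : A₈.card ≤ n := hcard (fun e => ∃ w, X (w, y) = X e ∧ X (w, w) = X (z, e.2))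
    (fun e w => X (w, y) = X e ∧ X (w, w) = X (z, e.2))
    (fun a ha => ha) (by
      rintro ⟨r, c⟩ ⟨r', c'⟩ b - - ⟨h1, h2⟩ ⟨h1', h2'⟩
      dsimp only at *
      obtain rfl := hX.row (h2.symm.trans h2')
      rw [hX.col (h1.symm.trans h1')])
  have hsub : S.image (link X z y) ⊆ openPairs X y z ∪ (A₁ ∪ A₂ ∪ A₃ ∪ A₄ ∪
      (A₃ ∪ A₄ ∪ A₅ ∪ A₆ ∪ A₇ ∪ A₈).image (link X z y)) := by
    intro q hq
    obtain ⟨⟨r, c⟩, he, rfl⟩ := Finset.mem_image.1 hq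
    have hrz : r ≠ z := hS₁ _ he
    have hcy : c ≠ y := hS₂ _ he
    obtain ⟨w, hw⟩ := hX.exists_row y (X (r, c))
    obtain ⟨k, hk⟩ := hX.exists_col w (X (z, c))
    have hl := hX.link_eq hw hk
    by_contra hcon
    simp only [Finset.mem_union, not_or] at hcon
    obtain ⟨ho, ⟨⟨⟨n1, n2⟩, n3⟩, n4⟩, n5⟩ := hcon
    have hB : (r, c) ∉ A₃ ∪ A₄ ∪ A₅ ∪ A₆ ∪ A₇ ∪ A₈ := fun h => n5 (Finset.mem_image_of_mem _ h)
    simp only [Finset.mem_union, not_or] at hB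
    obtain ⟨⟨⟨⟨⟨m3, m4⟩, m5⟩, m6⟩, m7⟩, m8⟩ := hB
    rw [hl] at n1 n2 n3 n4 ho
    simp only [A₁, A₂, A₃, A₄, A₅, A₆, A₇, A₈, Finset.mem_filter, Finset.mem_univ, true_and]
      at n1 n2 n3 n4 m3 m4 m5 m6 m7 m8
    refine ho (Finset.mem_filter.2 ⟨Finset.mem_univ _, c, w, ?_, hw, hk⟩)
    have hwz : w ≠ z := by rintro rfl; exact m7 hw
    have hwy : w ≠ y := by rintro rfl; exact m6 hw
    have hwk : w ≠ k := by rintro rfl; exact m8 ⟨w, hw, hk⟩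
    have hwc : w ≠ c := by rintro rfl; exact m5 hw
    have hwr : w ≠ r := by rintro rfl; exact hcy (hX.row hw).symm
    have hck : c ≠ k := by rintro rfl; exact hwz (hX.col hk)
    simp only [List.nodup_cons, List.mem_cons, not_or, List.not_mem_nil, not_false_eq_true,
      List.nodup_nil, and_true]
    exact ⟨⟨hyz, Ne.symm n1, hcy.symm, hwy.symm, Ne.symm n2⟩, ⟨hrz.symm, Ne.symm m3, hwz.symm,
      Ne.symm n3⟩, ⟨m4, hwr.symm, n4⟩, ⟨hwc.symm, hck⟩, hwk⟩
  refine (Finset.card_le_card hsub).trans ?_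
  have hB : ((A₃ ∪ A₄ ∪ A₅ ∪ A₆ ∪ A₇ ∪ A₈).image (link X z y)).card ≤ 6 * n := by
    refine Finset.card_image_le.trans ?_
    have := Finset.card_union_le (A₃ ∪ A₄ ∪ A₅ ∪ A₆ ∪ A₇) A₈
    have := Finset.card_union_le (A₃ ∪ A₄ ∪ A₅ ∪ A₆) A₇
    have := Finset.card_union_le (A₃ ∪ A₄ ∪ A₅) A₆
    have := Finset.card_union_le (A₃ ∪ A₄) A₅
    have := Finset.card_union_le A₃ A₄
    omega
  have := Finset.card_union_le (openPairs X y z) (A₁ ∪ A₂ ∪ A₃ ∪ A₄ ∪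
      (A₃ ∪ A₄ ∪ A₅ ∪ A₆ ∪ A₇ ∪ A₈).image (link X z y))
  have := Finset.card_union_le (A₁ ∪ A₂ ∪ A₃ ∪ A₄)
    ((A₃ ∪ A₄ ∪ A₅ ∪ A₆ ∪ A₇ ∪ A₈).image (link X z y))
  have := Finset.card_union_le (A₁ ∪ A₂ ∪ A₃) A₄
  have := Finset.card_union_le (A₁ ∪ A₂) A₃
  have := Finset.card_union_le A₁ A₂
  omega

/-- All of a bridging gadget except that the colours of `w₂ → w₁` and `w₆ → z` may differ. -/
def OpenGadget {n : ℕ} (X : Cell n → Fin n) (y z c r c' w k w' : Fin n) : Prop :=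
  ([y, z, c, r, c', w, k, w'] : List (Fin n)).Nodup ∧
  ([X (y, c), X (w', z), X (r, c'), X (z, c')] : List (Fin n)).Nodup ∧
  X (y, c) = X (w', k) ∧ X (w, y) = X (r, c') ∧ X (w, k) = X (z, c')

/-- The possible vertices `w₅` of open gadgets at the cell `e`. -/
def openColumns {n : ℕ} (X : Cell n → Fin n) (y z : Fin n) (e : Cell n) : Finset (Fin n) :=
  Finset.univ.filter fun k => ∃ c' w w', OpenGadget X y z e.2 e.1 c' w k w'

lemma Proper.card_columns_of_openPair {n : ℕ} {X : Cell n → Fin n} (hX : Proper X)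
    {y z r k : Fin n} (h : (r, k) ∈ openPairs X y z) :
    n ≤ (Finset.univ.filter fun c => k ∈ openColumns X y z (r, c)).card + 15 +
      (Finset.univ.filter fun c => X (c, k) = X (y, c)).card := by
  obtain ⟨c', w, hnd, hw, hk⟩ := (Finset.mem_filter.1 h).2
  dsimp only at hnd hw hk
  set B : List (Fin n) := [y, z, r, c', w, k] ++ ([X (c', k), X (w, k), X (k, k), X (r, k),
    X (z, k), X (r, c'), X (z, c'), X (rowOf X z (X (r, c')), k),
    X (rowOf X z (X (z, c')), k)] : List (Fin n)).map (colOf X y) with hB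
  have hBcard : B.toFinset.card ≤ 15 := by
    simpa [hB] using List.toFinset_card_le B
  have hsub : (Finset.univ : Finset (Fin n)) ⊆
      (Finset.univ.filter fun c => k ∈ openColumns X y z (r, c)) ∪ B.toFinset ∪
      Finset.univ.filter fun c => X (c, k) = X (y, c) := by
    intro c _
    by_contra hcon
    simp only [Finset.mem_union, not_or, Finset.mem_filter, Finset.mem_univ, true_and] at hcon
    obtain ⟨⟨ho, hb⟩, hc⟩ := hcon
    refine ho (Finset.mem_filter.2 ⟨Finset.mem_univ _, c', w, rowOf X k (X (y, c)), ?_⟩)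
    obtain ⟨w', hw'⟩ := hX.exists_row k (X (y, c))
    have hrow : rowOf X k (X (y, c)) = w' := hX.col (by rw [hX.apply_rowOf, hw'])
    have hcol : ∀ s, c ≠ colOf X y s ↔ X (y, c) ≠ s := by
      intro s
      rw [not_iff_not]
      constructor
      · rintro rfl; exact hX.apply_colOf _ _
      · rintro rfl; exact hX.row (hX.apply_colOf _ _).symm
    simp only [hB, List.mem_toFinset, List.mem_append, List.map_cons, List.map_nil, List.mem_cons,
      List.not_mem_nil, or_false, not_or, ← ne_eq, hcol] at hb
    obtain ⟨⟨b1, b2, b3, b4, b5, b6⟩, b7, b8, b9, b10, b11, b12, b13, b14, b15⟩ := hb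
    simp only [List.nodup_cons, List.mem_cons, not_or, List.not_mem_nil, not_false_eq_true,
      List.nodup_nil, and_true] at hnd
    obtain ⟨⟨a1, a2, a3, a4, a5⟩, ⟨a6, a7, a8, a9⟩, ⟨a10, a11, a12⟩, ⟨a13, a14⟩, a15⟩ := hnd
    rw [hrow]
    have e1 : w' ≠ y := by rintro rfl; exact b6 (hX.row hw').symm
    have e2 : w' ≠ z := by rintro rfl; exact b11 hw'.symm
    have e3 : w' ≠ c := by rintro rfl; exact hc hw'
    have e4 : w' ≠ r := by rintro rfl; exact b10 hw'.symm
    have e5 : w' ≠ c' := by rintro rfl; exact b7 hw'.symm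
    have e6 : w' ≠ w := by rintro rfl; exact b8 hw'.symm
    have e7 : w' ≠ k := by rintro rfl; exact b9 hw'.symm
    have f1 : X (y, c) ≠ X (w', z) := by
      rw [← hw']; intro h; exact a9 (hX.row h).symm
    have f2 : X (w', z) ≠ X (r, c') := by
      intro h
      have : rowOf X z (X (r, c')) = w' := hX.col (by rw [hX.apply_rowOf, h])
      rw [this] at b14
      exact b14 hw'.symm
    have f3 : X (w', z) ≠ X (z, c') := by
      intro h
      have : rowOf X z (X (z, c')) = w' := hX.col (by rw [hX.apply_rowOf, h])
      rw [this] at b15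
      exact b15 hw'.symm
    have f4 : X (r, c') ≠ X (z, c') := fun h => a6 (hX.col h).symm
    refine ⟨?_, ?_, hw'.symm, hw, hk⟩
    · simp only [List.nodup_cons, List.mem_cons, not_or, List.not_mem_nil, not_false_eq_true,
        List.nodup_nil, and_true]
      exact ⟨⟨a1, Ne.symm b1, a2, a3, a4, a5, e1.symm⟩, ⟨Ne.symm b2, a6, a7, a8, a9, e2.symm⟩,
        ⟨b3, b4, b5, b6, e3.symm⟩, ⟨a10, a11, a12, e4.symm⟩, ⟨a13, a14, e5.symm⟩,
        ⟨a15, e6.symm⟩, e7.symm⟩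
    · simp only [List.nodup_cons, List.mem_cons, not_or, List.not_mem_nil, not_false_eq_true,
        List.nodup_nil, and_true]
      exact ⟨⟨f1, b12, b13⟩, ⟨f2, f3⟩, f4⟩
  have h1 := Finset.card_le_card hsub
  rw [Finset.card_univ, Fintype.card_fin] at h1
  have := Finset.card_union_le ((Finset.univ.filter fun c => k ∈ openColumns X y z (r, c)) ∪
    B.toFinset) (Finset.univ.filter fun c => X (c, k) = X (y, c))
  have := Finset.card_union_le (Finset.univ.filter fun c => k ∈ openColumns X y z (r, c))
    B.toFinset
  omega

lemma Proper.mul_card_openPairs_le {n : ℕ} {X : Cell n → Fin n} (hX : Proper X) (y z : Fin n) :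
    n * (openPairs X y z).card ≤
      ∑ e, (openColumns X y z e).card + 15 * (openPairs X y z).card + n ^ 2 := by
  have h1 : ∑ p ∈ openPairs X y z, n ≤ ∑ p ∈ openPairs X y z,
      ((Finset.univ.filter fun c => p.2 ∈ openColumns X y z (p.1, c)).card + 15 +
        (Finset.univ.filter fun c => X (c, p.2) = X (y, c)).card) :=
    Finset.sum_le_sum fun p hp => hX.card_columns_of_openPair hp
  rw [Finset.sum_add_distrib, Finset.sum_add_distrib] at h1
  simp only [Finset.sum_const, smul_eq_mul] at h1
  have h2 : ∑ p ∈ openPairs X y z,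
      (Finset.univ.filter fun c => p.2 ∈ openColumns X y z (p.1, c)).card ≤
      ∑ e, (openColumns X y z e).card := by
    refine (Finset.sum_le_sum_of_subset (Finset.subset_univ _)).trans (le_of_eq ?_)
    rw [Fintype.sum_prod_type, Fintype.sum_prod_type]
    refine Finset.sum_congr rfl fun r _ => ?_
    simp only [Finset.card_filter]
    rw [Finset.sum_comm]
    refine Finset.sum_congr rfl fun c _ => ?_
    rw [← Finset.card_filter, Finset.filter_mem_eq_inter, Finset.univ_inter]
  have h3 : ∑ p ∈ openPairs X y z, (Finset.univ.filter fun c => X (c, p.2) = X (y, c)).card ≤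
      n ^ 2 := by
    refine (Finset.sum_le_sum_of_subset (Finset.subset_univ _)).trans ?_
    rw [Fintype.sum_prod_type]
    have h4 : ∀ r : Fin n, ∑ k : Fin n, (Finset.univ.filter fun c => X (c, k) = X (y, c)).card ≤
        n := by
      intro r
      simp only [Finset.card_filter]
      rw [Finset.sum_comm]
      refine (Finset.sum_le_card_nsmul _ _ 1 fun c _ => ?_).trans (by simp)
      rw [← Finset.card_filter]
      exact Finset.card_le_one.2 fun k hk k' hk' =>
        hX.row ((Finset.mem_filter.1 hk).2.trans (Finset.mem_filter.1 hk').2.symm)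
    refine (Finset.sum_le_sum fun r _ => h4 r).trans (le_of_eq ?_)
    simp [sq]
  rw [mul_comm n, mul_comm 15]
  omega

/-- The symbols that complete a bridging gadget at `e`, judging from the revealed entries `Y`. -/
def trap {n : ℕ} (Y : Cell n → Option (Fin n)) (y z : Fin n) (e : Cell n) : Finset (Fin n) :=
  Finset.univ.filter fun s => ∃ c' w k w' p q o,
    ([y, z, e.2, e.1, c', w, k, w'] : List (Fin n)).Nodup ∧
    ([p, s, q, o] : List (Fin n)).Nodup ∧ Y (w', z) = some s ∧ Y (y, e.2) = some p ∧
    Y (w', k) = some p ∧ Y (w, y) = some q ∧ Y (e.1, c') = some q ∧ Y (w, k) = some o ∧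
    Y (z, c') = some o

/-- The cells `(w₂, w₁)` of the bridging gadgets. -/
def closedCells {n : ℕ} (X : Cell n → Fin n) (y z : Fin n) : Finset (Cell n) :=
  Finset.univ.filter fun e => ∃ w, IsBridgeGadget (fun i j => X (i, j)) y z w ∧
    e = (w 1, w 0)

/-- The pairs `(w₂, w₅)` of the bridging gadgets. -/
def closedPairs {n : ℕ} (X : Cell n → Fin n) (y z : Fin n) : Finset (Cell n) :=
  Finset.univ.filter fun p => ∃ w, IsBridgeGadget (fun i j => X (i, j)) y z w ∧
    p = (w 1, w 4)

lemma mem_closedCells_of_mem_trap {n M : ℕ} {X : Cell n → Fin n} {y z : Fin n}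
    {τ : Cell n → Fin M} {e : Cell n} (h : X e ∈ trap (revealed τ e X) y z e) :
    e ∈ closedCells X y z := by
  obtain ⟨c', w, k, w', p, q, o, hnd, hcol, h1, h2, h3, h4, h5, h6, h7⟩ :=
    (Finset.mem_filter.1 h).2
  rw [revealed_eq_some] at *
  refine Finset.mem_filter.2 ⟨Finset.mem_univ _, ![e.2, e.1, c', w, k, w'], ⟨hnd, ?_⟩, rfl⟩
  refine ⟨h2.2.trans h3.2.symm, h1.2.symm, h4.2.trans h5.2.symm, h6.2.trans h7.2.symm, ?_⟩
  change ([X (y, e.2), X e, X (w, y), X (w, k)] : List (Fin n)).Nodup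
  rw [h2.2, h4.2, h6.2]
  exact hcol

lemma Proper.card_closedCells_le {n : ℕ} {X : Cell n → Fin n} (hX : Proper X) (y z : Fin n)
    (K : ℕ) : (closedCells X y z).card ≤
      (heavyCells X y z K).card + (K + 1) * (closedPairs X y z).card := by
  have h1 : ∀ e ∈ closedCells X y z, e.1 ≠ y ∧ e.2 ≠ z ∧ link X y z e ∈ closedPairs X y z := by
    intro e he
    obtain ⟨w, hw, rfl⟩ := (Finset.mem_filter.1 he).2
    obtain ⟨hnd, h1, h2, -⟩ := id hw
    simp only [List.nodup_cons, List.mem_cons, not_or] at hnd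
    refine ⟨Ne.symm hnd.1.2.2.1, Ne.symm hnd.2.1.1, Finset.mem_filter.2 ⟨Finset.mem_univ _, w,
      hw, hX.link_eq h2.symm h1.symm⟩⟩
  have h2 : (closedCells X y z \ heavyCells X y z K).card ≤
      (K + 1) * (closedPairs X y z).card := by
    refine (hX.card_le_mul_card_image_link y z (K := K) _
      (fun e he => (h1 e (Finset.mem_sdiff.1 he).1).2.1) fun e he => ?_).trans
      (Nat.mul_le_mul_left _ (Finset.card_le_card ?_))
    · obtain ⟨he1, he2⟩ := Finset.mem_sdiff.1 he
      by_contra hcon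
      exact he2 (Finset.mem_filter.2 ⟨Finset.mem_univ _, (h1 e he1).1, (h1 e he1).2.1,
        by exact_mod_cast (not_le.1 hcon).le⟩)
    · intro q hq
      obtain ⟨e, he, rfl⟩ := Finset.mem_image.1 hq
      exact (h1 e (Finset.mem_sdiff.1 he).1).2.2
  have := Finset.le_card_sdiff (heavyCells X y z K) (closedCells X y z)
  omega

lemma card_fibre_trap_ge {n m : ℕ} {X : Cell n → Fin n} (hX : Proper X) {y z : Fin n}
    {e : Cell n} {c' w k w' : Fin n} (h : OpenGadget X y z e.2 e.1 c' w k w')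
    {t : Fin (4 * m)} (ht : InWindow t) :
    ((fibre e t).card : ℝ) * (1 / 2 ^ 11) ≤ ((fibre e t).filter fun τ =>
      X (w', z) ∈ avail τ e X ∩ trap (revealed τ e X) y z e).card := by
  obtain ⟨hnd, hcol, h1, h2, h3⟩ := h
  obtain ⟨r, c⟩ := e
  dsimp only at *
  obtain ⟨c₀, hc₀⟩ := hX.exists_col r (X (w', z))
  obtain ⟨r₀, hr₀⟩ := hX.exists_row c (X (w', z))
  have hnd' := hnd
  have hcol' := hcol
  simp only [List.nodup_cons, List.mem_cons, not_or, List.not_mem_nil, not_false_eq_true,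
    List.nodup_nil, and_true] at hnd' hcol'
  obtain ⟨⟨a1, a2, a3, a4, a5, a6, a7⟩, ⟨b1, b2, b3, b4, b5, b6⟩, ⟨c1, c2, c3, c4, c5⟩,
    ⟨d1, d2, d3, d4⟩, ⟨e1, e2, e3⟩, ⟨f1, f2⟩, g1⟩ := hnd'
  obtain ⟨⟨p1, p2, p3⟩, ⟨p4, p5⟩, p6⟩ := hcol'
  set S₁ : Finset (Cell n) :=
    {(w', z), (y, c), (w', k), (w, y), (r, c'), (w, k), (z, c')} with hS₁
  set S₂ : Finset (Cell n) := {(r, c₀), (r₀, c)} with hS₂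
  have hS₁card : S₁.card ≤ 7 :=
    (Finset.card_insert_le _ _).trans (Nat.succ_le_succ Finset.card_le_six)
  obtain ⟨m1, m2, m3, m4, m5, m6, m7⟩ : (w', z) ∈ S₁ ∧ (y, c) ∈ S₁ ∧ (w', k) ∈ S₁ ∧
      (w, y) ∈ S₁ ∧ (r, c') ∈ S₁ ∧ (w, k) ∈ S₁ ∧ (z, c') ∈ S₁ := by
    simp only [hS₁, Finset.mem_insert, Finset.mem_singleton, true_or, or_true, and_self]
  have he : ((r, c) : Cell n) ∉ S₁ := by
    simp only [hS₁, Finset.mem_insert, Finset.mem_singleton, Prod.mk.injEq, not_or]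
    exact ⟨fun h => d4 h.1, fun h => a3 h.1.symm, fun h => d4 h.1, fun h => d2 h.1,
      fun h => c2 h.2, fun h => d2 h.1, fun h => b2 h.1.symm⟩
  have hval : ∀ x ∈ S₁, X x = X (w', z) → x = (w', z) := by
    intro x hx hxs
    simp only [hS₁, Finset.mem_insert, Finset.mem_singleton] at hx
    rcases hx with rfl | rfl | rfl | rfl | rfl | rfl | rfl
    · rfl
    · exact absurd hxs p1
    · exact absurd (h1.trans hxs) p1
    · exact absurd (hxs.symm.trans h2) p4
    · exact absurd hxs.symm p4
    · exact absurd (hxs.symm.trans h3) p5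
    · exact absurd hxs.symm p5
  have hdisj : Disjoint S₁ S₂ := by
    rw [Finset.disjoint_right]
    intro x hx hx'
    simp only [hS₂, Finset.mem_insert, Finset.mem_singleton] at hx
    rcases hx with rfl | rfl
    · exact d4 (congrArg Prod.fst (hval _ hx' hc₀))
    · exact b1 (congrArg Prod.snd (hval _ hx' hr₀)).symm
  have hge := card_fibre_filter_ge (r, c) t S₁ S₂ hdisj he hS₁card Finset.card_le_two
  refine le_trans ?_ (hge.trans ?_)
  · have h5 := ht.half_le
    have h6 := ht.quarter_le
    have h7 : (1 / 2 : ℝ) ^ 7 * (1 / 4) ^ 2 ≤ relTime t ^ 7 * (1 - relTime t) ^ 2 := by gcongr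
    have h8 : (1 / 2 : ℝ) ^ 7 * (1 / 4) ^ 2 = 1 / 2 ^ 11 := by norm_num
    rw [h8] at h7
    gcongr
  · refine Nat.cast_le.2 (Finset.card_le_card fun τ hτ => ?_)
    obtain ⟨hτ1, hτ2, hτ3⟩ := Finset.mem_filter.1 hτ
    have hτe : τ (r, c) = t := (Finset.mem_filter.1 hτ1).2
    rw [← hτe] at hτ2 hτ3
    refine Finset.mem_filter.2 ⟨hτ1, Finset.mem_inter.2 ⟨Finset.mem_filter.2 ⟨Finset.mem_univ _,
      ?_⟩, Finset.mem_filter.2 ⟨Finset.mem_univ _, c', w, k, w', X (y, c), X (r, c'), X (z, c'),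
      hnd, hcol, revealed_eq_some.2 ⟨hτ2 _ m1, rfl⟩, revealed_eq_some.2 ⟨hτ2 _ m2, rfl⟩,
      revealed_eq_some.2 ⟨hτ2 _ m3, h1.symm⟩, revealed_eq_some.2 ⟨hτ2 _ m4, h2⟩,
      revealed_eq_some.2 ⟨hτ2 _ m5, rfl⟩, revealed_eq_some.2 ⟨hτ2 _ m6, h3⟩,
      revealed_eq_some.2 ⟨hτ2 _ m7, rfl⟩⟩⟩⟩
    rintro ⟨r', c''⟩ hline hlt heq
    dsimp only at hline
    rcases hline with rfl | rfl
    · obtain rfl := hX.row (heq.trans hc₀.symm)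
      exact absurd (hτ3 (r', c'') (by simp [hS₂])) (not_le.2 hlt)
    · obtain rfl := hX.col (heq.trans hr₀.symm)
      exact absurd (hτ3 (r', c'') (by simp [hS₂])) (not_le.2 hlt)

lemma sum_card_trap_ge {n m : ℕ} {X : Cell n → Fin n} (hX : Proper X) (y z : Fin n)
    (e : Cell n) {t : Fin (4 * m)} (ht : InWindow t) :
    ((fibre e t).card : ℝ) * (1 / 2 ^ 11 * (openColumns X y z e).card) ≤
      ∑ τ ∈ fibre e t, ((avail τ e X ∩ trap (revealed τ e X) y z e).card : ℝ) := by
  have h5 : ∑ τ ∈ fibre e t, ((avail τ e X ∩ trap (revealed τ e X) y z e).card : ℝ) =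
      ∑ s, (((fibre e t).filter fun τ =>
        s ∈ avail τ e X ∩ trap (revealed τ e X) y z e).card : ℝ) := by
    have : ∀ τ : Cell n → Fin (4 * m),
        ((avail τ e X ∩ trap (revealed τ e X) y z e).card : ℝ) =
        ∑ s, if s ∈ avail τ e X ∩ trap (revealed τ e X) y z e then (1 : ℝ) else 0 := by
      intro τ
      rw [← Finset.sum_filter, Finset.filter_mem_eq_inter, Finset.univ_inter]
      simp
    rw [Finset.sum_congr rfl fun τ _ => this τ, Finset.sum_comm]
    refine Finset.sum_congr rfl fun s _ => ?_
    rw [Finset.card_filter]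
    push_cast
    rfl
  rw [h5]
  set f : Fin n → Fin n := fun k => X (rowOf X k (X (y, e.2)), z) with hf
  have hinj : Set.InjOn f (openColumns X y z e) := by
    intro k _ k' _ h
    have h1 : rowOf X k (X (y, e.2)) = rowOf X k' (X (y, e.2)) := hX.col h
    refine hX.row (r := rowOf X k (X (y, e.2))) ?_
    rw [hX.apply_rowOf, h1, hX.apply_rowOf]
  rw [← Finset.card_image_of_injOn hinj]
  refine le_trans ?_ (Finset.sum_le_sum_of_subset_of_nonneg (Finset.subset_univ
    ((openColumns X y z e).image f)) fun _ _ _ => Nat.cast_nonneg _)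
  rw [← mul_assoc, mul_comm, ← nsmul_eq_mul]
  refine Finset.card_nsmul_le_sum _ _ _ fun s hs => ?_
  obtain ⟨k, hk, rfl⟩ := Finset.mem_image.1 hs
  obtain ⟨c', w, w', hO⟩ := (Finset.mem_filter.1 hk).2
  have hw' : rowOf X k (X (y, e.2)) = w' := hX.col (by rw [hX.apply_rowOf, hO.2.2.1])
  simp only [hf, hw']
  exact card_fibre_trap_ge hX hO ht

/-- Latin squares without heavy cells and with few bridging gadgets are exponentially rare. -/
lemma exists_card_few_closedPairs_le : ∃ n₀ : ℕ, 0 < n₀ ∧ ∀ n, n₀ ≤ n →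
    ∀ y z : Fin n, y ≠ z → ((Finset.univ.filter fun X : Cell n → Fin n => Proper X ∧
      ((heavyCells X z y (2 ^ 13 / (1 / 2))).card : ℝ) < 1 / 2 * (n : ℝ) ^ 2 ∧
      ((heavyCells X y z (2 ^ 13 / (1 / 2 ^ 31))).card : ℝ) < 1 / 2 ^ 31 * (n : ℝ) ^ 2 ∧
      ((closedPairs X y z).card : ℝ) ≤ 53 * ((n : ℝ) ^ 2 / 10 ^ 50)).card : ℝ) ≤
      Real.exp (-(1 / 2 ^ 28 / 8 * (n : ℝ) ^ 2)) * Fintype.card (Colouring n) := by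
  obtain ⟨m, n₀, hn₀, H⟩ := exists_card_le_of_window_savings (1 / 2 ^ 28) (by positivity)
  refine ⟨max n₀ (2 ^ 30), lt_max_of_lt_left hn₀, fun n hn y z hyz => ?_⟩
  have hnbig : (2 : ℝ) ^ 30 ≤ n := by exact_mod_cast (le_max_right _ _).trans hn
  have hn' : (0 : ℝ) < n := by linarith
  refine H n ((le_max_left _ _).trans hn) _ (fun X hX => (Finset.mem_filter.1 hX).2.1)
    (fun τ e X s => if s ∈ trap (revealed τ e X) y z e then 1 / 2 else 1)
    (fun τ e X s => by split_ifs <;> norm_num) ?_ 4 ?_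
  · intro τ e X X' h
    simp only [revealed_congr τ e X X' h]
  · intro X hX
    obtain ⟨hXp, hG, hF, hfew⟩ := (Finset.mem_filter.1 hX).2
    refine ⟨fun e => -(1 / 2 ^ 12 * (openColumns X y z e).card),
      fun e => if e ∈ closedCells X y z then -1 else 0,
      fun e x hx _ => ?_, fun e t ht => ?_, fun e t ht => ?_, ?_⟩
    · have : 0 ≤ (1 / 2 ^ 12 * (openColumns X y z e).card : ℝ) := by positivity
      nlinarith
    · have h1 : ∀ τ : Cell n → Fin (4 * m), ∑ s ∈ avail τ e X,
          ((if s ∈ trap (revealed τ e X) y z e then (1 / 2 : ℝ) else 1) - 1) =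
          -(1 / 2) * (avail τ e X ∩ trap (revealed τ e X) y z e).card := by
        intro τ
        have h2 : ∀ s, ((if s ∈ trap (revealed τ e X) y z e then (1 / 2 : ℝ) else 1) - 1) =
            if s ∈ trap (revealed τ e X) y z e then (-(1 / 2) : ℝ) else 0 := by
          intro s; split_ifs <;> norm_num
        simp only [h2]
        rw [← Finset.sum_filter, Finset.filter_mem_eq_inter, Finset.sum_const, nsmul_eq_mul,
          mul_comm]
      rw [Finset.sum_congr rfl fun τ _ => h1 τ, ← Finset.mul_sum]
      have h3 := sum_card_trap_ge hXp y z e ht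
      dsimp only
      linarith
    · rw [← nsmul_eq_mul]
      refine Finset.card_nsmul_le_sum _ _ _ fun τ _ => ?_
      dsimp only
      by_cases h : X e ∈ trap (revealed τ e X) y z e
      · rw [if_pos (mem_closedCells_of_mem_trap h), if_pos h, one_div, Real.log_inv]
        have := Real.log_two_lt_d9
        linarith
      · rw [if_neg h, Real.log_one]
        split_ifs <;> norm_num
    · have h1 : ∑ e, (4 * -(1 / 2 ^ 12 * ((openColumns X y z e).card : ℝ)) / n -
          if e ∈ closedCells X y z then (-1 : ℝ) else 0) =
          -(1 / 2 ^ 10 * ((∑ e, (openColumns X y z e).card : ℕ) : ℝ) / n) +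
            (closedCells X y z).card := by
        rw [Finset.sum_sub_distrib, ← Finset.sum_filter, Finset.filter_mem_eq_inter,
          Finset.univ_inter, Finset.sum_const, nsmul_eq_mul, ← Finset.sum_div, ← Finset.mul_sum,
          Finset.sum_neg_distrib, ← Finset.mul_sum]
        push_cast
        ring
      rw [h1]
      have hclosed : ((closedCells X y z).card : ℝ) ≤ 1 / 2 ^ 30 * (n : ℝ) ^ 2 := by
        have h2 := hXp.card_closedCells_le y z (2 ^ 44)
        have h3 : (2 : ℝ) ^ 13 / (1 / 2 ^ 31) = ((2 ^ 44 : ℕ) : ℝ) := by norm_num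
        rw [h3] at hF
        have h4 : ((closedCells X y z).card : ℝ) ≤ (heavyCells X y z ((2 ^ 44 : ℕ) : ℝ)).card +
            (2 ^ 44 + 1) * (closedPairs X y z).card := by exact_mod_cast h2
        have h5 : (0 : ℝ) < (n : ℝ) ^ 2 := by positivity
        generalize ((heavyCells X y z ((2 ^ 44 : ℕ) : ℝ)).card : ℝ) = N at h4 hF
        linarith
      have hpairs : 1 / 2 ^ 16 * (n : ℝ) ^ 2 ≤ (openPairs X y z).card := by
        have h3 : (2 : ℝ) ^ 13 / (1 / 2) = ((2 ^ 14 : ℕ) : ℝ) := by norm_num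
        rw [h3] at hG
        set S : Finset (Cell n) := (Finset.univ \ heavyCells X z y ((2 ^ 14 : ℕ) : ℝ)) \
          ((Finset.univ.filter fun e : Cell n => e.1 = z) ∪
            Finset.univ.filter fun e : Cell n => e.2 = y) with hS
        have hSmem : ∀ e ∈ S, e.1 ≠ z ∧ e.2 ≠ y ∧ (collisions X z y e.1 e.2).card ≤ 2 ^ 14 := by
          intro e he
          simp only [hS, Finset.mem_sdiff, Finset.mem_union, Finset.mem_filter, Finset.mem_univ,
            true_and, not_or] at he
          refine ⟨he.2.1, he.2.2, ?_⟩
          by_contra hcon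
          exact he.1 (Finset.mem_filter.2 ⟨Finset.mem_univ _, he.2.1, he.2.2,
            by exact_mod_cast (not_le.1 hcon).le⟩)
        have h4 := hXp.card_light_le hyz S (fun e he => (hSmem e he).1)
          (fun e he => (hSmem e he).2.1) fun e he => (hSmem e he).2.2
        have h5 : (Finset.univ.filter fun e : Cell n => e.1 = z).card ≤ n := by
          refine (card_le_of_determined _ (fun e b => e.2 = b) (fun _ _ => ⟨_, rfl⟩) ?_).trans
            (Fintype.card_fin n).le
          intro a ha a' ha' b h h'
          exact Prod.ext ((Finset.mem_filter.1 ha).2.trans (Finset.mem_filter.1 ha').2.symm)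
            (h.trans h'.symm)
        have h6 : (Finset.univ.filter fun e : Cell n => e.2 = y).card ≤ n := by
          refine (card_le_of_determined _ (fun e b => e.1 = b) (fun _ _ => ⟨_, rfl⟩) ?_).trans
            (Fintype.card_fin n).le
          intro a ha a' ha' b h h'
          exact Prod.ext (h.trans h'.symm)
            ((Finset.mem_filter.1 ha).2.trans (Finset.mem_filter.1 ha').2.symm)
        have h7 := Finset.card_union_le (Finset.univ.filter fun e : Cell n => e.1 = z)
          (Finset.univ.filter fun e : Cell n => e.2 = y)
        have h8 := Finset.le_card_sdiff ((Finset.univ.filter fun e : Cell n => e.1 = z) ∪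
          Finset.univ.filter fun e : Cell n => e.2 = y)
          (Finset.univ \ heavyCells X z y ((2 ^ 14 : ℕ) : ℝ))
        have h9 := Finset.le_card_sdiff (heavyCells X z y ((2 ^ 14 : ℕ) : ℝ))
          (Finset.univ : Finset (Cell n))
        have h10 : (Finset.univ : Finset (Cell n)).card = n ^ 2 := by simp [sq]
        rw [← hS] at h8
        have h11 : n ^ 2 ≤ (2 ^ 14 + 1) * ((openPairs X y z).card + 10 * n) + 2 * n +
            (heavyCells X z y ((2 ^ 14 : ℕ) : ℝ)).card := by omega
        have h12 : (n : ℝ) ^ 2 ≤ (2 ^ 14 + 1) * ((openPairs X y z).card + 10 * n) + 2 * n +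
            (heavyCells X z y ((2 ^ 14 : ℕ) : ℝ)).card := by exact_mod_cast h11
        generalize ((heavyCells X z y ((2 ^ 14 : ℕ) : ℝ)).card : ℝ) = N at h12 hG
        have h13 : (2 : ℝ) ^ 30 * n ≤ (n : ℝ) ^ 2 := by rw [sq]; gcongr
        linarith
      have hcols : 1 / 2 ^ 17 * (n : ℝ) ^ 3 ≤ ((∑ e, (openColumns X y z e).card : ℕ) : ℝ) := by
        have h2 : (n : ℝ) * (openPairs X y z).card ≤ ((∑ e, (openColumns X y z e).card : ℕ) : ℝ) +
            15 * (openPairs X y z).card + (n : ℝ) ^ 2 := by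
          exact_mod_cast hXp.mul_card_openPairs_le y z
        have h3 : ((n : ℝ) - 15) * (1 / 2 ^ 16 * (n : ℝ) ^ 2) ≤
            ((n : ℝ) - 15) * (openPairs X y z).card :=
          mul_le_mul_of_nonneg_left hpairs (by linarith)
        have h4 : (2 : ℝ) ^ 30 * (n : ℝ) ^ 2 ≤ n * (n : ℝ) ^ 2 := by gcongr
        have h5 : 0 ≤ (n : ℝ) ^ 2 := by positivity
        have h6 : (n : ℝ) ^ 3 = n * (n : ℝ) ^ 2 := by ring
        rw [h6]
        linarith
      have h13 : 1 / 2 ^ 27 * (n : ℝ) ^ 2 ≤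
          1 / 2 ^ 10 * ((∑ e, (openColumns X y z e).card : ℕ) : ℝ) / n := by
        rw [le_div_iff₀ hn']
        have h6 : 1 / 2 ^ 27 * (n : ℝ) ^ 2 * n = 1 / 2 ^ 10 * (1 / 2 ^ 17 * (n : ℝ) ^ 3) := by
          ring
        rw [h6]
        gcongr
      have h5 : 0 ≤ (n : ℝ) ^ 2 := by positivity
      linarith

lemma Proper.bridge_determined {n : ℕ} {X : Cell n → Fin n} (hX : Proper X) {y z : Fin n}
    {w w' : Fin 6 → Fin n} (hw : IsBridgeGadget (fun i j => X (i, j)) y z w)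
    (hw' : IsBridgeGadget (fun i j => X (i, j)) y z w') (h : w 1 = w' 1)
    (h' : w 0 = w' 0 ∨ w 2 = w' 2 ∨ w 3 = w' 3 ∨ w 4 = w' 4 ∨ w 5 = w' 5) : w 4 = w' 4 := by
  obtain ⟨-, a1, a2, a3, a4, -⟩ := hw
  obtain ⟨-, b1, b2, b3, b4, -⟩ := hw'
  have of23 : w 2 = w' 2 → w 3 = w' 3 → w 4 = w' 4 := fun h2 h3 => by
    rw [h3, h2, ← b4] at a4
    exact hX.row a4
  have of05 : w 0 = w' 0 → w 5 = w' 5 → w 4 = w' 4 := fun h0 h5 => by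
    rw [h0, h5, b1] at a1
    exact (hX.row a1).symm
  rcases h' with h' | h' | h' | h' | h'
  · refine of05 h' ?_
    rw [h, h', b2] at a2
    exact (hX.col a2).symm
  · refine of23 h' ?_
    rw [h, h', ← b3] at a3
    exact hX.col a3
  · refine of23 ?_ h'
    rw [h, h', b3] at a3
    exact (hX.row a3).symm
  · exact h'
  · refine of05 ?_ h'
    rw [h, h', ← b2] at a2
    exact hX.row a2

lemma IsBridgeGadget.colour {n : ℕ} {φ : Fin n → Fin n → Fin n} {y z : Fin n} {w : Fin 6 → Fin n}
    (hw : IsBridgeGadget φ y z w) {d : Fin n} (hd : bridgeHasColour φ y z w d) :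
    φ y (w 0) = d ∨ φ (w 5) z = d ∨ φ (w 3) y = d ∨ φ z (w 2) = d := by
  obtain ⟨-, h1, h2, h3, h4, -⟩ := hw
  rcases hd with rfl | rfl | rfl | rfl | rfl | rfl | rfl | rfl
  · exact Or.inl rfl
  · exact Or.inr (Or.inl h2.symm)
  · exact Or.inr (Or.inr (Or.inl h3))
  · exact Or.inr (Or.inr (Or.inr rfl))
  · exact Or.inr (Or.inr (Or.inl rfl))
  · exact Or.inr (Or.inr (Or.inr h4.symm))
  · exact Or.inl h1
  · exact Or.inr (Or.inl rfl)

/-- If no well-spread collection of `M` bridging gadgets exists, then the bridging gadgets have few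
pairs `(w₂, w₅)`. -/
lemma Proper.card_closedPairs_le {n : ℕ} {X : Cell n → Fin n} (hX : Proper X) {y z : Fin n}
    {M : ℝ} (hM : ∀ ℬ : Finset (Fin 6 → Fin n),
      (∀ w ∈ ℬ, IsBridgeGadget (fun i j => X (i, j)) y z w) →
      WellSpreadBridgeGadgets (fun i j => X (i, j)) y z ℬ → (ℬ.card : ℝ) < M) :
    ((closedPairs X y z).card : ℝ) ≤ 53 * M := by
  set φ : Fin n → Fin n → Fin n := fun i j => X (i, j) with hφ
  obtain ⟨ℬ, hℬ, hmax⟩ := Finset.exists_max_image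
    (Finset.univ.filter fun ℬ : Finset (Fin 6 → Fin n) =>
      (∀ w ∈ ℬ, IsBridgeGadget φ y z w) ∧ WellSpreadBridgeGadgets φ y z ℬ) Finset.card
    ⟨∅, Finset.mem_filter.2 ⟨Finset.mem_univ _, by simp, by simp [WellSpreadBridgeGadgets]⟩⟩
  obtain ⟨hgad, hspread⟩ := (Finset.mem_filter.1 hℬ).2
  have hg : ∀ p : Cell n, ∃ w : Fin 6 → Fin n, p ∈ closedPairs X y z →
      IsBridgeGadget φ y z w ∧ p = (w 1, w 4) := by
    intro p
    by_cases hp : p ∈ closedPairs X y z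
    · obtain ⟨w, hw⟩ := (Finset.mem_filter.1 hp).2
      exact ⟨w, fun _ => hw⟩
    · exact ⟨fun _ => y, fun h => absurd h hp⟩
  choose g hg using hg
  set P := closedPairs X y z with hP
  set U : Finset (Fin n) := Finset.univ.filter fun u => u ≠ y ∧ u ≠ z ∧
    n ≤ (ℬ.filter fun w => u ∈ bridgeVerts y z w).card with hU
  set D : Finset (Fin n) := Finset.univ.filter fun d =>
    n ≤ (ℬ.filter fun w => bridgeHasColour φ y z w d).card with hD
  have hdet : ∀ S : Finset (Cell n), S ⊆ P → (∀ p ∈ S, ∀ q ∈ S, g p 1 = g q 1 →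
      g p 0 = g q 0 ∨ g p 2 = g q 2 ∨ g p 3 = g q 3 ∨ g p 4 = g q 4 ∨ g p 5 = g q 5) →
      S.card ≤ n := by
    intro S hS h
    refine (card_le_of_determined S (fun p b => p.1 = b) (fun _ _ => ⟨_, rfl⟩) ?_).trans
      (Fintype.card_fin n).le
    intro p hp q hq b hb hb'
    obtain ⟨hp1, hp2⟩ := hg p (hS hp)
    obtain ⟨hq1, hq2⟩ := hg q (hS hq)
    have h1 : g p 1 = g q 1 := by
      have := hb.trans hb'.symm
      rw [hp2, hq2] at this
      exact this
    rw [hp2, hq2, h1, hX.bridge_determined hp1 hq1 h1 (h p hp q hq h1)]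
  have hvert : ∀ u, u ≠ y → u ≠ z →
      (P.filter fun p => u ∈ bridgeVerts y z (g p)).card ≤ 6 * n := by
    intro u huy huz
    have hsub : (P.filter fun p => u ∈ bridgeVerts y z (g p)) ⊆
        (Finset.univ : Finset (Fin 6)).biUnion fun i => P.filter fun p => g p i = u := by
      intro p hp
      obtain ⟨hp1, hp2⟩ := Finset.mem_filter.1 hp
      simp only [bridgeVerts, Finset.mem_insert, huy, huz, false_or, Finset.mem_image] at hp2
      obtain ⟨i, -, hi⟩ := hp2
      exact Finset.mem_biUnion.2 ⟨i, Finset.mem_univ _, Finset.mem_filter.2 ⟨hp1, hi⟩⟩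
    refine (Finset.card_le_card hsub).trans ?_
    have h6 : ∀ i ∈ (Finset.univ : Finset (Fin 6)), (P.filter fun p => g p i = u).card ≤ n := by
      intro i _
      by_cases hi : i = 1
      · subst hi
        refine (card_le_of_determined _ (fun p b => p.2 = b) (fun _ _ => ⟨_, rfl⟩) ?_).trans
          (Fintype.card_fin n).le
        intro p hp q hq b hb hb'
        obtain ⟨hp1, hp2⟩ := Finset.mem_filter.1 hp
        obtain ⟨hq1, hq2⟩ := Finset.mem_filter.1 hq
        refine Prod.ext ?_ (hb.trans hb'.symm)
        rw [(hg p hp1).2, (hg q hq1).2]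
        exact hp2.trans hq2.symm
      · refine hdet _ (Finset.filter_subset _ _) fun p hp q hq _ => ?_
        have h1 := (Finset.mem_filter.1 hp).2.trans (Finset.mem_filter.1 hq).2.symm
        fin_cases i
        · exact Or.inl h1
        · exact absurd rfl hi
        · exact Or.inr (Or.inl h1)
        · exact Or.inr (Or.inr (Or.inl h1))
        · exact Or.inr (Or.inr (Or.inr (Or.inl h1)))
        · exact Or.inr (Or.inr (Or.inr (Or.inr h1)))
    simpa using Finset.card_biUnion_le_card_mul _ _ _ h6
  have hcol : ∀ d, (P.filter fun p => bridgeHasColour φ y z (g p) d).card ≤ 4 * n := by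
    intro d
    have hsub : (P.filter fun p => bridgeHasColour φ y z (g p) d) ⊆
        ((P.filter fun p => φ y (g p 0) = d) ∪ P.filter fun p => φ (g p 5) z = d) ∪
        ((P.filter fun p => φ (g p 3) y = d) ∪ P.filter fun p => φ z (g p 2) = d) := by
      intro p hp
      obtain ⟨hp1, hp2⟩ := Finset.mem_filter.1 hp
      rcases (hg p hp1).1.colour hp2 with h | h | h | h
      · exact Finset.mem_union_left _ (Finset.mem_union_left _ (Finset.mem_filter.2 ⟨hp1, h⟩))
      · exact Finset.mem_union_left _ (Finset.mem_union_right _ (Finset.mem_filter.2 ⟨hp1, h⟩))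
      · exact Finset.mem_union_right _ (Finset.mem_union_left _ (Finset.mem_filter.2 ⟨hp1, h⟩))
      · exact Finset.mem_union_right _ (Finset.mem_union_right _ (Finset.mem_filter.2 ⟨hp1, h⟩))
    have h0 : (P.filter fun p => φ y (g p 0) = d).card ≤ n :=
      hdet _ (Finset.filter_subset _ _) fun p hp q hq _ => Or.inl
        (hX.row ((Finset.mem_filter.1 hp).2.trans (Finset.mem_filter.1 hq).2.symm))
    have h5 : (P.filter fun p => φ (g p 5) z = d).card ≤ n :=
      hdet _ (Finset.filter_subset _ _) fun p hp q hq _ => Or.inr (Or.inr (Or.inr (Or.inr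
        (hX.col ((Finset.mem_filter.1 hp).2.trans (Finset.mem_filter.1 hq).2.symm)))))
    have h3 : (P.filter fun p => φ (g p 3) y = d).card ≤ n :=
      hdet _ (Finset.filter_subset _ _) fun p hp q hq _ => Or.inr (Or.inr (Or.inl
        (hX.col ((Finset.mem_filter.1 hp).2.trans (Finset.mem_filter.1 hq).2.symm))))
    have h2 : (P.filter fun p => φ z (g p 2) = d).card ≤ n :=
      hdet _ (Finset.filter_subset _ _) fun p hp q hq _ => Or.inr (Or.inl
        (hX.row ((Finset.mem_filter.1 hp).2.trans (Finset.mem_filter.1 hq).2.symm)))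
    have a1 := Finset.card_le_card hsub
    have a2 := Finset.card_union_le
      ((P.filter fun p => φ y (g p 0) = d) ∪ P.filter fun p => φ (g p 5) z = d)
      ((P.filter fun p => φ (g p 3) y = d) ∪ P.filter fun p => φ z (g p 2) = d)
    have a3 := Finset.card_union_le (P.filter fun p => φ y (g p 0) = d)
      (P.filter fun p => φ (g p 5) z = d)
    have a4 := Finset.card_union_le (P.filter fun p => φ (g p 3) y = d)
      (P.filter fun p => φ z (g p 2) = d)
    omega
  have hUcard : n * U.card ≤ 6 * ℬ.card := by
    have h1 : U.card • n ≤ ∑ u ∈ U, (ℬ.filter fun w => u ∈ bridgeVerts y z w).card :=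
      Finset.card_nsmul_le_sum _ _ _ fun u hu => (Finset.mem_filter.1 hu).2.2.2
    have h2 : ∑ u ∈ U, (ℬ.filter fun w => u ∈ bridgeVerts y z w).card ≤ ℬ.card • 6 := by
      simp only [Finset.card_filter]
      rw [Finset.sum_comm]
      refine Finset.sum_le_card_nsmul _ _ _ fun w _ => ?_
      rw [← Finset.card_filter]
      refine (Finset.card_le_card (t := Finset.univ.image w) fun u hu => ?_).trans
        (Finset.card_image_le.trans (by simp))
      obtain ⟨hu1, hu2⟩ := Finset.mem_filter.1 hu
      obtain ⟨-, huy, huz, -⟩ := Finset.mem_filter.1 hu1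
      simpa only [bridgeVerts, Finset.mem_insert, huy, huz, false_or] using hu2
    simp only [smul_eq_mul] at h1 h2
    linarith
  have hDcard : n * D.card ≤ 4 * ℬ.card := by
    have h1 : D.card • n ≤ ∑ d ∈ D, (ℬ.filter fun w => bridgeHasColour φ y z w d).card :=
      Finset.card_nsmul_le_sum _ _ _ fun d hd => (Finset.mem_filter.1 hd).2
    have h2 : ∑ d ∈ D, (ℬ.filter fun w => bridgeHasColour φ y z w d).card ≤ ℬ.card • 4 := by
      simp only [Finset.card_filter]
      rw [Finset.sum_comm]
      refine Finset.sum_le_card_nsmul _ _ _ fun w hw => ?_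
      rw [← Finset.card_filter]
      refine (Finset.card_le_card (t := {φ y (w 0), φ (w 5) z, φ (w 3) y, φ z (w 2)})
        fun d hd => ?_).trans Finset.card_le_four
      simp only [Finset.mem_insert, Finset.mem_singleton]
      rcases (hgad w hw).colour (Finset.mem_filter.1 hd).2 with h | h | h | h
      · exact Or.inl h.symm
      · exact Or.inr (Or.inl h.symm)
      · exact Or.inr (Or.inr (Or.inl h.symm))
      · exact Or.inr (Or.inr (Or.inr h.symm))
    simp only [smul_eq_mul] at h1 h2
    linarith
  have hcover : P ⊆ (P.filter fun p => g p ∈ ℬ) ∪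
      ((U.biUnion fun u => P.filter fun p => u ∈ bridgeVerts y z (g p)) ∪
        D.biUnion fun d => P.filter fun p => bridgeHasColour φ y z (g p) d) := by
    intro p hp
    by_contra hcon
    simp only [Finset.mem_union, Finset.mem_biUnion, Finset.mem_filter, hp, true_and, not_or,
      not_exists, not_and] at hcon
    obtain ⟨hnot, hu, hd⟩ := hcon
    have hins : insert (g p) ℬ ∈ Finset.univ.filter fun ℬ : Finset (Fin 6 → Fin n) =>
        (∀ w ∈ ℬ, IsBridgeGadget φ y z w) ∧ WellSpreadBridgeGadgets φ y z ℬ := by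
      refine Finset.mem_filter.2 ⟨Finset.mem_univ _, fun w hw => ?_, fun u huy huz => ?_,
        fun d => ?_⟩
      · rcases Finset.mem_insert.1 hw with rfl | hw
        · exact (hg p hp).1
        · exact hgad w hw
      · rw [Finset.filter_insert]
        split_ifs with h
        · refine (Finset.card_insert_le _ _).trans ?_
          by_contra hlt
          exact hu u (Finset.mem_filter.2 ⟨Finset.mem_univ _, huy, huz, by omega⟩) h
        · exact hspread.1 u huy huz
      · rw [Finset.filter_insert]
        split_ifs with h
        · refine (Finset.card_insert_le _ _).trans ?_
          by_contra hlt
          exact hd d (Finset.mem_filter.2 ⟨Finset.mem_univ _, by omega⟩) h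
        · exact hspread.2 d
    have := hmax _ hins
    rw [Finset.card_insert_of_notMem hnot] at this
    omega
  have hin : (P.filter fun p => g p ∈ ℬ).card ≤ ℬ.card := by
    refine Finset.card_le_card_of_injOn g (fun p hp => (Finset.mem_filter.1 hp).2) ?_
    intro p hp q hq h
    rw [(hg p (Finset.mem_filter.1 hp).1).2, (hg q (Finset.mem_filter.1 hq).1).2, h]
  have hPcard : P.card ≤ 53 * ℬ.card := by
    have a1 := Finset.card_le_card hcover
    have a2 := Finset.card_union_le (P.filter fun p => g p ∈ ℬ)
      ((U.biUnion fun u => P.filter fun p => u ∈ bridgeVerts y z (g p)) ∪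
        D.biUnion fun d => P.filter fun p => bridgeHasColour φ y z (g p) d)
    have a3 := Finset.card_union_le
      (U.biUnion fun u => P.filter fun p => u ∈ bridgeVerts y z (g p))
      (D.biUnion fun d => P.filter fun p => bridgeHasColour φ y z (g p) d)
    have a4 := Finset.card_biUnion_le_card_mul U
      (fun u => P.filter fun p => u ∈ bridgeVerts y z (g p)) (6 * n) fun u hu =>
        hvert u (Finset.mem_filter.1 hu).2.1 (Finset.mem_filter.1 hu).2.2.1
    have a5 := Finset.card_biUnion_le_card_mul D
      (fun d => P.filter fun p => bridgeHasColour φ y z (g p) d) (4 * n) fun d _ => hcol d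
    nlinarith
  have hlt := hM ℬ hgad hspread
  have hPcard' : (P.card : ℝ) ≤ 53 * ℬ.card := by exact_mod_cast hPcard
  linarith

/-- Colourings without well-spread collections of bridging gadgets are exponentially rare. -/
lemma exists_card_not_bridge_le : ∃ a : ℝ, 0 < a ∧ ∃ n₀ : ℕ, ∀ n, n₀ ≤ n →
    ((Finset.univ.filter fun X : Cell n → Fin n =>
      Proper X ∧ ¬ HasBridgeGadgets fun i j => X (i, j)).card : ℝ) ≤
      Real.exp (-(a * (n : ℝ) ^ 2)) * Fintype.card (Colouring n) := by
  obtain ⟨n₁, hn₁, H₁⟩ := exists_card_heavy_le (1 / 2) (by norm_num)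
  obtain ⟨n₂, hn₂, H₂⟩ := exists_card_heavy_le (1 / 2 ^ 31) (by norm_num)
  obtain ⟨n₃, hn₃, H₃⟩ := exists_card_few_closedPairs_le
  refine ⟨1 / 2 ^ 43, by norm_num, max (max n₁ n₂) (max n₃ (2 ^ 46)), fun n hn => ?_⟩
  simp only [max_le_iff] at hn
  obtain ⟨⟨h1, h2⟩, h3, h4⟩ := hn
  have hnbig : (2 : ℝ) ^ 46 ≤ n := by exact_mod_cast h4
  set C : ℝ := Real.exp (-(1 / 2 ^ 42 * (n : ℝ) ^ 2)) * Fintype.card (Colouring n) with hC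
  set B₁ : Cell n → Finset (Cell n → Fin n) := fun p => Finset.univ.filter fun X => Proper X ∧
    1 / 2 * (n : ℝ) ^ 2 ≤ (heavyCells X p.2 p.1 (2 ^ 13 / (1 / 2))).card with hB₁
  set B₂ : Cell n → Finset (Cell n → Fin n) := fun p => Finset.univ.filter fun X => Proper X ∧
    1 / 2 ^ 31 * (n : ℝ) ^ 2 ≤ (heavyCells X p.1 p.2 (2 ^ 13 / (1 / 2 ^ 31))).card with hB₂
  set B₃ : Cell n → Finset (Cell n → Fin n) := fun p => Finset.univ.filter fun X => Proper X ∧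
    ((heavyCells X p.2 p.1 (2 ^ 13 / (1 / 2))).card : ℝ) < 1 / 2 * (n : ℝ) ^ 2 ∧
    ((heavyCells X p.1 p.2 (2 ^ 13 / (1 / 2 ^ 31))).card : ℝ) < 1 / 2 ^ 31 * (n : ℝ) ^ 2 ∧
    ((closedPairs X p.1 p.2).card : ℝ) ≤ 53 * ((n : ℝ) ^ 2 / 10 ^ 50) with hB₃
  have hexp : ∀ b : ℝ, 1 / 2 ^ 42 ≤ b →
      Real.exp (-(b * (n : ℝ) ^ 2)) * Fintype.card (Colouring n) ≤ C := by
    intro b hb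
    rw [hC]
    gcongr
  have hB₁' : ∀ p, ((B₁ p).card : ℝ) ≤ C := fun p =>
    (H₁ n h1 p.2 p.1).trans (hexp _ (by norm_num))
  have hB₂' : ∀ p, ((B₂ p).card : ℝ) ≤ C := fun p =>
    (H₂ n h2 p.1 p.2).trans (hexp _ (by norm_num))
  have hB₃' : ∀ p : Cell n, p.1 ≠ p.2 → ((B₃ p).card : ℝ) ≤ C := fun p hp =>
    (H₃ n h3 p.1 p.2 hp).trans (hexp _ (by norm_num))
  have hcover : (Finset.univ.filter fun X : Cell n → Fin n =>
      Proper X ∧ ¬ HasBridgeGadgets fun i j => X (i, j)) ⊆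
      (Finset.univ.filter fun p : Cell n => p.1 ≠ p.2).biUnion fun p =>
        B₁ p ∪ B₂ p ∪ B₃ p := by
    intro X hX
    obtain ⟨hXp, hno⟩ := (Finset.mem_filter.1 hX).2
    unfold HasBridgeGadgets at hno
    push Not at hno
    obtain ⟨y, z, hyz, hno⟩ := hno
    refine Finset.mem_biUnion.2 ⟨(y, z), Finset.mem_filter.2 ⟨Finset.mem_univ _, hyz⟩, ?_⟩
    have hpairs := hXp.card_closedPairs_le hno
    by_cases c1 : 1 / 2 * (n : ℝ) ^ 2 ≤ (heavyCells X z y (2 ^ 13 / (1 / 2))).card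
    · exact Finset.mem_union_left _ (Finset.mem_union_left _
        (Finset.mem_filter.2 ⟨Finset.mem_univ _, hXp, c1⟩))
    by_cases c2 : 1 / 2 ^ 31 * (n : ℝ) ^ 2 ≤ (heavyCells X y z (2 ^ 13 / (1 / 2 ^ 31))).card
    · exact Finset.mem_union_left _ (Finset.mem_union_right _
        (Finset.mem_filter.2 ⟨Finset.mem_univ _, hXp, c2⟩))
    exact Finset.mem_union_right _ (Finset.mem_filter.2 ⟨Finset.mem_univ _, hXp, not_le.1 c1,
      not_le.1 c2, hpairs⟩)
  have hCpos : 0 ≤ C := by positivity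
  have hsum : ((Finset.univ.filter fun X : Cell n → Fin n =>
      Proper X ∧ ¬ HasBridgeGadgets fun i j => X (i, j)).card : ℝ) ≤ (n : ℝ) ^ 2 * (3 * C) := by
    have h5 : ((Finset.univ.filter fun X : Cell n → Fin n =>
        Proper X ∧ ¬ HasBridgeGadgets fun i j => X (i, j)).card : ℝ) ≤
        ∑ p ∈ Finset.univ.filter fun p : Cell n => p.1 ≠ p.2,
          ((B₁ p ∪ B₂ p ∪ B₃ p).card : ℝ) := by
      exact_mod_cast (Finset.card_le_card hcover).trans Finset.card_biUnion_le
    refine h5.trans ((Finset.sum_le_card_nsmul _ _ (3 * C) fun p hp => ?_).trans ?_)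
    · have h6 : ((B₁ p ∪ B₂ p ∪ B₃ p).card : ℝ) ≤ (B₁ p).card + (B₂ p).card + (B₃ p).card := by
        exact_mod_cast (Finset.card_union_le _ _).trans
          (Nat.add_le_add_right (Finset.card_union_le _ _) _)
      have := hB₁' p
      have := hB₂' p
      have := hB₃' p (Finset.mem_filter.1 hp).2
      linarith
    · rw [nsmul_eq_mul]
      refine mul_le_mul_of_nonneg_right ?_ (by positivity)
      have h7 : (Finset.univ.filter fun p : Cell n => p.1 ≠ p.2).card ≤ n ^ 2 :=
        (Finset.card_le_univ _).trans (by simp [sq])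
      exact_mod_cast h7
  refine hsum.trans ?_
  have h8 : (n : ℝ) ^ 2 * 3 ≤ Real.exp (1 / 2 ^ 43 * (n : ℝ) ^ 2) := by
    have h9 := Real.quadratic_le_exp_of_nonneg (x := 1 / 2 ^ 43 * (n : ℝ) ^ 2) (by positivity)
    have h10 : ((2 : ℝ) ^ 46) ^ 2 ≤ (n : ℝ) ^ 2 := by gcongr
    have h11 : 0 ≤ (n : ℝ) ^ 2 := by positivity
    nlinarith
  have h12 : Real.exp (-(1 / 2 ^ 43 * (n : ℝ) ^ 2)) =
      Real.exp (1 / 2 ^ 43 * (n : ℝ) ^ 2) * Real.exp (-(1 / 2 ^ 42 * (n : ℝ) ^ 2)) := by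
    rw [← Real.exp_add]
    congr 1
    ring
  calc (n : ℝ) ^ 2 * (3 * C) = (n : ℝ) ^ 2 * 3 * C := by ring
    _ ≤ Real.exp (1 / 2 ^ 43 * (n : ℝ) ^ 2) * C := by gcongr
    _ = _ := by rw [h12, hC, mul_assoc]

/-- With probability at least `1 - exp(-a n²)`, a uniformly random
proper `n`-arc-colouring contains, for all distinct `y, z`, a well-spread collection of
at least `n²/10⁵⁰` `(y,z)`-bridging gadgets. -/
theorem statement_9 :
    ∃ a : ℝ, 0 < a ∧ ∃ n₀ : ℕ, ∀ n : ℕ, n₀ ≤ n →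
      (1 - Real.exp (-(a * (n : ℝ) ^ 2))) * (Nat.card (Colouring n) : ℝ) ≤
        (Nat.card {G : Colouring n // HasBridgeGadgets G.1} : ℝ) := by
  obtain ⟨a, ha, n₀, h⟩ := exists_card_not_bridge_le
  refine ⟨a, ha, n₀, fun n hn => ?_⟩
  have hbad := h n hn
  rw [Nat.card_eq_fintype_card, Nat.card_eq_fintype_card,
    Fintype.card_subtype fun G : Colouring n => HasBridgeGadgets G.1]
  have hsplit := Finset.card_filter_add_card_filter_not (s := (Finset.univ : Finset (Colouring n)))
    (fun G => HasBridgeGadgets G.1)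
  have hinj : (Finset.univ.filter fun G : Colouring n => ¬ HasBridgeGadgets G.1).card ≤
      (Finset.univ.filter fun X : Cell n → Fin n =>
        Proper X ∧ ¬ HasBridgeGadgets fun i j => X (i, j)).card := by
    refine Finset.card_le_card_of_injOn (fun G p => G.1 p.1 p.2) (fun G hG => ?_) ?_
    · simpa using ⟨G.2, by simpa using hG⟩
    · intro G _ G' _ hGG'
      ext1
      funext i j
      exact congrFun hGG' (i, j)
  rw [Finset.card_univ] at hsplit
  have hsplit' : ((Finset.univ.filter fun G : Colouring n => HasBridgeGadgets G.1).card : ℝ) +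
      (Finset.univ.filter fun G : Colouring n => ¬ HasBridgeGadgets G.1).card =
      Fintype.card (Colouring n) := by exact_mod_cast hsplit
  have hinj' := (Nat.cast_le (α := ℝ)).2 hinj
  linarith

end RandomLatin
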